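/- arXiv:math/0607461 — 2 statements merged into one kernel-verified Lean document; each statement's English description precedes it below -/
import Mathlib

section
/- Under Assumptions 1, 2, 3 and 4, let y₀ ∈ ℝⁿ be such that ∇ₓf(0,y₀) = 0 and ∇²ₓf(0,y₀) is positive definite. Then there exist a finite family of times 0 = t₀ < t₁ < ⋯ < t_{k−1} < t_k = T, functions u_i : [t_{i−1},t_i) → ℝⁿ of class C² (i = 1,…,k), and nonconstant functions v_i : ℝ → ℝⁿ of class C² (i = 1,…,k−1), such that: (1) u₁(0) = y₀; (2) for every i and every t ∈ [t_{i−1},t_i), ∇ₓf(t,u_i(t)) = 0 and ∇²ₓf(t,u_i(t)) is positive definite; (3) for every i = 1,…,k the limit x_i := lim_{t→t_i⁻} u_i(t) exists, and for i = 1,…,k−1 one has (t_i,x_i) ∈ Z_f, ∇²ₓf(t_i,x_i) is positive semidefinite, and, with ℓ as in Assumption 2, the quantities ∇ₓf_t(t_i,x_i)·ℓ and Σ_{i,j,k} ∂³f/∂x_i∂x_j∂x_k(t_i,x_i) ℓ_i ℓ_j ℓ_k have the same sign; (4) for every i = 1,…,k−1, v_i solves v̇_i(s) = −∇ₓf(t_i,v_i(s))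 with lim_{s→−∞} v_i(s) = x_i and lim_{s→+∞} v_i(s) = u_{i+1}(t_i). Moreover the family of times t_i and functions u_i is unique, and each v_i is unique up to time-translation. -/
open Set Filter Topology
open scoped RealInnerProductSpace

/-- The set of pairs `(t, ξ)` with `t ∈ [0,T]` such that `ξ` is a degenerate critical
point of `f t`. -/
noncomputable def degenerateCriticalSet {n : ℕ} (T : ℝ)
    (f : ℝ → EuclideanSpace ℝ (Fin n) → ℝ) :
    Set (ℝ × EuclideanSpace ℝ (Fin n)) :=
  {p | p.1 ∈ Set.Icc 0 T ∧ gradient (f p.1) p.2 = 0 ∧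
    LinearMap.det ((fderiv ℝ (gradient (f p.1)) p.2 :
      EuclideanSpace ℝ (Fin n) →L[ℝ] EuclideanSpace ℝ (Fin n)) :
      EuclideanSpace ℝ (Fin n) →ₗ[ℝ] EuclideanSpace ℝ (Fin n)) = 0}

/-- The Hessian of `f t` at `x` is positive definite. -/
noncomputable def HessPosDef {n : ℕ} (f : ℝ → EuclideanSpace ℝ (Fin n) → ℝ)
    (t : ℝ) (x : EuclideanSpace ℝ (Fin n)) : Prop :=
  ∀ y : EuclideanSpace ℝ (Fin n), y ≠ 0 → 0 < ⟪(fderiv ℝ (gradient (f t)) x) y, y⟫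

/-- The Hessian of `f t` at `x` is positive semidefinite. -/
noncomputable def HessPosSemidef {n : ℕ} (f : ℝ → EuclideanSpace ℝ (Fin n) → ℝ)
    (t : ℝ) (x : EuclideanSpace ℝ (Fin n)) : Prop :=
  ∀ y : EuclideanSpace ℝ (Fin n), 0 ≤ ⟪(fderiv ℝ (gradient (f t)) x) y, y⟫

/-- The gradient with respect to `x` of the partial derivative `f_t`. -/
noncomputable def gradft {n : ℕ} (f : ℝ → EuclideanSpace ℝ (Fin n) → ℝ)
    (t : ℝ) (x : EuclideanSpace ℝ (Fin n)) : EuclideanSpace ℝ (Fin n) :=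
  gradient (fun z => deriv (fun s => f s z) t) x

/-- The third spatial derivative of `f t` at `x` evaluated three times at `ℓ`. -/
noncomputable def thirdDeriv {n : ℕ} (f : ℝ → EuclideanSpace ℝ (Fin n) → ℝ)
    (t : ℝ) (x ℓ : EuclideanSpace ℝ (Fin n)) : ℝ :=
  iteratedFDeriv ℝ 3 (f t) x ![ℓ, ℓ, ℓ]

/-- The properties of the piecewise slow/fast structure of Proposition `p:u`:
times `0 = t₀ < t₁ < ⋯ < t_k = T`, slow branches `u i` on `[t_{i-1}, t_i)` made of
nondegenerate local minima, left limits `x_i` which for `i ≤ k-1` are degenerate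
critical points with same-sign transversality conditions, and heteroclinics `v i`
connecting `x_i` to `u_{i+1}(t_i)`. -/
noncomputable def SlowFastFamily {n : ℕ} (T : ℝ)
    (f : ℝ → EuclideanSpace ℝ (Fin n) → ℝ) (y₀ : EuclideanSpace ℝ (Fin n))
    (k : ℕ) (t : ℕ → ℝ) (u v : ℕ → ℝ → EuclideanSpace ℝ (Fin n)) : Prop :=
  1 ≤ k ∧ t 0 = 0 ∧ t k = T ∧ (∀ i < k, t i < t (i + 1)) ∧
  u 1 0 = y₀ ∧
  (∀ i, 1 ≤ i → i ≤ k →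
    ContDiffOn ℝ 2 (u i) (Set.Ico (t (i - 1)) (t i)) ∧
    ∀ s ∈ Set.Ico (t (i - 1)) (t i),
      gradient (f s) (u i s) = 0 ∧ HessPosDef f s (u i s)) ∧
  (∀ i, 1 ≤ i → i ≤ k →
    ∃ x : EuclideanSpace ℝ (Fin n),
      Tendsto (u i) (nhdsWithin (t i) (Set.Iio (t i))) (nhds x) ∧
      (i ≤ k - 1 →
        (t i, x) ∈ degenerateCriticalSet T f ∧
        HessPosSemidef f (t i) x ∧
        (∀ ℓ : EuclideanSpace ℝ (Fin n), ℓ ≠ 0 →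
          LinearMap.ker ((fderiv ℝ (gradient (f (t i))) x :
            EuclideanSpace ℝ (Fin n) →L[ℝ] EuclideanSpace ℝ (Fin n)) :
            EuclideanSpace ℝ (Fin n) →ₗ[ℝ] EuclideanSpace ℝ (Fin n)) = Submodule.span ℝ {ℓ} →
          0 < ⟪gradft f (t i) x, ℓ⟫ * thirdDeriv f (t i) x ℓ) ∧
        Tendsto (v i) atBot (nhds x))) ∧
  (∀ i, 1 ≤ i → i ≤ k - 1 →
    ContDiff ℝ 2 (v i) ∧
    (∃ s₁ s₂ : ℝ, v i s₁ ≠ v i s₂) ∧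
    (∀ s : ℝ, HasDerivAt (v i) (-(gradient (f (t i)) (v i s))) s) ∧
    Tendsto (v i) atTop (nhds (u (i + 1) (t i))))

section SpatialCalculus

variable {E F : Type*} [NormedAddCommGroup E] [NormedSpace ℝ E]
  [NormedAddCommGroup F] [NormedSpace ℝ F]

lemma uniqueDiffOn_strip {T : ℝ} (hT : 0 < T) :
    UniqueDiffOn ℝ (Icc 0 T ×ˢ (univ : Set E)) :=
  (uniqueDiffOn_Icc hT).prod uniqueDiffOn_univ

lemma contDiff_slice {k : WithTop ℕ∞}
    {T : ℝ} {g : ℝ × E → F}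
    (hg : ContDiffOn ℝ k g (Icc 0 T ×ˢ (univ : Set E))) {t : ℝ} (ht : t ∈ Icc 0 T) :
    ContDiff ℝ k (fun x => g (t, x)) := by
  rw [← contDiffOn_univ]
  exact hg.comp ((contDiff_const.prodMk contDiff_id).contDiffOn) fun y _ => ⟨ht, mem_univ _⟩

lemma hasFDerivAt_slice {T : ℝ} {g : ℝ × E → F}
    (hg : DifferentiableOn ℝ g (Icc 0 T ×ˢ (univ : Set E))) {t : ℝ} (ht : t ∈ Icc 0 T) (x : E) :
    HasFDerivAt (fun y => g (t, y))
      ((fderivWithin ℝ g (Icc 0 T ×ˢ (univ : Set E)) (t, x)).comp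
        (ContinuousLinearMap.inr ℝ ℝ E)) x := by
  have h1 := (hg (t, x) ⟨ht, mem_univ _⟩).hasFDerivWithinAt
  have h2 : HasFDerivWithinAt (fun y : E => (t, y)) (ContinuousLinearMap.inr ℝ ℝ E) univ x :=
    (hasFDerivAt_prodMk_right t x).hasFDerivWithinAt
  exact hasFDerivWithinAt_univ.1 (h1.comp x h2 fun y _ => ⟨ht, mem_univ _⟩)

lemma contDiffOn_fderiv_slice {T : ℝ} (hT : 0 < T) {g : ℝ × E → F} {m k : WithTop ℕ∞}
    (hg : ContDiffOn ℝ k g (Icc 0 T ×ˢ (univ : Set E))) (hmk : m + 1 ≤ k) :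
    ContDiffOn ℝ m (fun p : ℝ × E => fderiv ℝ (fun y => g (p.1, y)) p.2)
      (Icc 0 T ×ˢ (univ : Set E)) := by
  have h1 : ContDiffOn ℝ m (fderivWithin ℝ g (Icc 0 T ×ˢ (univ : Set E)))
      (Icc 0 T ×ˢ (univ : Set E)) := hg.fderivWithin (uniqueDiffOn_strip hT) hmk
  have hd : DifferentiableOn ℝ g (Icc 0 T ×ˢ (univ : Set E)) :=
    hg.differentiableOn (by
      intro h
      rw [h] at hmk
      simp at hmk)
  have h2 := h1.clm_comp (g := fun p => fderivWithin ℝ g (Icc 0 T ×ˢ (univ : Set E)) p)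
    (contDiffOn_const (c := ContinuousLinearMap.inr ℝ ℝ E))
  refine h2.congr fun p hp => ?_
  exact (hasFDerivAt_slice hd hp.1 p.2).fderiv

end SpatialCalculus

section GradientCalculus

variable {E : Type*} [NormedAddCommGroup E] [InnerProductSpace ℝ E] [CompleteSpace E]

lemma contDiffOn_gradient_slice {T : ℝ} (hT : 0 < T) {f : ℝ → E → ℝ}
    (hf : ContDiffOn ℝ 3 (Function.uncurry f) (Icc 0 T ×ˢ (univ : Set E))) :
    ContDiffOn ℝ 2 (fun p : ℝ × E => gradient (f p.1) p.2) (Icc 0 T ×ˢ (univ : Set E)) := by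
  have h1 := contDiffOn_fderiv_slice hT (m := 2) hf (by norm_num)
  exact (InnerProductSpace.toDual ℝ E).symm.toContinuousLinearEquiv.contDiff.comp_contDiffOn h1

lemma contDiff_gradient {f : E → ℝ} {m k : WithTop ℕ∞} (hf : ContDiff ℝ k f)
    (hmk : m + 1 ≤ k) : ContDiff ℝ m (gradient f) :=
  (InnerProductSpace.toDual ℝ E).symm.toContinuousLinearEquiv.contDiff.comp
    (hf.fderiv_right hmk)

lemma fderiv_gradient_apply {f : E → ℝ} (hf : ContDiff ℝ 2 f) (x y z : E) :
    ⟪fderiv ℝ (gradient f) x y, z⟫ = fderiv ℝ (fderiv ℝ f) x y z := by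
  have h1 : HasFDerivAt (fderiv ℝ f) (fderiv ℝ (fderiv ℝ f) x) x :=
    ((hf.fderiv_right (m := 1) (by norm_num)).differentiable (by norm_num) x).hasFDerivAt
  have h2 : HasFDerivAt (gradient f) (fderiv ℝ (gradient f) x) x :=
    ((contDiff_gradient (m := 1) hf (by norm_num)).differentiable (by norm_num) x).hasFDerivAt
  have h3 := h2.inner ℝ (hasFDerivAt_const z x)
  have h4 := h1.clm_apply (hasFDerivAt_const z x)
  have h5 : (fun t => ⟪gradient f t, z⟫) = fun t => fderiv ℝ f t z := by
    ext t; exact inner_gradient_left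
  rw [h5] at h3
  have h6 := congrArg (fun L : E →L[ℝ] ℝ => L y) (h3.unique h4)
  simpa using h6

lemma fderiv_gradient_symm {f : E → ℝ} (hf : ContDiff ℝ 2 f) (x y z : E) :
    ⟪fderiv ℝ (gradient f) x y, z⟫ = ⟪fderiv ℝ (gradient f) x z, y⟫ := by
  rw [fderiv_gradient_apply hf, fderiv_gradient_apply hf]
  exact (hf.contDiffAt.isSymmSndFDerivAt (by simp)) y z

lemma iteratedFDeriv_three_eq {f : E → ℝ} (hf : ContDiff ℝ 3 f) (x l : E) :
    iteratedFDeriv ℝ 3 f x ![l, l, l] =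
      fderiv ℝ (fderiv ℝ (fun y => ⟪gradient f y, l⟫)) x l l := by
  have h0 : (fun y => ⟪gradient f y, l⟫) =
      (ContinuousLinearMap.apply ℝ ℝ l) ∘ (fun y => fderiv ℝ f y) := by
    ext y; simp [inner_gradient_left]
  have h1 : ContDiff ℝ 2 (fun y => fderiv ℝ f y) := hf.fderiv_right (by norm_num)
  have h2 := iteratedFDeriv_two_apply (𝕜 := ℝ) (fun y => ⟪gradient f y, l⟫) x ![l, l]
  rw [iteratedFDeriv_succ_apply_right]
  simp only [Matrix.cons_val_zero, Matrix.cons_val_one] at h2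
  rw [← h2, h0, (ContinuousLinearMap.apply ℝ ℝ l).iteratedFDeriv_comp_left h1.contDiffAt
    (i := 2) (by norm_num)]
  refine congrArg (fun z : Fin 2 → E => iteratedFDeriv ℝ 2 (fun y => fderiv ℝ f y) x z l)
    (funext fun i => ?_)
  fin_cases i <;> rfl

lemma hasDerivAt_inner_gradient_time {T : ℝ} {f : ℝ → E → ℝ}
    (hf : ContDiffOn ℝ 3 (Function.uncurry f) (Icc 0 T ×ˢ (univ : Set E)))
    {t : ℝ} (ht : t ∈ Ioo 0 T) (x l : E) :
    HasDerivAt (fun s => ⟪gradient (f s) x, l⟫)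
      ⟪gradient (fun z => deriv (fun s => f s z) t) x, l⟫ t := by
  set φ := Function.uncurry f with hφ
  have hat : ∀ s ∈ Ioo 0 T, ∀ z : E, ContDiffAt ℝ 3 φ (s, z) := fun s hs z =>
    hf.contDiffAt (prod_mem_nhds (Icc_mem_nhds hs.1 hs.2) univ_mem)
  have hd : ∀ s ∈ Ioo 0 T, ∀ z : E, HasFDerivAt φ (fderiv ℝ φ (s, z)) (s, z) := fun s hs z =>
    ((hat s hs z).differentiableAt (by norm_num)).hasFDerivAt
  have h2 : ContDiffAt ℝ 2 (fderiv ℝ φ) (t, x) := (hat t ht x).fderiv_right (by norm_num)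
  have h2' : HasFDerivAt (fderiv ℝ φ) (fderiv ℝ (fderiv ℝ φ) (t, x)) (t, x) :=
    (h2.differentiableAt (by norm_num)).hasFDerivAt
  have ht1 : ∀ z, deriv (fun s => f s z) t = fderiv ℝ φ (t, z) (1, 0) := fun z => by
    have := (hd t ht z).comp_hasDerivAt t
      (f := fun s => (s, z)) ((hasDerivAt_id t).prodMk (hasDerivAt_const t z))
    exact this.deriv
  have hx1 : ∀ s ∈ Ioo 0 T, ⟪gradient (f s) x, l⟫ = fderiv ℝ φ (s, x) (0, l) := fun s hs => by
    rw [inner_gradient_left]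
    have := (hd s hs x).comp x (f := fun y => (s, y)) (hasFDerivAt_prodMk_right s x)
    have h3 : fderiv ℝ (f s) x = _ := this.fderiv
    rw [h3]; simp
  have e1 : ⟪gradient (fun z => deriv (fun s => f s z) t) x, l⟫ =
      fderiv ℝ (fderiv ℝ φ) (t, x) (0, l) (1, 0) := by
    rw [inner_gradient_left]
    have h4 : (fun z => deriv (fun s => f s z) t) = fun z => fderiv ℝ φ (t, z) (1, 0) :=
      funext ht1
    rw [h4]
    have h50 : HasFDerivAt (fun y => fderiv ℝ φ (t, y))
        ((fderiv ℝ (fderiv ℝ φ) (t, x)).comp (ContinuousLinearMap.inr ℝ ℝ E)) x := by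
      have hr : HasFDerivAt (fun y : E => (t, y)) (ContinuousLinearMap.inr ℝ ℝ E) x :=
        hasFDerivAt_prodMk_right t x
      exact HasFDerivAt.comp (g := fderiv ℝ φ) (f := fun y : E => (t, y)) x h2' hr
    have h5 := h50.clm_apply (hasFDerivAt_const ((1 : ℝ), (0 : E)) x)
    have h6 : fderiv ℝ (fun z => fderiv ℝ φ (t, z) (1, 0)) x = _ := h5.fderiv
    rw [h6]; simp
  have h70 : HasDerivAt (fun s => fderiv ℝ φ (s, x)) (fderiv ℝ (fderiv ℝ φ) (t, x) (1, 0)) t :=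
    HasFDerivAt.comp_hasDerivAt (l := fderiv ℝ φ) t h2'
      ((hasDerivAt_id t).prodMk (hasDerivAt_const t x))
  have h7 := h70.clm_apply (hasDerivAt_const t ((0 : ℝ), l))
  have sym := (hat t ht x).isSymmSndFDerivAt (by simp; norm_num)
  rw [e1, sym]
  have h8 : (fun s => ⟪gradient (f s) x, l⟫) =ᶠ[𝓝 t] fun s => fderiv ℝ φ (s, x) (0, l) := by
    filter_upwards [Ioo_mem_nhds ht.1 ht.2] with s hs using hx1 s hs
  refine HasDerivAt.congr_of_eventuallyEq ?_ h8
  simpa using h7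

end GradientCalculus

section PosDef

variable {E : Type*} [NormedAddCommGroup E] [InnerProductSpace ℝ E]

/-- The quadratic form `y ↦ ⟪A y, y⟫` is positive definite. -/
def PosDefForm (A : E →L[ℝ] E) : Prop := ∀ y, y ≠ 0 → 0 < ⟪A y, y⟫

/-- The quadratic form `y ↦ ⟪A y, y⟫` is positive semidefinite. -/
def PosSemidefForm (A : E →L[ℝ] E) : Prop := ∀ y, 0 ≤ ⟪A y, y⟫

lemma exists_pos_mul_sq_le_inner [FiniteDimensional ℝ E] (A : E →L[ℝ] E) (K : Submodule ℝ E)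
    (hA : ∀ y ∈ K, y ≠ 0 → 0 < ⟪A y, y⟫) :
    ∃ m > 0, ∀ y ∈ K, m * ‖y‖ ^ 2 ≤ ⟪A y, y⟫ := by
  have hcomp : IsCompact (Metric.sphere (0 : E) 1 ∩ K) :=
    (isCompact_sphere 0 1).inter_right K.closed_of_finiteDimensional
  have hcont : ContinuousOn (fun y => ⟪A y, y⟫) (Metric.sphere (0 : E) 1 ∩ K) := by
    fun_prop
  rcases (Metric.sphere (0 : E) 1 ∩ K).eq_empty_or_nonempty with he | hne
  · refine ⟨1, one_pos, fun y hy => ?_⟩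
    rcases eq_or_ne y 0 with rfl | h0
    · simp
    · exfalso
      have : (‖y‖⁻¹ • y) ∈ Metric.sphere (0 : E) 1 ∩ K :=
        ⟨by simp [norm_smul, h0], K.smul_mem _ hy⟩
      rw [he] at this
      exact this
  · obtain ⟨x, hx, hmin⟩ := hcomp.exists_isMinOn hne hcont
    have hx0 : x ≠ 0 := by
      rintro rfl
      simpa using hx.1
    refine ⟨⟪A x, x⟫, hA x hx.2 hx0, fun y hy => ?_⟩
    rcases eq_or_ne y 0 with rfl | h0
    · simp
    · have hmem : (‖y‖⁻¹ • y) ∈ Metric.sphere (0 : E) 1 ∩ K :=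
        ⟨by simp [norm_smul, h0], K.smul_mem _ hy⟩
      have h1 : ⟪A x, x⟫ ≤ ⟪A (‖y‖⁻¹ • y), ‖y‖⁻¹ • y⟫ := hmin hmem
      rw [map_smul, real_inner_smul_left, real_inner_smul_right] at h1
      have hn : 0 < ‖y‖ := norm_pos_iff.2 h0
      calc ⟪A x, x⟫ * ‖y‖ ^ 2 ≤ (‖y‖⁻¹ * (‖y‖⁻¹ * ⟪A y, y⟫)) * ‖y‖ ^ 2 := by gcongr
        _ = ⟪A y, y⟫ := by field_simp

lemma PosDefForm.exists_pos_mul_sq_le [FiniteDimensional ℝ E] {A : E →L[ℝ] E}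
    (hA : PosDefForm A) : ∃ m > 0, ∀ y, m * ‖y‖ ^ 2 ≤ ⟪A y, y⟫ := by
  obtain ⟨m, hm, h⟩ := exists_pos_mul_sq_le_inner A ⊤ fun y _ => hA y
  exact ⟨m, hm, fun y => h y trivial⟩

lemma PosDefForm.posSemidefForm {A : E →L[ℝ] E} (hA : PosDefForm A) : PosSemidefForm A := by
  intro y
  rcases eq_or_ne y 0 with rfl | h
  · simp
  · exact (hA y h).le

lemma PosDefForm.ker_eq_bot {A : E →L[ℝ] E} (hA : PosDefForm A) :
    LinearMap.ker (A : E →ₗ[ℝ] E) = ⊥ := by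
  rw [LinearMap.ker_eq_bot']
  intro y hy
  by_contra h
  have := hA y h
  rw [show A y = 0 from hy] at this
  simp at this

lemma PosDefForm.det_ne_zero [FiniteDimensional ℝ E] {A : E →L[ℝ] E} (hA : PosDefForm A) :
    LinearMap.det (A : E →ₗ[ℝ] E) ≠ 0 := by
  intro h
  exact LinearMap.bot_lt_ker_of_det_eq_zero h |>.ne' hA.ker_eq_bot

lemma PosSemidefForm.apply_eq_zero {A : E →L[ℝ] E} (hA : PosSemidefForm A)
    (hs : ∀ y z, ⟪A y, z⟫ = ⟪A z, y⟫) {y : E} (hy : ⟪A y, y⟫ = 0) : A y = 0 := by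
  have key : ∀ s : ℝ, 0 ≤ 2 * s * ‖A y‖ ^ 2 + s ^ 2 * ⟪A (A y), A y⟫ := by
    intro s
    have h := hA (y + s • A y)
    have e : ⟪A (y + s • A y), y + s • A y⟫ =
        2 * s * ‖A y‖ ^ 2 + s ^ 2 * ⟪A (A y), A y⟫ := by
      have h1 := hs (A y) y
      simp only [map_add, map_smul, inner_add_left, inner_add_right, real_inner_smul_left,
        real_inner_smul_right, hy, h1, real_inner_self_eq_norm_sq]
      ring
    linarith
  by_contra hne
  have hp : 0 < ‖A y‖ ^ 2 := by positivity
  set c := ⟪A (A y), A y⟫ with hc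
  have hc0 : 0 ≤ c := hA _
  have h := key (-(‖A y‖ ^ 2 / (c + 1)))
  have h2 : 2 * -(‖A y‖ ^ 2 / (c + 1)) * ‖A y‖ ^ 2 + (-(‖A y‖ ^ 2 / (c + 1))) ^ 2 * c =
      -(‖A y‖ ^ 4 * (c + 2) / (c + 1) ^ 2) := by
    field_simp
    ring
  rw [h2] at h
  have : 0 < ‖A y‖ ^ 4 * (c + 2) / (c + 1) ^ 2 := by positivity
  linarith

lemma PosSemidefForm.posDefForm_of_det_ne_zero [FiniteDimensional ℝ E] {A : E →L[ℝ] E}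
    (hA : PosSemidefForm A) (hs : ∀ y z, ⟪A y, z⟫ = ⟪A z, y⟫)
    (hdet : LinearMap.det (A : E →ₗ[ℝ] E) ≠ 0) : PosDefForm A := by
  intro y hy
  refine lt_of_le_of_ne (hA y) fun h0 => hy ?_
  have h1 := hA.apply_eq_zero hs h0.symm
  have h2 : LinearMap.ker (A : E →ₗ[ℝ] E) = ⊥ :=
    (LinearMap.isUnit_iff_ker_eq_bot _).1
      ((LinearMap.isUnit_iff_isUnit_det _).2 (isUnit_iff_ne_zero.2 hdet))
  exact (LinearMap.ker_eq_bot'.1 h2) y h1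

end PosDef

section Branches

variable {E : Type*} [NormedAddCommGroup E] [InnerProductSpace ℝ E]

lemma inner_sub_ge_of_fderiv_ge {g : E → E} (hg : Differentiable ℝ g) {s : Set E}
    (hs : Convex ℝ s) {m : ℝ} (hm : ∀ x ∈ s, ∀ y, m * ‖y‖ ^ 2 ≤ ⟪fderiv ℝ g x y, y⟫)
    {x x' : E} (hx : x ∈ s) (hx' : x' ∈ s) :
    m * ‖x - x'‖ ^ 2 ≤ ⟪g x - g x', x - x'⟫ := by
  have hd : ∀ c : ℝ, HasDerivAt (fun c : ℝ => ⟪g (x' + c • (x - x')), x - x'⟫)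
      ⟪fderiv ℝ g (x' + c • (x - x')) (x - x'), x - x'⟫ c := by
    intro c
    have h1 : HasDerivAt (fun c : ℝ => x' + c • (x - x')) (x - x') c := by
      simpa using ((hasDerivAt_id c).smul_const (x - x')).const_add x'
    have h2 := ((hg (x' + c • (x - x'))).hasFDerivAt.comp_hasDerivAt c h1)
    simpa using h2.inner ℝ (hasDerivAt_const c (x - x'))
  obtain ⟨c, hc, he⟩ := exists_hasDerivAt_eq_slope _ _ (zero_lt_one)
    (fun c _ => (hd c).continuousAt.continuousWithinAt) (fun c _ => hd c)
  have hmem : x' + c • (x - x') ∈ s := by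
    have := hs.add_smul_sub_mem hx' hx ⟨hc.1.le, hc.2.le⟩
    exact this
  have := hm _ hmem (x - x')
  rw [he] at this
  simpa [← inner_sub_left] using this

/-- `u` is a continuous branch of nondegenerate stable zeros of `G` over the set `I`. -/
def IsBranch (G : ℝ → E → E) (u : ℝ → E) (I : Set ℝ) : Prop :=
  ContinuousOn u I ∧ ∀ t ∈ I, G t (u t) = 0 ∧ PosDefForm (fderiv ℝ (G t) (u t))

lemma IsBranch.mono {G : ℝ → E → E} {u : ℝ → E} {I J : Set ℝ} (h : IsBranch G u I)
    (hJ : J ⊆ I) : IsBranch G u J :=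
  ⟨h.1.mono hJ, fun t ht => h.2 t (hJ ht)⟩

variable [FiniteDimensional ℝ E]

lemma exists_nhds_uniform_posDef {T : ℝ} (hT : 0 < T) {G : ℝ → E → E}
    (hG : ContDiffOn ℝ 2 (fun p : ℝ × E => G p.1 p.2) (Icc 0 T ×ˢ (univ : Set E)))
    {t₀ : ℝ} (ht₀ : t₀ ∈ Icc 0 T) {x₀ : E} (hpd : PosDefForm (fderiv ℝ (G t₀) x₀)) :
    ∃ m > 0, ∃ ε > 0, ∃ r > 0, ∀ t ∈ Icc 0 T, |t - t₀| < ε → ∀ x ∈ Metric.closedBall x₀ r,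
      ∀ y, m * ‖y‖ ^ 2 ≤ ⟪fderiv ℝ (G t) x y, y⟫ := by
  obtain ⟨m, hm, h⟩ := hpd.exists_pos_mul_sq_le
  have hc : ContinuousOn (fun p : ℝ × E => fderiv ℝ (G p.1) p.2) (Icc 0 T ×ˢ (univ : Set E)) :=
    (contDiffOn_fderiv_slice hT hG (m := 1) (by norm_num)).continuousOn
  have hc' := hc (t₀, x₀) ⟨ht₀, mem_univ _⟩
  rw [Metric.continuousWithinAt_iff] at hc'
  obtain ⟨δ, hδ, hb⟩ := hc' (m / 2) (by positivity)
  refine ⟨m / 2, by positivity, δ, hδ, δ / 2, by positivity, fun t ht htt x hx y => ?_⟩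
  have h1 := hb (x := (t, x)) ⟨ht, mem_univ _⟩ (by
    rw [Prod.dist_eq, max_lt_iff]
    exact ⟨by simpa [Real.dist_eq] using htt, (Metric.mem_closedBall.1 hx).trans_lt (by linarith)⟩)
  rw [dist_eq_norm] at h1
  have h2 : |⟪(fderiv ℝ (G t) x - fderiv ℝ (G t₀) x₀) y, y⟫| ≤ m / 2 * ‖y‖ ^ 2 := by
    calc _ ≤ ‖(fderiv ℝ (G t) x - fderiv ℝ (G t₀) x₀) y‖ * ‖y‖ := abs_real_inner_le_norm _ _
      _ ≤ (m / 2 * ‖y‖) * ‖y‖ := by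
        gcongr
        exact ContinuousLinearMap.le_of_opNorm_le _ h1.le y
      _ = _ := by ring
  have h3 := h y
  have h4 : ⟪fderiv ℝ (G t) x y, y⟫ = ⟪fderiv ℝ (G t₀) x₀ y, y⟫ +
      ⟪(fderiv ℝ (G t) x - fderiv ℝ (G t₀) x₀) y, y⟫ := by
    rw [sub_apply, inner_sub_left]; ring
  have := (abs_le.1 h2).1
  linarith

lemma exists_gradient_eq_zero_of_mono {φ : E → ℝ} (hφ : Differentiable ℝ φ) {x₀ : E} {r m : ℝ}
    (hr : 0 < r)
    (hm : ∀ x ∈ Metric.closedBall x₀ r,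
      m * ‖x - x₀‖ ^ 2 ≤ ⟪gradient φ x - gradient φ x₀, x - x₀⟫)
    (hsmall : ‖gradient φ x₀‖ < m * r) :
    ∃ x ∈ Metric.closedBall x₀ r, gradient φ x = 0 := by
  obtain ⟨x, hx, hmin⟩ := (isCompact_closedBall x₀ r).exists_isMinOn
    ⟨x₀, Metric.mem_closedBall_self hr.le⟩ hφ.continuous.continuousOn
  refine ⟨x, hx, ?_⟩
  have hgrad : HasFDerivAt φ (fderiv ℝ φ x) x := (hφ x).hasFDerivAt
  by_cases hb : x ∈ Metric.ball x₀ r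
  · have hloc : IsLocalMin φ x := hmin.isLocalMin (Metric.closedBall_mem_nhds_of_mem hb)
    rw [gradient, hloc.fderiv_eq_zero, map_zero]
  · exfalso
    have hxr : ‖x - x₀‖ = r := by
      rw [Metric.mem_closedBall, dist_eq_norm] at hx
      rw [Metric.mem_ball, dist_eq_norm, not_lt] at hb
      exact le_antisymm hx hb
    have h1 : 0 ≤ fderiv ℝ φ x (x₀ - x) := by
      refine hmin.localize.hasFDerivWithinAt_nonneg hgrad.hasFDerivWithinAt ?_
      exact sub_mem_posTangentConeAt_of_segment_subset
        ((convex_closedBall x₀ r).segment_subset hx (Metric.mem_closedBall_self hr.le))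
    rw [← inner_gradient_left] at h1
    have h2 := hm x hx
    rw [hxr, inner_sub_left] at h2
    have h3 : ⟪gradient φ x, x₀ - x⟫ = -⟪gradient φ x, x - x₀⟫ := by
      rw [← inner_neg_right, neg_sub]
    have h4 : -(⟪gradient φ x₀, x - x₀⟫) ≤ ‖gradient φ x₀‖ * r := by
      rw [← hxr]
      exact (neg_le_abs _).trans (abs_real_inner_le_norm _ _)
    nlinarith

/-- Local description of the zeros near a nondegenerate stable zero: a radius `r` and a
time-window on which zeros in the ball are unique, stable, and depend continuously on time. -/
lemma exists_local_branch {T : ℝ} (hT : 0 < T) {f : ℝ → E → ℝ}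
    (hf : ContDiffOn ℝ 3 (Function.uncurry f) (Icc 0 T ×ˢ (univ : Set E)))
    {t₀ : ℝ} (ht₀ : t₀ ∈ Icc 0 T) {x₀ : E} (hx₀ : gradient (f t₀) x₀ = 0)
    (hpd : PosDefForm (fderiv ℝ (gradient (f t₀)) x₀)) :
    ∃ ε > 0, ∃ r > 0, ∃ w : ℝ → E, w t₀ = x₀ ∧
      IsBranch (fun t => gradient (f t)) w (Icc 0 T ∩ Ioo (t₀ - ε) (t₀ + ε)) ∧
      ∀ t ∈ Icc 0 T ∩ Ioo (t₀ - ε) (t₀ + ε), ∀ x ∈ Metric.closedBall x₀ r,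
        gradient (f t) x = 0 → x = w t := by
  have hG := contDiffOn_gradient_slice hT hf
  obtain ⟨m, hm, ε₁, hε₁, r, hr, hpos⟩ := exists_nhds_uniform_posDef hT
    (G := fun t => gradient (f t)) hG ht₀ hpd
  have hmono : ∀ t ∈ Icc 0 T, |t - t₀| < ε₁ → ∀ x ∈ Metric.closedBall x₀ r,
      ∀ x' ∈ Metric.closedBall x₀ r,
      m * ‖x - x'‖ ^ 2 ≤ ⟪gradient (f t) x - gradient (f t) x', x - x'⟫ :=
    fun t ht htt x hx x' hx' =>
    inner_sub_ge_of_fderiv_ge ((contDiff_slice hG ht).differentiable (by norm_num))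
      (convex_closedBall x₀ r) (hpos t ht htt) hx hx'
  have hcont : ∀ x : E, ContinuousOn (fun t => gradient (f t) x) (Icc 0 T) := fun x =>
    hG.continuousOn.comp (f := fun t : ℝ => (t, x)) (by fun_prop) fun t ht => ⟨ht, mem_univ _⟩
  have hsm := hcont x₀ t₀ ht₀
  rw [Metric.continuousWithinAt_iff] at hsm
  obtain ⟨ε₂, hε₂, hsm⟩ := hsm (m * r) (by positivity)
  have hI : ∀ t ∈ Icc 0 T ∩ Ioo (t₀ - min ε₁ ε₂) (t₀ + min ε₁ ε₂),
      t ∈ Icc 0 T ∧ |t - t₀| < ε₁ ∧ |t - t₀| < ε₂ := by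
    rintro t ⟨ht, h1, h2⟩
    have : |t - t₀| < min ε₁ ε₂ := by rw [abs_lt]; constructor <;> linarith
    exact ⟨ht, lt_min_iff.1 this⟩
  have hex : ∀ t ∈ Icc 0 T ∩ Ioo (t₀ - min ε₁ ε₂) (t₀ + min ε₁ ε₂),
      ∃ x ∈ Metric.closedBall x₀ r, gradient (f t) x = 0 := by
    intro t ht
    obtain ⟨h0, h1, h2⟩ := hI t ht
    refine exists_gradient_eq_zero_of_mono
      ((contDiff_slice (g := Function.uncurry f) hf h0).differentiable (by norm_num)) hr
      (fun x hx => hmono t h0 h1 x hx x₀ (Metric.mem_closedBall_self hr.le)) ?_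
    have := hsm h0 (by simpa [Real.dist_eq] using h2)
    simpa [hx₀] using this
  have huniq : ∀ t ∈ Icc 0 T ∩ Ioo (t₀ - min ε₁ ε₂) (t₀ + min ε₁ ε₂),
      ∀ x ∈ Metric.closedBall x₀ r, ∀ x' ∈ Metric.closedBall x₀ r,
      gradient (f t) x' = 0 → m * ‖x - x'‖ ≤ ‖gradient (f t) x‖ := by
    intro t ht x hx x' hx' h'
    obtain ⟨h0, h1, h2⟩ := hI t ht
    have h3 := hmono t h0 h1 x hx x' hx'
    rw [h', sub_zero] at h3
    rcases (norm_nonneg (x - x')).eq_or_lt with he | hlt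
    · rw [← he, mul_zero]; positivity
    · have h4 := real_inner_le_norm (gradient (f t) x) (x - x')
      refine le_of_mul_le_mul_right ?_ hlt
      nlinarith
  choose! w hwmem hwz using hex
  have hε : 0 < min ε₁ ε₂ := lt_min hε₁ hε₂
  have ht₀I : t₀ ∈ Icc 0 T ∩ Ioo (t₀ - min ε₁ ε₂) (t₀ + min ε₁ ε₂) :=
    ⟨ht₀, by constructor <;> linarith⟩
  have heq : ∀ t ∈ Icc 0 T ∩ Ioo (t₀ - min ε₁ ε₂) (t₀ + min ε₁ ε₂),
      ∀ x ∈ Metric.closedBall x₀ r, gradient (f t) x = 0 → x = w t := by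
    intro t ht x hx h
    have h1 := huniq t ht x hx (w t) (hwmem t ht) (hwz t ht)
    rw [h, norm_zero] at h1
    have h2 : ‖x - w t‖ ≤ 0 := by
      by_contra hc
      push Not at hc
      nlinarith
    exact sub_eq_zero.1 (norm_le_zero_iff.1 h2)
  refine ⟨min ε₁ ε₂, hε, r, hr, w, (heq t₀ ht₀I x₀ (Metric.mem_closedBall_self hr.le) hx₀).symm,
    ⟨fun s hs => ?_, fun t ht => ⟨hwz t ht, ?_⟩⟩, heq⟩
  · have h1 : Tendsto (fun t => m⁻¹ * ‖gradient (f t) (w s)‖)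
        (𝓝[Icc 0 T ∩ Ioo (t₀ - min ε₁ ε₂) (t₀ + min ε₁ ε₂)] s) (𝓝 0) := by
      have h2 := ((hcont (w s) s hs.1).mono (s := Icc 0 T ∩
        Ioo (t₀ - min ε₁ ε₂) (t₀ + min ε₁ ε₂)) inter_subset_left).norm.const_mul m⁻¹
      have h3 : gradient (f s) (w s) = 0 := hwz s hs
      have h4 := h2.tendsto
      rwa [h3, norm_zero, mul_zero] at h4
    rw [ContinuousWithinAt, tendsto_iff_norm_sub_tendsto_zero]
    refine squeeze_zero' (Eventually.of_forall fun _ => norm_nonneg _) ?_ h1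
    filter_upwards [self_mem_nhdsWithin] with t ht
    have h5 := huniq t ht (w s) (hwmem s hs) (w t) (hwmem t ht) (hwz t ht)
    rw [norm_sub_rev]
    rw [inv_mul_eq_div, le_div_iff₀ hm]
    linarith
  · intro y hy
    obtain ⟨h0, h1, -⟩ := hI t ht
    have := hpos t h0 h1 (w t) (hwmem t ht) y
    have hy' : 0 < m * ‖y‖ ^ 2 := by positivity
    exact hy'.trans_le this

end Branches

section BranchRegularity

variable {E : Type*} [NormedAddCommGroup E] [InnerProductSpace ℝ E]

/-- The derivative of a continuous zero branch of `g` at a point where the spatial derivative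
is invertible. -/
lemma hasDerivWithinAt_of_implicit {g : ℝ × E → E} {S : Set (ℝ × E)} {u : ℝ → E} {I : Set ℝ}
    {s : ℝ} (hs : s ∈ I) {D : ℝ × E →L[ℝ] E} (hg : HasFDerivWithinAt g D S (s, u s))
    (hu : ContinuousWithinAt u I s) (hmem : ∀ t ∈ I, (t, u t) ∈ S) (hz : ∀ t ∈ I, g (t, u t) = 0)
    (e : E ≃L[ℝ] E) (he : (e : E →L[ℝ] E) = D.comp (ContinuousLinearMap.inr ℝ ℝ E)) :
    HasDerivWithinAt u (-(e.symm (D (1, 0)))) I s := by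
  set c := -(e.symm (D (1, 0))) with hc
  have htend : Tendsto (fun t => (t, u t)) (𝓝[I] s) (𝓝[S] (s, u s)) := by
    refine tendsto_nhdsWithin_iff.2 ⟨?_, ?_⟩
    · exact (tendsto_id.mono_left nhdsWithin_le_nhds).prodMk_nhds hu
    · filter_upwards [self_mem_nhdsWithin] with t ht using hmem t ht
  have h1 := hg.isLittleO.comp_tendsto htend
  have h2 : (fun t => e.symm (D ((t, u t) - (s, u s)))) =o[𝓝[I] s]
      fun t => (t, u t) - (s, u s) := by
    refine (((e.symm : E →L[ℝ] E).isBigO_comp _ _).trans_isLittleO ?_)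
    refine (Asymptotics.IsLittleO.neg_left h1).congr' ?_ (EventuallyEq.rfl)
    filter_upwards [self_mem_nhdsWithin] with t ht
    simp only [Function.comp_apply, hz t ht, hz s hs, sub_self, zero_sub, neg_neg]
  have h3 : ∀ t, e.symm (D ((t, u t) - (s, u s))) = u t - u s - (t - s) • c := by
    intro t
    have : D ((t, u t) - (s, u s)) = (t - s) • D (1, 0) + e (u t - u s) := by
      have h4 : e (u t - u s) = D (0, u t - u s) := by
        have := congrArg (fun L : E →L[ℝ] E => L (u t - u s)) he
        simpa using this
      rw [h4, ← map_smul, ← map_add]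
      simp
    rw [this, map_add, map_smul, e.symm_apply_apply, hc]
    simp [add_comm]
  simp_rw [h3] at h2
  have h5 : (fun t => ((0 : ℝ), u t - u s - (t - s) • c)) =o[𝓝[I] s]
      fun t => (t, u t) - (s, u s) := by
    refine Asymptotics.IsLittleO.of_norm_left ?_
    simpa using h2.norm_left
  have h6 := h5.right_isBigO_sub
  have h7 : (fun t => (t, u t) - (s, u s)) =O[𝓝[I] s] fun t => t - s := by
    refine h6.trans ?_
    refine Asymptotics.IsBigO.of_bound (1 + ‖c‖) (Eventually.of_forall fun t => ?_)
    have : (t, u t) - (s, u s) - ((0 : ℝ), u t - u s - (t - s) • c) = (t - s) • ((1 : ℝ), c) := by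
      simp
    rw [this, norm_smul, mul_comm]
    gcongr
    rw [Prod.norm_def]
    refine max_le ?_ ?_ <;> simp
  rw [hasDerivWithinAt_iff_isLittleO]
  exact h2.trans_isBigO h7

variable [FiniteDimensional ℝ E]

lemma PosDefForm.exists_equiv {A : E →L[ℝ] E} (hA : PosDefForm A) :
    ∃ e : E ≃L[ℝ] E, (e : E →L[ℝ] E) = A := by
  have hinj : Function.Injective (A : E →ₗ[ℝ] E) := LinearMap.ker_eq_bot.1 hA.ker_eq_bot
  refine ⟨(LinearEquiv.ofInjectiveEndo (A : E →ₗ[ℝ] E) hinj).toContinuousLinearEquiv, ?_⟩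
  ext y
  rfl

lemma IsBranch.contDiffOn {T : ℝ} (hT : 0 < T) {G : ℝ → E → E}
    (hG : ContDiffOn ℝ 2 (fun p : ℝ × E => G p.1 p.2) (Icc 0 T ×ˢ (univ : Set E)))
    {u : ℝ → E} {a b : ℝ} (hI : Ico a b ⊆ Icc 0 T) (hu : IsBranch G u (Ico a b)) :
    ContDiffOn ℝ 2 u (Ico a b) := by
  set S := Icc 0 T ×ˢ (univ : Set E) with hS
  set g : ℝ × E → E := fun p => G p.1 p.2 with hg
  have hmem : ∀ t ∈ Ico a b, (t, u t) ∈ S := fun t ht => ⟨hI ht, mem_univ _⟩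
  have hgd : DifferentiableOn ℝ g S := hG.differentiableOn (by norm_num)
  have hH : ContDiffOn ℝ 1 (fun p : ℝ × E => fderiv ℝ (G p.1) p.2) S :=
    contDiffOn_fderiv_slice hT hG (by norm_num)
  have hD : ContDiffOn ℝ 1 (fun p => fderivWithin ℝ g S p (1, 0)) S :=
    (hG.fderivWithin (uniqueDiffOn_strip hT) (by norm_num)).clm_apply contDiffOn_const
  have hder : ∀ s ∈ Ico a b, HasDerivWithinAt u
      (-((fderiv ℝ (G s) (u s)).inverse (fderivWithin ℝ g S (s, u s) (1, 0)))) (Ico a b) s := by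
    intro s hs
    obtain ⟨e, he⟩ := (hu.2 s hs).2.exists_equiv
    have h1 := hasDerivWithinAt_of_implicit hs
      (hgd (s, u s) (hmem s hs)).hasFDerivWithinAt (hu.1 s hs) hmem (fun t ht => (hu.2 t ht).1) e
      (by rw [he]; exact (hasFDerivAt_slice hgd (hI hs) (u s)).fderiv)
    rw [← he, ContinuousLinearMap.inverse_equiv]
    exact h1
  have hUD : UniqueDiffOn ℝ (Ico a b) := uniqueDiffOn_Ico a b
  have hdiff : DifferentiableOn ℝ u (Ico a b) := fun s hs => (hder s hs).differentiableWithinAt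
  have step : ∀ m : WithTop ℕ∞, m ≤ 1 → m ≠ ⊤ → ContDiffOn ℝ m u (Ico a b) →
      ContDiffOn ℝ (m + 1) u (Ico a b) := by
    intro m hm hmt hum
    rw [contDiffOn_succ_iff_derivWithin hUD]
    refine ⟨hdiff, fun h => absurd h hmt, ?_⟩
    have hpath : ContDiffOn ℝ m (fun t => (t, u t)) (Ico a b) := contDiffOn_id.prodMk hum
    have h1 : ContDiffOn ℝ m (fun s => fderivWithin ℝ g S (s, u s) (1, 0)) (Ico a b) :=
      (hD.of_le hm).comp hpath hmem
    have h2 : ContDiffOn ℝ m (fun s => fderiv ℝ (G s) (u s)) (Ico a b) :=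
      (hH.of_le hm).comp hpath hmem
    have h3 : ContDiffOn ℝ m (fun s => (fderiv ℝ (G s) (u s)).inverse) (Ico a b) := by
      intro s hs
      obtain ⟨e, he⟩ := (hu.2 s hs).2.exists_equiv
      have h4 : ContDiffAt ℝ m ContinuousLinearMap.inverse (fderiv ℝ (G s) (u s)) := by
        rw [← he]
        exact contDiffAt_map_inverse e
      exact h4.comp_contDiffWithinAt s (h2 s hs)
    refine (h3.clm_apply h1).neg.congr fun s hs => ?_
    exact (hder s hs).derivWithin (hUD s hs)
  have h0 : ContDiffOn ℝ 0 u (Ico a b) := contDiffOn_zero.2 hu.1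
  have h1 := step 0 (by norm_num) (by norm_num) h0
  rw [zero_add] at h1
  have h2 := step 1 le_rfl (by norm_num) h1
  norm_num at h2
  exact h2

end BranchRegularity

section MaximalBranch

variable {E : Type*} [NormedAddCommGroup E] [InnerProductSpace ℝ E] [FiniteDimensional ℝ E]
  {T : ℝ} {f : ℝ → E → ℝ}

lemma IsBranch.eqOn (hT : 0 < T)
    (hf : ContDiffOn ℝ 3 (Function.uncurry f) (Icc 0 T ×ˢ (univ : Set E)))
    {u w : ℝ → E} {a b : ℝ} (hI : Ico a b ⊆ Icc 0 T)
    (hu : IsBranch (fun t => gradient (f t)) u (Ico a b))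
    (hw : IsBranch (fun t => gradient (f t)) w (Ico a b)) (ha : u a = w a) :
    EqOn u w (Ico a b) := by
  intro c hc
  have hac : Icc a c ⊆ Ico a b := fun t ht => ⟨ht.1, ht.2.trans_lt hc.2⟩
  have hcl : IsClosed ({t | u t = w t} ∩ Icc a c) := by
    have h1 : ContinuousOn (fun t => u t - w t) (Icc a c) :=
      (hu.1.mono hac).sub (hw.1.mono hac)
    have h2 := h1.preimage_isClosed_of_isClosed isClosed_Icc (isClosed_singleton (x := (0 : E)))
    convert h2 using 1
    ext t
    simp [sub_eq_zero, and_comm]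
  refine hcl.Icc_subset_of_forall_mem_nhdsWithin ha (fun t ht => ?_) ⟨hc.1, le_rfl⟩
  have htI : t ∈ Ico a b := hac ⟨ht.2.1, ht.2.2.le⟩
  obtain ⟨ε, hε, r, hr, z, -, -, hz⟩ :=
    exists_local_branch hT hf (hI htI) (hu.2 t htI).1 (hu.2 t htI).2
  have hle : 𝓝[>] t ≤ 𝓝[Ico a b] t := by
    refine nhdsWithin_le_iff.2 ?_
    filter_upwards [Ioo_mem_nhdsGT htI.2] with s hs using ⟨htI.1.trans hs.1.le, hs.2⟩
  have hball : Metric.closedBall (u t) r ∈ 𝓝 (u t) := Metric.closedBall_mem_nhds _ hr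
  have e1 : ∀ᶠ s in 𝓝[>] t, u s ∈ Metric.closedBall (u t) r := hle ((hu.1 t htI) hball)
  have e2 : ∀ᶠ s in 𝓝[>] t, w s ∈ Metric.closedBall (u t) r := by
    have ht1 : u t = w t := ht.1
    rw [ht1] at hball ⊢
    exact hle ((hw.1 t htI) hball)
  have e3 : ∀ᶠ s in 𝓝[>] t, s ∈ Ico a b := hle self_mem_nhdsWithin
  have e4 : ∀ᶠ s in 𝓝[>] t, s ∈ Ioo (t - ε) (t + ε) :=
    nhdsWithin_le_nhds (Ioo_mem_nhds (by linarith) (by linarith))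
  filter_upwards [e1, e2, e3, e4] with s h1 h2 h3 h4
  have hs : s ∈ Icc 0 T ∩ Ioo (t - ε) (t + ε) := ⟨hI h3, h4⟩
  exact (hz s hs _ h1 (hu.2 s h3).1).trans (hz s hs _ h2 (hw.2 s h3).1).symm

lemma IsBranch.limit_mem (hT : 0 < T)
    (hf : ContDiffOn ℝ 3 (Function.uncurry f) (Icc 0 T ×ˢ (univ : Set E)))
    {u : ℝ → E} {a b : ℝ} (hab : a < b) (hb : b ∈ Icc 0 T) (hI : Ico a b ⊆ Icc 0 T)
    (hu : IsBranch (fun t => gradient (f t)) u (Ico a b)) {x : E}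
    (hx : MapClusterPt x (𝓝[<] b) u) :
    gradient (f b) x = 0 ∧ PosSemidefForm (fderiv ℝ (gradient (f b)) x) := by
  have hG := contDiffOn_gradient_slice hT hf
  have hH : ContDiffOn ℝ 1 (fun p : ℝ × E => fderiv ℝ (gradient (f p.1)) p.2)
      (Icc 0 T ×ˢ (univ : Set E)) := contDiffOn_fderiv_slice hT hG (by norm_num)
  have hIev : ∀ᶠ t in 𝓝[<] b, t ∈ Ico a b := by
    filter_upwards [Ioo_mem_nhdsLT hab] with t ht using ⟨ht.1.le, ht.2⟩
  obtain ⟨l, hl, hl1, hl2⟩ : ∃ l : Filter ℝ, l.NeBot ∧ l ≤ 𝓝[<] b ∧ Tendsto u l (𝓝 x) := by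
    have hx' : MapClusterPt x (𝓝[<] b) u := hx
    rw [mapClusterPt_iff_ultrafilter] at hx'
    obtain ⟨U, hU1, hU2⟩ := hx'
    exact ⟨U, inferInstance, hU1, hU2⟩
  have hpath : Tendsto (fun t => (t, u t)) l (𝓝[Icc 0 T ×ˢ (univ : Set E)] (b, x)) := by
    refine tendsto_nhdsWithin_iff.2 ⟨?_, ?_⟩
    · exact (tendsto_id.mono_left (hl1.trans nhdsWithin_le_nhds)).prodMk_nhds hl2
    · filter_upwards [hl1 hIev] with t ht using ⟨hI ht, mem_univ _⟩
  have h1 := (hG.continuousOn (b, x) ⟨hb, mem_univ _⟩).tendsto.comp hpath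
  have h2 := (hH.continuousOn (b, x) ⟨hb, mem_univ _⟩).tendsto.comp hpath
  constructor
  · refine tendsto_nhds_unique h1 (tendsto_const_nhds.congr' ?_)
    filter_upwards [hl1 hIev] with t ht using (hu.2 t ht).1.symm
  · intro y
    have h3 : Tendsto (fun t => ⟪fderiv ℝ (gradient (f t)) (u t) y, y⟫) l
        (𝓝 ⟪fderiv ℝ (gradient (f b)) x y, y⟫) :=
      (((ContinuousLinearMap.apply ℝ E y).continuous.tendsto _).comp h2).inner tendsto_const_nhds
    refine ge_of_tendsto h3 ?_
    filter_upwards [hl1 hIev] with t ht using (hu.2 t ht).2.posSemidefForm y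

/-- If a left cluster point of a branch is a nondegenerate stable zero, it is the left limit. -/
lemma IsBranch.tendsto_of_clusterPt (hT : 0 < T)
    (hf : ContDiffOn ℝ 3 (Function.uncurry f) (Icc 0 T ×ˢ (univ : Set E)))
    {u : ℝ → E} {a b : ℝ} (hab : a < b) (hb : b ∈ Icc 0 T) (hI : Ico a b ⊆ Icc 0 T)
    (hu : IsBranch (fun t => gradient (f t)) u (Ico a b)) {x : E}
    (hx : MapClusterPt x (𝓝[<] b) u) (hpd : PosDefForm (fderiv ℝ (gradient (f b)) x)) :
    Tendsto u (𝓝[<] b) (𝓝 x) := by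
  obtain ⟨ε, hε, r, hr, z, hz0, hz1, hz2⟩ :=
    exists_local_branch hT hf hb (hu.limit_mem hT hf hab hb hI hx).1 hpd
  have hbI : b ∈ Icc 0 T ∩ Ioo (b - ε) (b + ε) := ⟨hb, by constructor <;> linarith⟩
  have e1 : ∃ᶠ t in 𝓝[<] b, u t ∈ Metric.closedBall x r :=
    hx.frequently (Metric.closedBall_mem_nhds x hr)
  have e2 : ∀ᶠ t in 𝓝[<] b, t ∈ Ioo (max a (b - ε)) b :=
    Ioo_mem_nhdsLT (max_lt hab (by linarith))
  obtain ⟨t, ht1, ht2⟩ := (e1.and_eventually e2).exists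
  have ha : a < t := (le_max_left _ _).trans_lt ht2.1
  have hεt : b - ε < t := (le_max_right _ _).trans_lt ht2.1
  have hsub1 : Ico t b ⊆ Ico a b := Ico_subset_Ico_left ha.le
  have hsub2 : Ico t b ⊆ Icc 0 T ∩ Ioo (b - ε) (b + ε) := fun s hs =>
    ⟨hI (hsub1 hs), hεt.trans_le hs.1, by linarith [hs.2]⟩
  have htm : t ∈ Ico t b := ⟨le_rfl, ht2.2⟩
  have heq := (hu.mono hsub1).eqOn hT hf (hsub1.trans hI) (hz1.mono hsub2)
    (hz2 t (hsub2 htm) _ ht1 (hu.2 t (hsub1 htm)).1)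
  have hlim : Tendsto z (𝓝[<] b) (𝓝 x) := by
    rw [← hz0]
    refine (hz1.1 b hbI).tendsto.mono_left (nhdsWithin_le_iff.2 ?_)
    filter_upwards [Ioo_mem_nhdsLT ht2.2] with s hs using hsub2 ⟨hs.1.le, hs.2⟩
  refine hlim.congr' ?_
  filter_upwards [Ioo_mem_nhdsLT ht2.2] with s hs using (heq ⟨hs.1.le, hs.2⟩).symm

lemma IsBranch.exists_limit (hT : 0 < T)
    (hf : ContDiffOn ℝ 3 (Function.uncurry f) (Icc 0 T ×ˢ (univ : Set E)))
    {K : Set E} (hK : IsCompact K) (hKz : ∀ t ∈ Icc 0 T, ∀ x, gradient (f t) x = 0 → x ∈ K)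
    {u : ℝ → E} {a b : ℝ} (hab : a < b) (hb : b ∈ Icc 0 T) (hI : Ico a b ⊆ Icc 0 T)
    (hdeg : ∀ x x', gradient (f b) x = 0 → gradient (f b) x' = 0 →
      PosSemidefForm (fderiv ℝ (gradient (f b)) x) →
      PosSemidefForm (fderiv ℝ (gradient (f b)) x') →
      ¬ PosDefForm (fderiv ℝ (gradient (f b)) x) →
      ¬ PosDefForm (fderiv ℝ (gradient (f b)) x') → x = x')
    (hu : IsBranch (fun t => gradient (f t)) u (Ico a b)) :
    ∃ x, Tendsto u (𝓝[<] b) (𝓝 x) := by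
  have hev : ∀ᶠ t in 𝓝[<] b, u t ∈ K := by
    filter_upwards [Ioo_mem_nhdsLT hab] with t ht
    exact hKz t (hI ⟨ht.1.le, ht.2⟩) _ (hu.2 t ⟨ht.1.le, ht.2⟩).1
  by_cases hex : ∃ x, MapClusterPt x (𝓝[<] b) u ∧ PosDefForm (fderiv ℝ (gradient (f b)) x)
  · obtain ⟨x, hx, hpd⟩ := hex
    exact ⟨x, hu.tendsto_of_clusterPt hT hf hab hb hI hx hpd⟩
  · push Not at hex
    obtain ⟨x, -, hx⟩ := hK.exists_mapClusterPt (u := u) (f := 𝓝[<] b)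
      (le_principal_iff.2 hev)
    refine ⟨x, hK.tendsto_nhds_of_unique_mapClusterPt hev fun y _ hy => ?_⟩
    have h1 := hu.limit_mem hT hf hab hb hI hx
    have h2 := hu.limit_mem hT hf hab hb hI hy
    exact hdeg y x h2.1 h1.1 h2.2 h1.2 (hex y hy) (hex x hx)

end MaximalBranch

section MaximalBranch

variable {E : Type*} [NormedAddCommGroup E] [InnerProductSpace ℝ E] [FiniteDimensional ℝ E]
  {T : ℝ} {f : ℝ → E → ℝ}

/-- Branches on an increasing family of intervals glue. -/
lemma IsBranch.exists_glue (hT : 0 < T)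
    (hf : ContDiffOn ℝ 3 (Function.uncurry f) (Icc 0 T ×ˢ (univ : Set E)))
    {a τ : ℝ} (hI : Ico a τ ⊆ Icc 0 T) {x₀ : E} {B : Set ℝ} (hBa : ∀ b ∈ B, a < b)
    (hB : IsLUB B τ)
    (h : ∀ b ∈ B, ∃ u, IsBranch (fun t => gradient (f t)) u (Ico a b) ∧ u a = x₀) :
    ∃ u, IsBranch (fun t => gradient (f t)) u (Ico a τ) ∧ ∀ t ∈ B, u a = x₀ := by
  have h' : ∀ b, ∃ u, b ∈ B → IsBranch (fun t => gradient (f t)) u (Ico a b) ∧ u a = x₀ := by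
    intro b
    by_cases hb : b ∈ B
    · obtain ⟨u, hu⟩ := h b hb
      exact ⟨u, fun _ => hu⟩
    · exact ⟨fun _ => 0, fun h => absurd h hb⟩
  choose U hU using h'
  have hex : ∀ t, ∃ b, t ∈ Ico a τ → b ∈ B ∧ t < b := by
    intro t
    by_cases ht : t ∈ Ico a τ
    · obtain ⟨b, hb, htb⟩ := (lt_isLUB_iff hB).1 ht.2
      exact ⟨b, fun _ => ⟨hb, htb⟩⟩
    · exact ⟨0, fun h => absurd h ht⟩
  choose β hβ using hex
  have key : ∀ b ∈ B, EqOn (fun t => U (β t) t) (U b) (Ico a b) := by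
    intro b hb t ht
    have htτ : t ∈ Ico a τ := ⟨ht.1, ht.2.trans_le (hB.1 hb)⟩
    obtain ⟨h1, h2⟩ := hβ t htτ
    have hs : Ico a (min b (β t)) ⊆ Icc 0 T := fun s hs =>
      hI ⟨hs.1, hs.2.trans_le ((min_le_left _ _).trans (hB.1 hb))⟩
    refine IsBranch.eqOn hT hf hs ((hU _ h1).1.mono (Ico_subset_Ico_right (min_le_right _ _)))
      ((hU b hb).1.mono (Ico_subset_Ico_right (min_le_left _ _))) ?_ ⟨ht.1, lt_min ht.2 h2⟩
    rw [(hU _ h1).2, (hU b hb).2]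
  refine ⟨fun t => U (β t) t, ⟨?_, ?_⟩, ?_⟩
  · intro t ht
    obtain ⟨h1, h2⟩ := hβ t ht
    have hn : Ico a (β t) ∈ 𝓝[Ico a τ] t := by
      filter_upwards [self_mem_nhdsWithin, nhdsWithin_le_nhds (Iio_mem_nhds h2)] with s hs hs'
      exact ⟨hs.1, hs'⟩
    refine (((hU _ h1).1.1 t ⟨ht.1, h2⟩).mono_of_mem_nhdsWithin hn).congr_of_eventuallyEq ?_ rfl
    filter_upwards [hn] with s hs using key _ h1 hs
  · intro t ht
    obtain ⟨h1, h2⟩ := hβ t ht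
    exact (hU _ h1).1.2 t ⟨ht.1, h2⟩
  · intro b hb
    exact (key b hb ⟨le_rfl, hBa b hb⟩).trans (hU b hb).2

/-- A branch whose limit is a nondegenerate minimum can be continued. -/
lemma IsBranch.exists_extension (hT : 0 < T)
    (hf : ContDiffOn ℝ 3 (Function.uncurry f) (Icc 0 T ×ˢ (univ : Set E)))
    {a τ : ℝ} (haτ : a < τ) (ha : 0 ≤ a) (hτ : τ < T) {u : ℝ → E} {x : E}
    (hu : IsBranch (fun t => gradient (f t)) u (Ico a τ)) (hx : Tendsto u (𝓝[<] τ) (𝓝 x))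
    (hx0 : gradient (f τ) x = 0) (hpd : PosDefForm (fderiv ℝ (gradient (f τ)) x)) :
    ∃ b ∈ Ioc τ T, ∃ w, IsBranch (fun t => gradient (f t)) w (Ico a b) ∧ w a = u a := by
  obtain ⟨ε, hε, r, hr, z, hz0, hz1, hz2⟩ :=
    exists_local_branch hT hf ⟨ha.trans haτ.le, hτ.le⟩ hx0 hpd
  have e1 : ∀ᶠ t in 𝓝[<] τ, u t = z t := by
    filter_upwards [hx (Metric.closedBall_mem_nhds x hr),
      Ioo_mem_nhdsLT (max_lt haτ (by linarith : τ - ε < τ))] with t ht ht'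
    have h1 : a < t := (le_max_left _ _).trans_lt ht'.1
    have h2 : τ - ε < t := (le_max_right _ _).trans_lt ht'.1
    exact hz2 t ⟨⟨by linarith, by linarith [ht'.2]⟩, h2, by linarith [ht'.2]⟩ _ ht
      (hu.2 t ⟨h1.le, ht'.2⟩).1
  obtain ⟨δ, hδ, he⟩ : ∃ δ < τ, ∀ t ∈ Ioo δ τ, u t = z t := by
    obtain ⟨δ, hδ, h⟩ := mem_nhdsLT_iff_exists_Ioo_subset.1 e1
    exact ⟨δ, hδ, h⟩
  set w : ℝ → E := fun t => if t < τ then u t else z t with hw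
  have hwz : ∀ t, δ < t → w t = z t := by
    intro t ht
    by_cases h : t < τ
    · simp [hw, h, he t ⟨ht, h⟩]
    · simp [hw, h]
  have hwu : ∀ t, t < τ → w t = u t := fun t ht => by simp [hw, ht]
  have hsub : ∀ t ∈ Ico a (min (τ + ε) T), τ ≤ t → t ∈ Icc 0 T ∩ Ioo (τ - ε) (τ + ε) := by
    intro t ht h
    exact ⟨⟨ha.trans ht.1, (ht.2.trans_le (min_le_right _ _)).le⟩, by linarith,
      ht.2.trans_le (min_le_left _ _)⟩
  refine ⟨min (τ + ε) T, ⟨lt_min (by linarith) hτ, min_le_right _ _⟩, w, ⟨?_, ?_⟩, hwu a haτ⟩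
  · intro t ht
    by_cases h : t < τ
    · have hn : Ico a τ ∈ 𝓝[Ico a (min (τ + ε) T)] t := by
        filter_upwards [self_mem_nhdsWithin, nhdsWithin_le_nhds (Iio_mem_nhds h)] with s hs hs'
        exact ⟨hs.1, hs'⟩
      refine ((hu.1 t ⟨ht.1, h⟩).mono_of_mem_nhdsWithin hn).congr_of_eventuallyEq ?_ (hwu t h)
      filter_upwards [hn] with s hs using hwu s hs.2
    · push Not at h
      have hn : Icc 0 T ∩ Ioo (τ - ε) (τ + ε) ∈ 𝓝[Ico a (min (τ + ε) T)] t := by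
        filter_upwards [self_mem_nhdsWithin,
          nhdsWithin_le_nhds (Ioi_mem_nhds (by linarith : τ - ε < t))] with s hs hs'
        exact ⟨⟨ha.trans hs.1, (hs.2.trans_le (min_le_right _ _)).le⟩, hs',
          hs.2.trans_le (min_le_left _ _)⟩
      refine ((hz1.1 t (hsub t ht h)).mono_of_mem_nhdsWithin hn).congr_of_eventuallyEq ?_
        (hwz t (hδ.trans_le h))
      filter_upwards [nhdsWithin_le_nhds (Ioi_mem_nhds (hδ.trans_le h))] with s hs using hwz s hs
  · intro t ht
    by_cases h : t < τ
    · rw [hwu t h]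
      exact hu.2 t ⟨ht.1, h⟩
    · push Not at h
      rw [hwz t (hδ.trans_le h)]
      exact hz1.2 t (hsub t ht h)

lemma exists_maximal_branch (hT : 0 < T)
    (hf : ContDiffOn ℝ 3 (Function.uncurry f) (Icc 0 T ×ˢ (univ : Set E)))
    {K : Set E} (hK : IsCompact K) (hKz : ∀ t ∈ Icc 0 T, ∀ x, gradient (f t) x = 0 → x ∈ K)
    (hdeg : ∀ b ∈ Icc 0 T, ∀ x x', gradient (f b) x = 0 → gradient (f b) x' = 0 →
      PosSemidefForm (fderiv ℝ (gradient (f b)) x) →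
      PosSemidefForm (fderiv ℝ (gradient (f b)) x') →
      ¬ PosDefForm (fderiv ℝ (gradient (f b)) x) →
      ¬ PosDefForm (fderiv ℝ (gradient (f b)) x') → x = x')
    {a : ℝ} (ha : a ∈ Ico 0 T) {x₀ : E} (hx₀ : gradient (f a) x₀ = 0)
    (hpd : PosDefForm (fderiv ℝ (gradient (f a)) x₀)) :
    ∃ τ ∈ Ioc a T, ∃ u x, IsBranch (fun t => gradient (f t)) u (Ico a τ) ∧ u a = x₀ ∧
      Tendsto u (𝓝[<] τ) (𝓝 x) ∧ gradient (f τ) x = 0 ∧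
      PosSemidefForm (fderiv ℝ (gradient (f τ)) x) ∧
      (τ < T → ¬ PosDefForm (fderiv ℝ (gradient (f τ)) x)) := by
  set B : Set ℝ := {b | b ∈ Ioc a T ∧
    ∃ u, IsBranch (fun t => gradient (f t)) u (Ico a b) ∧ u a = x₀} with hB
  obtain ⟨b₀, hb₀⟩ : B.Nonempty := by
    obtain ⟨ε, hε, r, hr, z, hz0, hz1, -⟩ := exists_local_branch hT hf ⟨ha.1, ha.2.le⟩ hx₀ hpd
    refine ⟨min (a + ε) T, ⟨lt_min (by linarith) ha.2, min_le_right _ _⟩, z, hz1.mono ?_, hz0⟩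
    intro t ht
    exact ⟨⟨ha.1.trans ht.1, (ht.2.trans_le (min_le_right _ _)).le⟩, by linarith [ht.1],
      ht.2.trans_le (min_le_left _ _)⟩
  have hbdd : BddAbove B := ⟨T, fun b hb => hb.1.2⟩
  have hlub : IsLUB B (sSup B) := isLUB_csSup ⟨b₀, hb₀⟩ hbdd
  set τ := sSup B
  have haτ : a < τ := hb₀.1.1.trans_le (hlub.1 hb₀)
  have hτT : τ ≤ T := hlub.2 fun b hb => hb.1.2
  have hI : Ico a τ ⊆ Icc 0 T := fun t ht => ⟨ha.1.trans ht.1, (ht.2.trans_le hτT).le⟩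
  obtain ⟨u, hu, hua⟩ := IsBranch.exists_glue hT hf hI (fun b hb => hb.1.1) hlub fun b hb => hb.2
  have hτ : τ ∈ Icc 0 T := ⟨ha.1.trans haτ.le, hτT⟩
  obtain ⟨x, hx⟩ := hu.exists_limit hT hf hK hKz haτ hτ hI (hdeg τ hτ)
  have hx' := hu.limit_mem hT hf haτ hτ hI hx.mapClusterPt
  refine ⟨τ, ⟨haτ, hτT⟩, u, x, hu, hua b₀ hb₀, hx, hx'.1, hx'.2, fun hlt hpd' => ?_⟩
  obtain ⟨b, hb, w, hw, hwa⟩ := hu.exists_extension hT hf haτ ha.1 hlt hx hx'.1 hpd'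
  have : b ∈ B := ⟨⟨haτ.trans hb.1, hb.2⟩, w, hw, hwa.trans (hua b₀ hb₀)⟩
  exact absurd (hlub.1 this) (not_le.2 hb.1)

end MaximalBranch

section Barrier

/-- If `Q` is nonincreasing wherever it exceeds `c`, then `Q` cannot cross the level `c` upwards. -/
lemma le_of_deriv_nonpos_of_lt {Q Q' : ℝ → ℝ} {a b c : ℝ} (hab : a ≤ b)
    (hQ : ∀ s ∈ Icc a b, HasDerivAt Q (Q' s) s) (hQ' : ∀ s ∈ Icc a b, c < Q s → Q' s ≤ 0)
    (ha : Q a ≤ c) : Q b ≤ c := by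
  by_contra hb
  push Not at hb
  have hcont : ContinuousOn Q (Icc a b) := fun s hs => (hQ s hs).continuousAt.continuousWithinAt
  set S : Set ℝ := {s ∈ Icc a b | Q s ≤ c} with hS
  have hScl : IsClosed S := by
    have := hcont.preimage_isClosed_of_isClosed isClosed_Icc (isClosed_Iic (a := c))
    exact this
  have hSne : S.Nonempty := ⟨a, ⟨le_rfl, hab⟩, ha⟩
  have hSbdd : BddAbove S := ⟨b, fun s hs => hs.1.2⟩
  have hmem := hScl.csSup_mem hSne hSbdd
  set σ := sSup S
  have hgt : ∀ s ∈ Ioc σ b, c < Q s := by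
    intro s hs
    by_contra h
    push Not at h
    exact absurd (le_csSup hSbdd (show s ∈ S from ⟨⟨hmem.1.1.trans hs.1.le, hs.2⟩, h⟩))
      (not_le.2 hs.1)
  have hanti : AntitoneOn Q (Icc σ b) := by
    refine antitoneOn_of_deriv_nonpos (convex_Icc _ _)
      (hcont.mono (Icc_subset_Icc_left hmem.1.1)) ?_ ?_
    · intro s hs
      rw [interior_Icc] at hs
      exact (hQ s ⟨hmem.1.1.trans hs.1.le, hs.2.le⟩).differentiableAt.differentiableWithinAt
    · intro s hs
      rw [interior_Icc] at hs
      have hs' : s ∈ Icc a b := ⟨hmem.1.1.trans hs.1.le, hs.2.le⟩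
      rw [(hQ s hs').deriv]
      exact hQ' s hs' (hgt s ⟨hs.1, hs.2.le⟩)
  have := hanti ⟨le_rfl, hmem.1.2⟩ ⟨hmem.1.2, le_rfl⟩ hmem.1.2
  linarith [hmem.2]

end Barrier

section GlobalSolutions

variable {E : Type*} [NormedAddCommGroup E] [InnerProductSpace ℝ E]

/-- `w` is a global solution of the autonomous equation `w' = -F(w)`. -/
def IsDescent (F : E → E) (w : ℝ → E) : Prop := ∀ s, HasDerivAt w (-F (w s)) s

lemma IsDescent.continuous {F : E → E} {w : ℝ → E} (hw : IsDescent F w) : Continuous w :=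
  continuous_iff_continuousAt.2 fun s => (hw s).continuousAt

lemma IsDescent.comp_add {F : E → E} {w : ℝ → E} (hw : IsDescent F w) (c : ℝ) :
    IsDescent F (fun s => w (s + c)) := fun s => (hw (s + c)).comp_add_const s c

lemma IsDescent.hasDerivAt_inner {F : E → E} {w : ℝ → E} (hw : IsDescent F w) (l : E) (s : ℝ) :
    HasDerivAt (fun s => ⟪w s, l⟫) (-⟪F (w s), l⟫) s := by
  simpa using (hw s).inner ℝ (hasDerivAt_const s l)

lemma IsDescent.hasDerivAt_norm_sq {F : E → E} {w : ℝ → E} (hw : IsDescent F w) (s : ℝ) :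
    HasDerivAt (fun s => ‖w s‖ ^ 2) (-2 * ⟪F (w s), w s⟫) s := by
  have h := (hw s).norm_sq
  rw [inner_neg_right, real_inner_comm] at h
  convert! h using 1
  ring

lemma exists_isDescent [CompleteSpace E] {F : E → E} {L : ℝ} {K : NNReal}
    (hL : ∀ x, ‖F x‖ ≤ L) (hK : LipschitzWith K F) (x₀ : E) :
    ∃ w, IsDescent F w ∧ w 0 = x₀ := by
  have hL0 : 0 ≤ L := (norm_nonneg _).trans (hL x₀)
  have hKn : LipschitzWith K (fun x => -F x) := hK.neg
  have hloc : ∀ N : ℕ, ∃ α : ℝ → E, α 0 = x₀ ∧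
      ∀ t ∈ Icc (-(N : ℝ)) N, HasDerivWithinAt α (-F (α t)) (Icc (-(N : ℝ)) N) t := by
    intro N
    have hN : (0 : ℝ) ∈ Icc (-(N : ℝ)) N := by simp
    have hPL : IsPicardLindelof (fun _ x => -F x) (⟨0, hN⟩ : Icc (-(N : ℝ)) N) x₀
        (L.toNNReal * N) 0 L.toNNReal K := by
      refine IsPicardLindelof.of_time_independent (fun x _ => ?_) hKn.lipschitzOnWith ?_
      · rw [norm_neg, Real.coe_toNNReal _ hL0]
        exact hL x
      · simp
    exact hPL.exists_eq_forall_mem_Icc_hasDerivWithinAt₀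
  choose α hα0 hα using hloc
  have hαd : ∀ N : ℕ, ∀ t ∈ Ioo (-(N : ℝ)) N, HasDerivAt (α N) (-F (α N t)) t := fun N t ht =>
    (hα N t ⟨ht.1.le, ht.2.le⟩).hasDerivAt (Icc_mem_nhds ht.1 ht.2)
  have hmono : ∀ N M : ℕ, N ≤ M → EqOn (α N) (α M) (Ioo (-(N : ℝ)) N) := by
    intro N M hNM t ht
    have hcast : (N : ℝ) ≤ M := by exact_mod_cast hNM
    have hsub : Ioo (-(N : ℝ)) N ⊆ Ioo (-(M : ℝ)) M := Ioo_subset_Ioo (by linarith) hcast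
    have h0 : (0 : ℝ) ∈ Ioo (-(N : ℝ)) N := by
      have : 0 < (N : ℝ) := by linarith [ht.1.trans ht.2]
      exact ⟨by linarith, this⟩
    exact ODE_solution_unique_of_mem_Ioo (v := fun _ x => -F x) (s := fun _ => univ)
      (fun _ _ => hKn.lipschitzOnWith) h0 (fun s hs => ⟨hαd N s hs, mem_univ _⟩)
      (fun s hs => ⟨hαd M s (hsub hs), mem_univ _⟩) (by rw [hα0, hα0]) ht
  have hmem : ∀ t : ℝ, t ∈ Ioo (-((⌈|t|⌉₊ + 1 : ℕ) : ℝ)) ((⌈|t|⌉₊ + 1 : ℕ) : ℝ) := by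
    intro t
    have h := Nat.le_ceil |t|
    push_cast
    constructor <;> linarith [neg_abs_le t, le_abs_self t]
  have hagree : ∀ N : ℕ, ∀ t ∈ Ioo (-(N : ℝ)) N, α (⌈|t|⌉₊ + 1) t = α N t := by
    intro N t ht
    rcases le_total (⌈|t|⌉₊ + 1) N with h | h
    · exact hmono _ _ h (hmem t)
    · exact (hmono _ _ h ht).symm
  refine ⟨fun t => α (⌈|t|⌉₊ + 1) t, fun t => ?_, by simp [hα0]⟩
  refine (hαd _ t (hmem t)).congr_of_eventuallyEq ?_
  filter_upwards [Ioo_mem_nhds (hmem t).1 (hmem t).2] with s hs using hagree _ s hs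

lemma IsDescent.dist_le {F : E → E} {K : NNReal} (hK : LipschitzWith K F) {w₁ w₂ : ℝ → E}
    (h₁ : IsDescent F w₁) (h₂ : IsDescent F w₂) (s : ℝ) :
    dist (w₁ s) (w₂ s) ≤ dist (w₁ 0) (w₂ 0) * Real.exp (K * |s|) := by
  rcases le_total 0 s with hs | hs
  · have := dist_le_of_trajectories_ODE (v := fun _ x => -F x) (a := 0) (b := s)
      (fun _ => hK.neg) h₁.continuous.continuousOn (fun t _ => (h₁ t).hasDerivWithinAt)
      h₂.continuous.continuousOn (fun t _ => (h₂ t).hasDerivWithinAt) le_rfl s ⟨hs, le_rfl⟩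
    rw [abs_of_nonneg hs]
    simpa using this
  · have hrev : ∀ {w : ℝ → E}, IsDescent F w → ∀ t,
        HasDerivAt (fun t => w (-t)) (F (w (-t))) t := by
      intro w hw t
      have := (hw (-t)).scomp t (hasDerivAt_neg t)
      simpa [Function.comp_def] using this
    have := dist_le_of_trajectories_ODE (v := fun _ x => F x) (a := 0) (b := -s)
      (f := fun t => w₁ (-t)) (g := fun t => w₂ (-t))
      (fun _ => hK) (h₁.continuous.comp continuous_neg).continuousOn
      (fun t _ => (hrev h₁ t).hasDerivWithinAt)
      (h₂.continuous.comp continuous_neg).continuousOn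
      (fun t _ => (hrev h₂ t).hasDerivWithinAt) le_rfl (-s) ⟨by linarith, le_rfl⟩
    simp only [neg_neg, neg_zero, sub_zero] at this
    rwa [abs_of_nonpos hs]

lemma IsDescent.eq_of_eq_at [FiniteDimensional ℝ E] {F : E → E} (hF : ContDiff ℝ 1 F)
    {w₁ w₂ : ℝ → E} (h₁ : IsDescent F w₁) (h₂ : IsDescent F w₂) {s₀ : ℝ}
    (h : w₁ s₀ = w₂ s₀) : w₁ = w₂ := by
  ext1 t
  obtain ⟨a, b, ht, hs⟩ : ∃ a b, t ∈ Ioo a b ∧ s₀ ∈ Ioo a b :=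
    ⟨min t s₀ - 1, max t s₀ + 1, by grind, by grind⟩
  obtain ⟨R, hR⟩ : ∃ R, ∀ s ∈ Icc a b, ‖w₁ s‖ ≤ R ∧ ‖w₂ s‖ ≤ R := by
    obtain ⟨R₁, hR₁⟩ := isCompact_Icc.exists_bound_of_continuousOn
      (h₁.continuous.continuousOn (s := Icc a b))
    obtain ⟨R₂, hR₂⟩ := isCompact_Icc.exists_bound_of_continuousOn
      (h₂.continuous.continuousOn (s := Icc a b))
    exact ⟨max R₁ R₂, fun s hs => ⟨(hR₁ s hs).trans (le_max_left _ _),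
      (hR₂ s hs).trans (le_max_right _ _)⟩⟩
  obtain ⟨K, hK⟩ := hF.contDiffOn.exists_lipschitzOnWith one_ne_zero
    (convex_closedBall (0 : E) R) (isCompact_closedBall 0 R)
  refine ODE_solution_unique_of_mem_Ioo (v := fun _ x => -F x)
    (s := fun _ => Metric.closedBall 0 R) (fun _ _ => hK.neg) hs (fun s hs => ⟨h₁ s, ?_⟩)
    (fun s hs => ⟨h₂ s, ?_⟩) h ht
  · simpa using (hR s ⟨hs.1.le, hs.2.le⟩).1
  · simpa using (hR s ⟨hs.1.le, hs.2.le⟩).2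

lemma IsDescent.norm_sq_le {F : E → E} {w : ℝ → E} (hw : IsDescent F w) {M : ℝ}
    (hF : ∀ x, M < ‖x‖ ^ 2 → 0 ≤ ⟪F x, x⟫) {a b : ℝ} (hab : a ≤ b) (ha : ‖w a‖ ^ 2 ≤ M) :
    ‖w b‖ ^ 2 ≤ M :=
  le_of_deriv_nonpos_of_lt (Q := fun s => ‖w s‖ ^ 2) hab (fun s _ => hw.hasDerivAt_norm_sq s)
    (fun s _ h => by linarith [hF _ h]) ha

lemma IsDescent.contDiff {F : E → E} (hF : ContDiff ℝ 1 F) {w : ℝ → E} (hw : IsDescent F w) :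
    ContDiff ℝ 2 w := by
  have hd : deriv w = fun s => -F (w s) := funext fun s => (hw s).deriv
  have hdiff : Differentiable ℝ w := fun s => (hw s).differentiableAt
  have h1 : ContDiff ℝ 1 w := by
    rw [contDiff_one_iff_deriv]
    refine ⟨hdiff, ?_⟩
    rw [hd]
    exact (hF.continuous.comp hw.continuous).neg
  have h2 : ContDiff ℝ (1 + 1) w := by
    rw [contDiff_succ_iff_deriv]
    refine ⟨hdiff, fun h => by simp at h, ?_⟩
    rw [hd]
    exact (hF.comp h1).neg
  norm_num at h2
  exact h2

lemma IsDescent.map_limit_eq_zero {F : E → E} (hF : Continuous F) {w : ℝ → E}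
    (hw : IsDescent F w) {x : E} (hx : Tendsto w atTop (𝓝 x)) : F x = 0 := by
  by_contra hne
  have hpos : 0 < ‖F x‖ ^ 2 := by positivity
  have h1 : Tendsto (fun s => ⟪F (w s), F x⟫) atTop (𝓝 (‖F x‖ ^ 2)) := by
    rw [← real_inner_self_eq_norm_sq]
    exact ((hF.tendsto x).comp hx).inner tendsto_const_nhds
  have h2 : Tendsto (fun s => ⟪w s, F x⟫) atTop (𝓝 ⟪x, F x⟫) := hx.inner tendsto_const_nhds
  have h3 : Tendsto (fun s => ⟪w (s + 1), F x⟫ - ⟪w s, F x⟫) atTop (𝓝 0) := by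
    have := (h2.comp (tendsto_atTop_add_const_right atTop (1 : ℝ) tendsto_id)).sub h2
    simpa using this
  obtain ⟨S, hS⟩ := eventually_atTop.1
    (h1.eventually (lt_mem_nhds (by linarith : ‖F x‖ ^ 2 / 2 < ‖F x‖ ^ 2)))
  have h4 : ∀ s ≥ S, ⟪w (s + 1), F x⟫ - ⟪w s, F x⟫ ≤ -(‖F x‖ ^ 2 / 2) := by
    intro s hs
    obtain ⟨c, hc, hc'⟩ := exists_hasDerivAt_eq_slope (fun s => ⟪w s, F x⟫)
      (fun s => -⟪F (w s), F x⟫) (by linarith : s < s + 1)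
      (hw.continuous.inner continuous_const).continuousOn
      (fun s _ => hw.hasDerivAt_inner (F x) s)
    have := hS c (hs.trans hc.1.le)
    simp only [add_sub_cancel_left, div_one] at hc'
    linarith
  have h5 := le_of_tendsto h3 (eventually_atTop.2 ⟨S, h4⟩)
  linarith

/-- A `C¹` field can be cut off outside a ball into a bounded Lipschitz field. -/
lemma exists_truncation [FiniteDimensional ℝ E] {F : E → E} (hF : ContDiff ℝ 1 F) (R : ℝ) :
    ∃ F₁ : E → E, ∃ χ : E → ℝ, (∀ x, 0 ≤ χ x) ∧ (∀ x, F₁ x = χ x • F x) ∧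
      (∀ x, ‖x‖ ≤ R → F₁ x = F x) ∧ (∃ L, ∀ x, ‖F₁ x‖ ≤ L) ∧ ∃ K, LipschitzWith K F₁ := by
  have hR : 0 < |R| + 1 := by positivity
  let χ : ContDiffBump (0 : E) := ⟨|R| + 1, |R| + 2, hR, by linarith⟩
  have hsm : ContDiff ℝ 1 (fun x => χ x • F x) := χ.contDiff.smul hF
  have hcs : HasCompactSupport (fun x => χ x • F x) := χ.hasCompactSupport.smul_right
  refine ⟨fun x => χ x • F x, χ, fun x => χ.nonneg, fun x => rfl, fun x hx => ?_, ?_, ?_⟩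
  · have : χ x = 1 := χ.one_of_mem_closedBall (by simpa using by linarith [le_abs_self R])
    simp [this]
  · exact hcs.exists_bound_of_continuous hsm.continuous
  · exact hsm.lipschitzWith_of_hasCompactSupport hcs one_ne_zero

end GlobalSolutions

section FoldEstimates

variable {E : Type*} [NormedAddCommGroup E] [InnerProductSpace ℝ E]

/-- The component of `w` orthogonal to the unit vector `l`. -/
noncomputable def perp (l w : E) : E := w - ⟪w, l⟫ • l

lemma perp_add_smul (l w : E) : perp l w + ⟪w, l⟫ • l = w := by simp [perp]

lemma inner_perp {l : E} (hl : ‖l‖ = 1) (w : E) : ⟪perp l w, l⟫ = 0 := by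
  simp [perp, inner_sub_left, inner_smul_left, hl]

lemma norm_sq_perp {l : E} (hl : ‖l‖ = 1) (w : E) :
    ‖w‖ ^ 2 = ‖perp l w‖ ^ 2 + ⟪w, l⟫ ^ 2 := by
  conv_lhs => rw [← perp_add_smul l w]
  rw [norm_add_sq_real, inner_smul_right, inner_perp hl, norm_smul, hl, Real.norm_eq_abs]
  simp

lemma norm_le_perp_add {l : E} (hl : ‖l‖ = 1) (w : E) : ‖w‖ ≤ ‖perp l w‖ + |⟪w, l⟫| := by
  conv_lhs => rw [← perp_add_smul l w]
  refine (norm_add_le _ _).trans_eq ?_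
  rw [norm_smul, hl, mul_one, Real.norm_eq_abs]

lemma continuous_perp (l : E) : Continuous (perp l) := by
  unfold perp
  fun_prop

/-- Local estimates for a vector field `F` near a zero of fold type at the origin, with kernel
direction `l`, on the ball of radius `r` and with respect to the cone
`‖perp l w‖ ≤ κ * |⟪w, l⟫|`. -/
structure IsFold (F : E → E) (l : E) (r κ c m C : ℝ) : Prop where
  r_pos : 0 < r
  cone_pos : 0 < κ
  cone_le : κ ≤ 1
  c_pos : 0 < c
  m_pos : 0 < m
  norm_l : ‖l‖ = 1
  repel : ∀ w, ‖w‖ ≤ r → κ * |⟪w, l⟫| < ‖perp l w‖ →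
    κ ^ 2 * ⟪w, l⟫ * ⟪F w, l⟫ ≤ ⟪F w, perp l w⟫
  drift : ∀ w, ‖w‖ ≤ r → ‖perp l w‖ ≤ κ * |⟪w, l⟫| → c * ⟪w, l⟫ ^ 2 ≤ -⟪F w, l⟫
  contract : ∀ w₁ w₂, ‖w₁‖ ≤ r → ‖w₂‖ ≤ r → ⟪w₁, l⟫ = ⟪w₂, l⟫ → ⟪w₂, l⟫ ≠ 0 →
    ‖perp l w₁‖ ≤ κ * |⟪w₁, l⟫| → ‖perp l w₂‖ ≤ κ * |⟪w₂, l⟫| →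
    (⟪F w₁, l⟫ / ⟪F w₂, l⟫ - 1) * ⟪F w₂, w₁ - w₂⟫ ≤ ⟪F w₁ - F w₂, w₁ - w₂⟫
  coercive : ∀ w, ‖w‖ ≤ r → κ * |⟪w, l⟫| < ‖perp l w‖ → m * ‖w‖ ≤ ‖F w‖
  quadratic : ∀ w, ‖w‖ ≤ r → |⟪F w, l⟫| ≤ C * ‖w‖ ^ 2

/-- Second order Taylor upper bound for a scalar function with vanishing 1-jet. -/
lemma exists_second_order_bound {φ : E → ℝ} (hφ : ContDiff ℝ 2 φ) (h0 : φ 0 = 0)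
    (h1 : fderiv ℝ φ 0 = 0) {ε : ℝ} (hε : 0 < ε) :
    ∃ r > 0, ∀ w, ‖w‖ ≤ r → φ w ≤ (fderiv ℝ (fderiv ℝ φ) 0 w w + ε * ‖w‖ ^ 2) / 2 := by
  have hdφ : ContDiff ℝ 1 (fderiv ℝ φ) := hφ.fderiv_right (by norm_num)
  have hd : HasFDerivAt (fderiv ℝ φ) (fderiv ℝ (fderiv ℝ φ) 0) 0 :=
    (hdφ.differentiable one_ne_zero).differentiableAt.hasFDerivAt
  have hlo := hd.isLittleO.def hε
  obtain ⟨r, hr, hball⟩ := Metric.nhds_basis_closedBall.eventually_iff.1 hlo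
  refine ⟨r, hr, fun w hw => ?_⟩
  set B := fderiv ℝ (fderiv ℝ φ) 0
  have hg : ∀ s : ℝ, HasDerivAt (fun s : ℝ => φ (s • w) - s ^ 2 / 2 * (B w w + ε * ‖w‖ ^ 2))
      (fderiv ℝ φ (s • w) w - s * (B w w + ε * ‖w‖ ^ 2)) s := by
    intro s
    have e1 : HasDerivAt (fun s : ℝ => φ (s • w)) (fderiv ℝ φ (s • w) w) s := by
      have := ((hφ.differentiable (by norm_num)).differentiableAt
        (x := s • w)).hasFDerivAt.comp_hasDerivAt s ((hasDerivAt_id s).smul_const w)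
      simpa [Function.comp_def] using this
    have e2 : HasDerivAt (fun s : ℝ => s ^ 2 / 2 * (B w w + ε * ‖w‖ ^ 2))
        (s * (B w w + ε * ‖w‖ ^ 2)) s := by
      have := ((hasDerivAt_pow 2 s).div_const 2).mul_const (B w w + ε * ‖w‖ ^ 2)
      convert! this using 1
      simp
    exact e1.sub e2
  have hanti : AntitoneOn (fun s : ℝ => φ (s • w) - s ^ 2 / 2 * (B w w + ε * ‖w‖ ^ 2))
      (Icc 0 1) := by
    refine antitoneOn_of_deriv_nonpos (convex_Icc _ _)
      (fun s _ => (hg s).continuousAt.continuousWithinAt)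
      (fun s _ => (hg s).differentiableAt.differentiableWithinAt) fun s hs => ?_
    rw [interior_Icc] at hs
    rw [(hg s).deriv]
    have hsw : ‖s • w‖ ≤ r := by
      rw [norm_smul, Real.norm_of_nonneg hs.1.le]
      nlinarith [hs.2, norm_nonneg w]
    have h3 := hball (show s • w ∈ Metric.closedBall 0 r by simpa using hsw)
    rw [h1, sub_zero, sub_zero] at h3
    have h4 := (fderiv ℝ φ (s • w) - B (s • w)).le_opNorm w
    have h5 : (fderiv ℝ φ (s • w) - B (s • w)) w ≤ ε * ‖s • w‖ * ‖w‖ :=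
      (le_abs_self _).trans (h4.trans (by gcongr))
    rw [norm_smul, Real.norm_of_nonneg hs.1.le] at h5
    have h6 : (fderiv ℝ φ (s • w) - B (s • w)) w = fderiv ℝ φ (s • w) w - s * B w w := by
      simp
    rw [h6] at h5
    nlinarith
  have := hanti (show (0 : ℝ) ∈ Icc (0 : ℝ) 1 by simp) (show (1 : ℝ) ∈ Icc (0 : ℝ) 1 by simp)
    zero_le_one
  simp only [one_smul, zero_smul, h0] at this
  linarith

variable [FiniteDimensional ℝ E]

/-- First order Taylor estimate with quadratic remainder, in difference form. -/
lemma exists_taylor_bound {F : E → E} (hF : ContDiff ℝ 2 F) :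
    ∃ C > 0, ∀ ρ ≤ 1, ∀ w₁ w₂ : E, ‖w₁‖ ≤ ρ → ‖w₂‖ ≤ ρ →
      ‖F w₁ - F w₂ - fderiv ℝ F 0 (w₁ - w₂)‖ ≤ C * ρ * ‖w₁ - w₂‖ := by
  have hdF : ContDiff ℝ 1 (fderiv ℝ F) := hF.fderiv_right (by norm_num)
  obtain ⟨K, hK⟩ := hdF.contDiffOn.exists_lipschitzOnWith one_ne_zero
    (convex_closedBall (0 : E) 1) (isCompact_closedBall 0 1)
  refine ⟨K + 1, by positivity, fun ρ hρ w₁ w₂ h₁ h₂ => ?_⟩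
  have hρ0 : 0 ≤ ρ := (norm_nonneg _).trans h₁
  refine (convex_closedBall (0 : E) ρ).norm_image_sub_le_of_norm_fderiv_le' (𝕜 := ℝ)
    (fun x _ => (hF.differentiable (by norm_num)).differentiableAt) (fun x hx => ?_)
    (by simpa using h₂) (by simpa using h₁)
  have hx' : ‖x‖ ≤ ρ := by simpa using hx
  have := hK.dist_le_mul x (by simpa using hx'.trans hρ) 0 (by simp)
  rw [dist_eq_norm, dist_zero_right] at this
  refine this.trans ?_
  have : (K : ℝ) ≤ K + 1 := by linarith
  gcongr

end FoldEstimates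

section FoldExistence

variable {E : Type*} [NormedAddCommGroup E] [InnerProductSpace ℝ E]

/-- In a thin cone around `l`, a scalar function with vanishing 1-jet and negative second
derivative along `l` is bounded above by a negative quadratic. -/
lemma exists_drift_bound {φ : E → ℝ} (hφ : ContDiff ℝ 2 φ) (h0 : φ 0 = 0)
    (h1 : fderiv ℝ φ 0 = 0) {l : E} (hl : ‖l‖ = 1) (hβ : fderiv ℝ (fderiv ℝ φ) 0 l l < 0) :
    ∃ r > 0, ∃ κ₀ > 0, ∃ c > 0, ∀ w, ‖w‖ ≤ r → ‖perp l w‖ ≤ κ₀ * |⟪w, l⟫| →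
      c * ⟪w, l⟫ ^ 2 ≤ -φ w := by
  set B := fderiv ℝ (fderiv ℝ φ) 0 with hB
  set β := -(B l l) with hβ'
  have hβpos : 0 < β := by rw [hβ']; linarith
  obtain ⟨r, hr, hbd⟩ := exists_second_order_bound hφ h0 h1 (ε := β / 8) (by linarith)
  set b := ‖B‖ + 1 with hb
  have hbpos : 0 < b := by positivity
  refine ⟨r, hr, min 1 (β / (12 * b)), lt_min one_pos (by positivity), β / 4, by linarith,
    fun w hw hcone => ?_⟩
  set κ := min 1 (β / (12 * b))
  have hκ1 : κ ≤ 1 := min_le_left _ _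
  have hκ0 : 0 < κ := lt_min one_pos (by positivity)
  have hκb : κ * b ≤ β / 12 := by
    have : κ ≤ β / (12 * b) := min_le_right _ _
    rw [le_div_iff₀ (by positivity)] at this
    linarith
  set z := ⟪w, l⟫ with hz
  set y := perp l w with hy
  have hwyz : w = y + z • l := (perp_add_smul l w).symm
  have hexp : B w w = B y y + z * B y l + z * B l y + z ^ 2 * B l l := by
    rw [hwyz]
    simp
    ring
  have hbound : ∀ p q : E, B p q ≤ b * (‖p‖ * ‖q‖) := by
    intro p q
    refine (le_abs_self _).trans (((B.le_opNorm₂ p q)).trans ?_)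
    rw [mul_assoc]
    gcongr
    rw [hb]; linarith
  have hy1 : ‖y‖ ≤ |z| := hcone.trans (mul_le_of_le_one_left (abs_nonneg z) hκ1)
  have e1 : B y y ≤ b * (κ * |z| * |z|) := (hbound y y).trans (by gcongr)
  have e2 : z * B y l ≤ b * (κ * |z| * |z|) := by
    have h1 := hbound (z • y) l
    rw [norm_smul, hl, Real.norm_eq_abs] at h1
    have h2 : B (z • y) l = z * B y l := by simp
    rw [← h2]
    refine h1.trans ?_
    have : |z| * ‖y‖ ≤ κ * |z| * |z| := by
      rw [mul_comm]
      gcongr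
    refine mul_le_mul_of_nonneg_left ?_ hbpos.le
    linarith
  have e3 : z * B l y ≤ b * (κ * |z| * |z|) := by
    have h1 := hbound l (z • y)
    rw [norm_smul, hl, Real.norm_eq_abs] at h1
    have h2 : B l (z • y) = z * B l y := by simp
    rw [← h2]
    refine h1.trans ?_
    have : |z| * ‖y‖ ≤ κ * |z| * |z| := by
      rw [mul_comm]
      gcongr
    refine mul_le_mul_of_nonneg_left ?_ hbpos.le
    linarith
  have hzz : |z| * |z| = z ^ 2 := by rw [← sq, sq_abs]
  have hw2 : ‖w‖ ^ 2 ≤ 2 * z ^ 2 := by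
    have : ‖y‖ ^ 2 ≤ z ^ 2 := by
      rw [← sq_abs z]
      gcongr
    rw [norm_sq_perp hl w]
    linarith
  have h3 := hbd w hw
  have h4 : b * (κ * |z| * |z|) ≤ β / 12 * z ^ 2 := by
    rw [mul_assoc κ, hzz]
    have := mul_le_mul_of_nonneg_right hκb (sq_nonneg z)
    linarith
  have h5 : z ^ 2 * B l l = -(β * z ^ 2) := by rw [hβ']; ring
  have h6 : β / 8 * ‖w‖ ^ 2 ≤ β / 8 * (2 * z ^ 2) := by gcongr
  linarith

lemma contract_aux {F : E → E} {A : E →L[ℝ] E} {l : E} {m₀ C a κ c r : ℝ} (hl : ‖l‖ = 1)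
    (hm₀ : 0 < m₀) (hC : 0 < C) (ha : 0 < a) (hc : 0 < c) (hAa : ‖A‖ ≤ a)
    (hκ1 : κ ≤ 1) (hr2 : r ≤ 1 / 2) (hr4 : 8 * C * r ≤ m₀) (hr5 : 32 * C ^ 2 * r ≤ m₀ * c)
    (hκa : 2 * C * a * κ ≤ m₀ * c / 4) (hAl : ∀ y, ⟪A y, l⟫ = 0)
    (hAperp : ∀ w, A w = A (perp l w)) {w₁ w₂ : E}
    (hcoer : m₀ * ‖w₁ - w₂‖ ^ 2 ≤ ⟪A (w₁ - w₂), w₁ - w₂⟫)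
    (htay : ∀ ρ ≤ 1, ∀ w₁ w₂ : E, ‖w₁‖ ≤ ρ → ‖w₂‖ ≤ ρ →
      ‖F w₁ - F w₂ - A (w₁ - w₂)‖ ≤ C * ρ * ‖w₁ - w₂‖)
    (htay0 : ‖F w₂ - A w₂‖ ≤ C * ‖w₂‖ ^ 2) (hdrift : c * ⟪w₂, l⟫ ^ 2 ≤ -⟪F w₂, l⟫)
    (h₂ : ‖w₂‖ ≤ r) (hz : ⟪w₁, l⟫ = ⟪w₂, l⟫) (hz0 : ⟪w₂, l⟫ ≠ 0)
    (hc₁ : ‖perp l w₁‖ ≤ κ * |⟪w₂, l⟫|) (hc₂ : ‖perp l w₂‖ ≤ κ * |⟪w₂, l⟫|) :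
    (⟪F w₁, l⟫ / ⟪F w₂, l⟫ - 1) * ⟪F w₂, w₁ - w₂⟫ ≤ ⟪F w₁ - F w₂, w₁ - w₂⟫ := by
  have hn1 : ‖w₁‖ ≤ 2 * |⟪w₂, l⟫| := by
    have h1 := norm_le_perp_add hl w₁
    have h2 := mul_le_of_le_one_left (abs_nonneg ⟪w₂, l⟫) hκ1
    rw [hz] at h1
    linarith
  have hn2 : ‖w₂‖ ≤ 2 * |⟪w₂, l⟫| := by
    have h1 := norm_le_perp_add hl w₂
    have h2 := mul_le_of_le_one_left (abs_nonneg ⟪w₂, l⟫) hκ1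
    linarith
  have hzr : |⟪w₂, l⟫| ≤ r := by
    have := abs_real_inner_le_norm w₂ l
    rw [hl, mul_one] at this
    exact this.trans h₂
  have hDl : ⟪w₁ - w₂, l⟫ = 0 := by rw [inner_sub_left, hz]; ring
  have ht := htay (2 * |⟪w₂, l⟫|) (by linarith) w₁ w₂ hn1 hn2
  have hyA : ‖A (perp l w₂)‖ ≤ a * (κ * |⟪w₂, l⟫|) := (A.le_opNorm _).trans (by gcongr)
  generalize hzdef : ⟪w₂, l⟫ = z at *
  generalize hDdef : w₁ - w₂ = D at *
  have hzpos : 0 < |z| := abs_pos.2 hz0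
  have e1 : (m₀ - 2 * C * |z|) * ‖D‖ ^ 2 ≤ ⟪F w₁ - F w₂, D⟫ := by
    have h1 := neg_le_of_abs_le ((abs_real_inner_le_norm (F w₁ - F w₂ - A D) D).trans
      (mul_le_mul_of_nonneg_right ht (norm_nonneg D)))
    rw [inner_sub_left] at h1
    linarith
  have e2 : |⟪F w₁ - F w₂, l⟫| ≤ 2 * C * |z| * ‖D‖ := by
    have h1 : ⟪F w₁ - F w₂, l⟫ = ⟪F w₁ - F w₂ - A D, l⟫ := by
      rw [inner_sub_left (F w₁ - F w₂), hAl, sub_zero]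
    rw [h1]
    refine (abs_real_inner_le_norm _ _).trans ?_
    rw [hl, mul_one]
    linarith
  have e3 : |⟪F w₂, D⟫| ≤ (a * κ * |z| + 4 * C * z ^ 2) * ‖D‖ := by
    have h1 : ⟪F w₂, D⟫ = ⟪F w₂ - A w₂, D⟫ + ⟪A (perp l w₂), D⟫ := by
      rw [← hAperp, inner_sub_left]; ring
    have h2 : |⟪F w₂ - A w₂, D⟫| ≤ 4 * C * z ^ 2 * ‖D‖ := by
      refine (abs_real_inner_le_norm _ _).trans ?_
      have : ‖w₂‖ ^ 2 ≤ (2 * |z|) ^ 2 := by gcongr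
      rw [mul_pow, sq_abs] at this
      have h5 := mul_le_mul_of_nonneg_left this hC.le
      gcongr
      linarith
    have h3 : |⟪A (perp l w₂), D⟫| ≤ a * (κ * |z|) * ‖D‖ :=
      (abs_real_inner_le_norm _ _).trans (by gcongr)
    rw [h1]
    refine (abs_add_le _ _).trans ?_
    linarith
  have hzsq : 0 < z ^ 2 := by positivity
  have hzz : |z| * |z| = z ^ 2 := by rw [← sq, sq_abs]
  have hne : ⟪F w₂, l⟫ ≠ 0 := by
    have : 0 < c * z ^ 2 := by positivity
    linarith
  have e5 : ⟪F w₁, l⟫ / ⟪F w₂, l⟫ - 1 = ⟪F w₁ - F w₂, l⟫ / ⟪F w₂, l⟫ := by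
    rw [inner_sub_left]; field_simp
  rw [e5]
  refine (le_trans (le_abs_self _) ?_).trans e1
  rw [abs_mul, abs_div]
  have e6 : c * z ^ 2 ≤ |⟪F w₂, l⟫| := hdrift.trans (neg_le_abs _)
  have e7 : |⟪F w₁ - F w₂, l⟫| / |⟪F w₂, l⟫| ≤ 2 * C * |z| * ‖D‖ / (c * z ^ 2) := by
    gcongr
  refine (mul_le_mul e7 e3 (abs_nonneg _) (by positivity)).trans ?_
  rw [div_mul_eq_mul_div, div_le_iff₀ (by positivity)]
  have e8 : 2 * C * |z| * ‖D‖ * ((a * κ * |z| + 4 * C * z ^ 2) * ‖D‖)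
      = (2 * C * a * κ + 8 * C ^ 2 * |z|) * (z ^ 2 * ‖D‖ ^ 2) := by
    rw [← hzz]; ring
  rw [e8]
  have e9 : (2 * C * a * κ + 8 * C ^ 2 * |z|) ≤ (m₀ - 2 * C * |z|) * c := by
    have h1 : 8 * C ^ 2 * |z| ≤ m₀ * c / 4 := by
      have : 8 * C ^ 2 * |z| ≤ 8 * C ^ 2 * r := by gcongr
      linarith
    have h2 : 2 * C * |z| * c ≤ m₀ / 4 * c := by
      have : 2 * C * |z| ≤ 2 * C * r := by gcongr
      gcongr
      linarith
    have h3 := mul_pos hm₀ hc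
    linarith
  have := mul_le_mul_of_nonneg_right e9 (by positivity : 0 ≤ z ^ 2 * ‖D‖ ^ 2)
  linarith

variable [FiniteDimensional ℝ E]

lemma exists_isFold {F : E → E} (hF : ContDiff ℝ 2 F) (h0 : F 0 = 0)
    (hpsd : PosSemidefForm (fderiv ℝ F 0))
    (hsym : ∀ y z, ⟪fderiv ℝ F 0 y, z⟫ = ⟪fderiv ℝ F 0 z, y⟫) {l : E} (hl : ‖l‖ = 1)
    (hker : LinearMap.ker (fderiv ℝ F 0 : E →ₗ[ℝ] E) = Submodule.span ℝ {l})
    (hβ : fderiv ℝ (fderiv ℝ (fun y => ⟪F y, l⟫)) 0 l l < 0) :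
    ∃ r κ c m C, IsFold F l r κ c m C := by
  set A := fderiv ℝ F 0 with hA
  have hAl : A l = 0 := by
    have : l ∈ LinearMap.ker (A : E →ₗ[ℝ] E) := hker ▸ Submodule.mem_span_singleton_self l
    exact this
  have hAinl : ∀ y, ⟪A y, l⟫ = 0 := fun y => by rw [hsym, hAl, inner_zero_left]
  have hAperp : ∀ w, A w = A (perp l w) := fun w => by simp [perp, hAl]
  obtain ⟨m₀, hm₀, hcoer⟩ := exists_pos_mul_sq_le_inner A (Submodule.span ℝ {l})ᗮ (by
    intro y hy hne
    refine lt_of_le_of_ne (hpsd y) fun h => hne ?_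
    have h1 : y ∈ LinearMap.ker (A : E →ₗ[ℝ] E) := hpsd.apply_eq_zero hsym h.symm
    rw [hker] at h1
    have h2 := hy y h1
    exact inner_self_eq_zero.1 h2)
  have hmem : ∀ y, ⟪y, l⟫ = 0 → y ∈ (Submodule.span ℝ {l})ᗮ := by
    intro y hy
    rw [Submodule.mem_orthogonal_singleton_iff_inner_left]
    exact hy
  have hcoer' : ∀ y, ⟪y, l⟫ = 0 → m₀ * ‖y‖ ^ 2 ≤ ⟪A y, y⟫ := fun y hy => hcoer y (hmem y hy)
  obtain ⟨C, hC, htay⟩ := exists_taylor_bound hF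
  rw [← hA] at htay
  have hφd : fderiv ℝ (fun y => ⟪F y, l⟫) 0 = 0 := by
    ext y
    have hd := (hF.differentiable (by norm_num)).differentiableAt (x := (0 : E))
    rw [fderiv_inner_apply ℝ hd (differentiableAt_const l)]
    simpa using hAinl y
  obtain ⟨r₁, hr₁, κ₀, hκ₀, c, hc, hdrift⟩ := exists_drift_bound
    (hF.inner ℝ contDiff_const) (by simp [h0]) hφd hl hβ
  set a := ‖A‖ + 1 with ha
  have hapos : 0 < a := by positivity
  set κ := min (min 1 κ₀) (m₀ * c / (8 * C * a)) with hκ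
  have hκpos : 0 < κ := lt_min (lt_min one_pos hκ₀) (by positivity)
  have hκ1 : κ ≤ 1 := (min_le_left _ _).trans (min_le_left _ _)
  have hκκ₀ : κ ≤ κ₀ := (min_le_left _ _).trans (min_le_right _ _)
  have hκa : 2 * C * a * κ ≤ m₀ * c / 4 := by
    have : κ ≤ m₀ * c / (8 * C * a) := min_le_right _ _
    rw [le_div_iff₀ (by positivity)] at this
    linarith
  set r := min (min r₁ (1 / 2)) (min (m₀ / (2 * C * (1 / κ + 1)))
    (min (m₀ / (8 * C)) (m₀ * c / (32 * C ^ 2)))) with hr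
  have hrpos : 0 < r := by
    refine lt_min (lt_min hr₁ (by norm_num)) (lt_min ?_ (lt_min ?_ ?_)) <;> positivity
  have hrr₁ : r ≤ r₁ := (min_le_left _ _).trans (min_le_left _ _)
  have hr2 : r ≤ 1 / 2 := (min_le_left _ _).trans (min_le_right _ _)
  have hr3 : 2 * C * (1 / κ + 1) * r ≤ m₀ := by
    have : r ≤ m₀ / (2 * C * (1 / κ + 1)) := (min_le_right _ _).trans (min_le_left _ _)
    rw [le_div_iff₀ (by positivity)] at this
    linarith
  have hr4 : 8 * C * r ≤ m₀ := by
    have : r ≤ m₀ / (8 * C) :=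
      (min_le_right _ _).trans ((min_le_right _ _).trans (min_le_left _ _))
    rw [le_div_iff₀ (by positivity)] at this
    linarith
  have hr5 : 32 * C ^ 2 * r ≤ m₀ * c := by
    have : r ≤ m₀ * c / (32 * C ^ 2) :=
      (min_le_right _ _).trans ((min_le_right _ _).trans (min_le_right _ _))
    rw [le_div_iff₀ (by positivity)] at this
    linarith
  have htay0 : ∀ w, ‖w‖ ≤ r → ‖F w - A w‖ ≤ C * ‖w‖ ^ 2 := by
    intro w hw
    have := htay ‖w‖ (by linarith) w 0 le_rfl (by simp)
    simpa [h0, sq, mul_assoc] using this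
  have hquad : ∀ w, ‖w‖ ≤ r → |⟪F w, l⟫| ≤ C * ‖w‖ ^ 2 := by
    intro w hw
    have h1 : ⟪F w, l⟫ = ⟪F w - A w, l⟫ := by rw [inner_sub_left, hAinl, sub_zero]
    rw [h1]
    refine (abs_real_inner_le_norm _ _).trans ?_
    rw [hl, mul_one]
    exact htay0 w hw
  have hFD : ∀ w, ‖w‖ ≤ r → ∀ D, |⟪F w - A w, D⟫| ≤ C * ‖w‖ ^ 2 * ‖D‖ := fun w hw D =>
    (abs_real_inner_le_norm _ _).trans (by gcongr; exact htay0 w hw)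
  -- outside the cone
  have hout : ∀ w, ‖w‖ ≤ r → κ * |⟪w, l⟫| < ‖perp l w‖ →
      ‖w‖ ≤ (1 / κ + 1) * ‖perp l w‖ ∧ C * ‖w‖ ^ 2 ≤ m₀ / 2 * ‖perp l w‖ ∧
      m₀ * ‖perp l w‖ ^ 2 - C * ‖w‖ ^ 2 * ‖perp l w‖ ≤ ⟪F w, perp l w⟫ := by
    intro w hw hcone
    have h1 : |⟪w, l⟫| ≤ 1 / κ * ‖perp l w‖ := by
      rw [div_mul_eq_mul_div, one_mul, le_div_iff₀ hκpos]
      linarith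
    have h2 : ‖w‖ ≤ (1 / κ + 1) * ‖perp l w‖ := by linarith [norm_le_perp_add hl w]
    have h3 : C * ‖w‖ ^ 2 ≤ m₀ / 2 * ‖perp l w‖ := by
      have : ‖w‖ ^ 2 ≤ r * ((1 / κ + 1) * ‖perp l w‖) := by
        rw [sq]
        gcongr
      have h5 : C * (r * ((1 / κ + 1) * ‖perp l w‖)) ≤ m₀ / 2 * ‖perp l w‖ := by
        have := mul_le_mul_of_nonneg_right hr3 (norm_nonneg (perp l w))
        linarith
      exact (mul_le_mul_of_nonneg_left this hC.le).trans h5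
    refine ⟨h2, h3, ?_⟩
    have h4 := hcoer' (perp l w) (inner_perp hl w)
    rw [← hAperp w] at h4
    have h5 := neg_le_of_abs_le (hFD w hw (perp l w))
    rw [inner_sub_left] at h5
    linarith
  refine ⟨r, κ, c, m₀ / 2 / (1 / κ + 1), C, hrpos, hκpos, hκ1, hc, by positivity, hl, ?_, ?_, ?_,
    ?_, hquad⟩
  · intro w hw hcone
    obtain ⟨h2, h3, h4⟩ := hout w hw hcone
    have h5 : κ ^ 2 * ⟪w, l⟫ * ⟪F w, l⟫ ≤ ‖perp l w‖ * (C * ‖w‖ ^ 2) := by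
      refine (le_abs_self _).trans ?_
      rw [abs_mul, abs_mul, abs_of_pos (by positivity : 0 < κ ^ 2)]
      refine mul_le_mul ?_ (hquad w hw) (abs_nonneg _) (norm_nonneg _)
      have h6 : κ ^ 2 * |⟪w, l⟫| ≤ κ * |⟪w, l⟫| := by
        gcongr
        exact pow_le_of_le_one hκpos.le hκ1 two_ne_zero
      linarith
    have h7 := mul_le_mul_of_nonneg_right h3 (norm_nonneg (perp l w))
    linarith
  · intro w hw hcone
    exact hdrift w (hw.trans hrr₁) (hcone.trans (by gcongr))
  · intro w₁ w₂ h₁ h₂ hz hz0 hc₁ hc₂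
    rw [hz] at hc₁
    exact contract_aux hl hm₀ hC hapos hc (by rw [ha]; linarith) hκ1 hr2 hr4 hr5 hκa hAinl
      hAperp (hcoer' _ (by rw [inner_sub_left, hz, sub_self])) htay (htay0 w₂ h₂)
      (hdrift w₂ (h₂.trans hrr₁) (hc₂.trans (by gcongr))) h₂ hz hz0 hc₁ hc₂
  · intro w hw hcone
    obtain ⟨h2, h3, h4⟩ := hout w hw hcone
    have hypos : 0 < ‖perp l w‖ := lt_of_le_of_lt (by positivity) hcone
    have h5 := (le_abs_self _).trans (abs_real_inner_le_norm (F w) (perp l w))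
    have h6 : m₀ / 2 * ‖perp l w‖ ≤ ‖F w‖ := by
      refine le_of_mul_le_mul_right ?_ hypos
      have h7 := mul_le_mul_of_nonneg_right h3 (norm_nonneg (perp l w))
      linarith
    rw [div_mul_eq_mul_div, div_le_iff₀ (by positivity)]
    calc m₀ / 2 * ‖w‖ ≤ m₀ / 2 * ((1 / κ + 1) * ‖perp l w‖) := by gcongr
      _ = m₀ / 2 * ‖perp l w‖ * (1 / κ + 1) := by ring
      _ ≤ ‖F w‖ * (1 / κ + 1) := by gcongr

end FoldExistence

section FoldExit

variable {E : Type*} [NormedAddCommGroup E] [InnerProductSpace ℝ E]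
  {F : E → E} {l : E} {r κ c m C : ℝ} {w : ℝ → E}

lemma IsFold.congr {F₁ : E → E} (h : IsFold F l r κ c m C) (hF : ∀ x, ‖x‖ ≤ r → F₁ x = F x) :
    IsFold F₁ l r κ c m C where
  r_pos := h.r_pos
  cone_pos := h.cone_pos
  cone_le := h.cone_le
  c_pos := h.c_pos
  m_pos := h.m_pos
  norm_l := h.norm_l
  repel w hw := by rw [hF w hw]; exact h.repel w hw
  drift w hw := by rw [hF w hw]; exact h.drift w hw
  contract w₁ w₂ h₁ h₂ := by rw [hF w₁ h₁, hF w₂ h₂]; exact h.contract w₁ w₂ h₁ h₂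
  coercive w hw := by rw [hF w hw]; exact h.coercive w hw
  quadratic w hw := by rw [hF w hw]; exact h.quadratic w hw

lemma IsFold.hasDerivAt_cone (h : IsFold F l r κ c m C) (hw : IsDescent F w) (s : ℝ) :
    HasDerivAt (fun s => ‖perp l (w s)‖ ^ 2 - κ ^ 2 * ⟪w s, l⟫ ^ 2)
      (-2 * (⟪F (w s), perp l (w s)⟫ - κ ^ 2 * ⟪w s, l⟫ * ⟪F (w s), l⟫)) s := by
  have h1 : (fun s => ‖perp l (w s)‖ ^ 2 - κ ^ 2 * ⟪w s, l⟫ ^ 2)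
      = fun s => ‖w s‖ ^ 2 - (1 + κ ^ 2) * ⟪w s, l⟫ ^ 2 := by
    funext s
    rw [norm_sq_perp h.norm_l (w s)]
    ring
  rw [h1]
  convert! (hw.hasDerivAt_norm_sq s).sub
    (((hw.hasDerivAt_inner l s).pow 2).const_mul (1 + κ ^ 2)) using 1
  simp only [perp, inner_sub_right, inner_smul_right]
  push_cast
  ring

/-- The quadratic cone is a barrier as long as the orbit remains in the ball. -/
lemma IsFold.cone_le_of_le (h : IsFold F l r κ c m C) (hw : IsDescent F w) {a b q : ℝ}
    (hab : a ≤ b) (hr : ∀ s ∈ Icc a b, ‖w s‖ ≤ r) (hq : 0 ≤ q)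
    (ha : ‖perp l (w a)‖ ^ 2 - κ ^ 2 * ⟪w a, l⟫ ^ 2 ≤ q) :
    ‖perp l (w b)‖ ^ 2 - κ ^ 2 * ⟪w b, l⟫ ^ 2 ≤ q := by
  refine le_of_deriv_nonpos_of_lt (Q := fun s => ‖perp l (w s)‖ ^ 2 - κ ^ 2 * ⟪w s, l⟫ ^ 2)
    hab (fun s _ => h.hasDerivAt_cone hw s) (fun s hs hlt => ?_) ha
  have h1 : (κ * |⟪w s, l⟫|) ^ 2 < ‖perp l (w s)‖ ^ 2 := by
    rw [mul_pow, sq_abs]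
    linarith
  have := h.repel (w s) (hr s hs) (lt_of_pow_lt_pow_left₀ 2 (norm_nonneg _) h1)
  linarith

lemma IsFold.mem_cone_iff (h : IsFold F l r κ c m C) (x : E) :
    ‖perp l x‖ ^ 2 - κ ^ 2 * ⟪x, l⟫ ^ 2 ≤ 0 ↔ ‖perp l x‖ ≤ κ * |⟪x, l⟫| := by
  rw [sub_nonpos, ← sq_abs ⟪x, l⟫, ← mul_pow]
  exact pow_le_pow_iff_left₀ (norm_nonneg _) (mul_nonneg h.cone_pos.le (abs_nonneg _)) two_ne_zero

lemma IsFold.norm_le_of_cone (h : IsFold F l r κ c m C) {x : E}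
    (hx : ‖perp l x‖ ≤ κ * |⟪x, l⟫|) : ‖x‖ ≤ 2 * |⟪x, l⟫| := by
  have h1 := norm_le_perp_add h.norm_l x
  have h2 := mul_le_of_le_one_left (abs_nonneg ⟪x, l⟫) h.cone_le
  linarith

lemma IsFold.abs_inner_le (h : IsFold F l r κ c m C) (x : E) : |⟪x, l⟫| ≤ ‖x‖ := by
  simpa [h.norm_l] using abs_real_inner_le_norm x l

/-- Along an orbit in the cone, the coordinate in the direction of `l` is nondecreasing. -/
lemma IsFold.monotoneOn_inner (h : IsFold F l r κ c m C) (hw : IsDescent F w) {I : Set ℝ}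
    (hI : Convex ℝ I) (hr : ∀ s ∈ I, ‖w s‖ ≤ r)
    (hcone : ∀ s ∈ I, ‖perp l (w s)‖ ≤ κ * |⟪w s, l⟫|) :
    MonotoneOn (fun s => ⟪w s, l⟫) I := by
  refine monotoneOn_of_deriv_nonneg hI
    (fun s _ => (hw.hasDerivAt_inner l s).continuousAt.continuousWithinAt)
    (fun s _ => (hw.hasDerivAt_inner l s).differentiableAt.differentiableWithinAt) fun s hs => ?_
  rw [(hw.hasDerivAt_inner l s).deriv]
  have h1 := h.drift (w s) (hr s (interior_subset hs)) (hcone s (interior_subset hs))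
  have h2 : 0 ≤ c * ⟪w s, l⟫ ^ 2 := mul_nonneg h.c_pos.le (sq_nonneg _)
  linarith

/-- Along an orbit in the cone, the coordinate in the direction of `l` grows at least linearly. -/
lemma IsFold.inner_add_le (h : IsFold F l r κ c m C) (hw : IsDescent F w) {a b δ : ℝ}
    (hab : a ≤ b) (hδ : 0 ≤ δ) (hr : ∀ s ∈ Icc a b, ‖w s‖ ≤ r)
    (hcone : ∀ s ∈ Icc a b, ‖perp l (w s)‖ ≤ κ * |⟪w s, l⟫|) (hz : ∀ s ∈ Icc a b, δ ≤ ⟪w s, l⟫) :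
    ⟪w a, l⟫ + c * δ ^ 2 * (b - a) ≤ ⟪w b, l⟫ := by
  have := (convex_Icc a b).mul_sub_le_image_sub_of_le_deriv (f := fun s => ⟪w s, l⟫)
    (C := c * δ ^ 2)
    (fun s _ => (hw.hasDerivAt_inner l s).continuousAt.continuousWithinAt)
    (fun s _ => (hw.hasDerivAt_inner l s).differentiableAt.differentiableWithinAt)
    (fun s hs => by
      have hs' := interior_subset hs
      rw [(hw.hasDerivAt_inner l s).deriv]
      refine le_trans ?_ (h.drift (w s) (hr s hs') (hcone s hs'))
      have := h.c_pos
      have := hz s hs'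
      gcongr) a (left_mem_Icc.2 hab) b (right_mem_Icc.2 hab) hab
  linarith

/-- The part of the closed unstable cone inside the ball. -/
def unstableCone (l : E) (r κ : ℝ) : Set E := {x | ‖x‖ ≤ r ∧ ‖perp l x‖ ≤ κ * ⟪x, l⟫}

lemma isClosed_unstableCone (l : E) (r κ : ℝ) : IsClosed (unstableCone l r κ) := by
  have h1 := continuous_perp (E := E) l
  refine (isClosed_le continuous_norm continuous_const).inter
    (isClosed_le h1.norm (by fun_prop))

lemma IsFold.inner_nonneg (h : IsFold F l r κ c m C) {x : E} (hx : x ∈ unstableCone l r κ) :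
    0 ≤ ⟪x, l⟫ :=
  nonneg_of_mul_nonneg_right ((norm_nonneg _).trans hx.2) h.cone_pos

lemma IsFold.mem_unstableCone_iff (h : IsFold F l r κ c m C) {x : E} :
    x ∈ unstableCone l r κ ↔ ‖x‖ ≤ r ∧ ‖perp l x‖ ≤ κ * |⟪x, l⟫| ∧ 0 ≤ ⟪x, l⟫ := by
  refine ⟨fun hx => ⟨hx.1, ?_, h.inner_nonneg hx⟩, fun hx => ⟨hx.1, ?_⟩⟩
  · rw [abs_of_nonneg (h.inner_nonneg hx)]; exact hx.2
  · rw [← abs_of_nonneg hx.2.2]; exact hx.2.1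

lemma IsFold.mem_unstableCone_of_Icc (h : IsFold F l r κ c m C) (hw : IsDescent F w) {a b : ℝ}
    (ha : w a ∈ unstableCone l r κ) (hr : ∀ s ∈ Icc a b, ‖w s‖ ≤ r) :
    ∀ s ∈ Icc a b, w s ∈ unstableCone l r κ ∧ ⟪w a, l⟫ ≤ ⟪w s, l⟫ := by
  have ha' := h.mem_unstableCone_iff.1 ha
  have hcone : ∀ s ∈ Icc a b, ‖perp l (w s)‖ ≤ κ * |⟪w s, l⟫| := fun s hs =>
    (h.mem_cone_iff _).1 (h.cone_le_of_le hw hs.1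
      (fun σ hσ => hr σ ⟨hσ.1, hσ.2.trans hs.2⟩) le_rfl ((h.mem_cone_iff _).2 ha'.2.1))
  intro s hs
  have hmono := h.monotoneOn_inner hw (convex_Icc a b) hr hcone
    (left_mem_Icc.2 (hs.1.trans hs.2)) hs hs.1
  exact ⟨h.mem_unstableCone_iff.2 ⟨hr s hs, hcone s hs, ha'.2.2.trans hmono⟩, hmono⟩

/-- An orbit started on the unstable axis reaches the sphere of radius `r` through the cone. -/
lemma IsFold.exists_exit (h : IsFold F l r κ c m C) (hw : IsDescent F w) {ε : ℝ} (hε : 0 < ε)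
    (hεr : ε < r) (h0 : w 0 = ε • l) :
    ∃ t, 0 ≤ t ∧ ‖w t‖ = r ∧ ∀ s ∈ Icc 0 t, w s ∈ unstableCone l r κ := by
  have hl := h.norm_l
  have hinner : ⟪w 0, l⟫ = ε := by simp [h0, inner_smul_left, hl]
  have hnorm : ‖w 0‖ = ε := by rw [h0, norm_smul, hl, mul_one, Real.norm_of_nonneg hε.le]
  have hcone0 : w 0 ∈ unstableCone l r κ := by
    refine ⟨by linarith, ?_⟩
    have : perp l (w 0) = 0 := by rw [perp, hinner, h0, sub_self]
    rw [this, norm_zero, hinner]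
    exact mul_nonneg h.cone_pos.le hε.le
  set S := {s : ℝ | 0 ≤ s ∧ r ≤ ‖w s‖} with hS
  have hclosed : IsClosed S := isClosed_Ici.inter (isClosed_le continuous_const hw.continuous.norm)
  have hcε : 0 < c * ε ^ 2 := mul_pos h.c_pos (by positivity)
  have hne : S.Nonempty := by
    by_contra hemp
    have hlt : ∀ s, 0 ≤ s → ‖w s‖ ≤ r := fun s hs => by
      by_contra hcon
      exact hemp ⟨s, hs, (not_le.1 hcon).le⟩
    have hb : (0 : ℝ) ≤ r / (c * ε ^ 2) := div_nonneg h.r_pos.le hcε.le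
    have hIcc := h.mem_unstableCone_of_Icc hw hcone0 (b := r / (c * ε ^ 2))
      fun s hs => hlt s hs.1
    have h1 := h.inner_add_le hw hb hε.le (fun s hs => hlt s hs.1)
      (fun s hs => (h.mem_unstableCone_iff.1 (hIcc s hs).1).2.1)
      (fun s hs => hinner ▸ (hIcc s hs).2)
    rw [sub_zero, mul_div_cancel₀ _ hcε.ne', hinner] at h1
    have h2 := (le_abs_self _).trans (h.abs_inner_le (w (r / (c * ε ^ 2))))
    have h3 := hlt _ hb
    linarith
  have hbdd : BddBelow S := ⟨0, fun s hs => hs.1⟩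
  have hmem : sInf S ∈ S := hclosed.csInf_mem hne hbdd
  have hbefore : ∀ s, 0 ≤ s → s < sInf S → ‖w s‖ < r := fun s hs hlt => by
    by_contra hcon
    exact absurd (csInf_le hbdd (show s ∈ S from ⟨hs, not_lt.1 hcon⟩)) (not_le.2 hlt)
  have hpos : 0 < sInf S := by
    refine lt_of_le_of_ne hmem.1 fun heq => ?_
    have := hmem.2
    rw [← heq, hnorm] at this
    linarith
  have hle : ‖w (sInf S)‖ ≤ r := by
    have ht : Tendsto (fun s => ‖w s‖) (𝓝[<] (sInf S)) (𝓝 ‖w (sInf S)‖) :=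
      (hw.continuous.norm.tendsto _).mono_left nhdsWithin_le_nhds
    refine le_of_tendsto ht ?_
    filter_upwards [Ioo_mem_nhdsLT hpos] with s hs using (hbefore s hs.1.le hs.2).le
  refine ⟨sInf S, hmem.1, le_antisymm hle hmem.2, fun s hs => ?_⟩
  refine (h.mem_unstableCone_of_Icc hw hcone0 (fun s hs => ?_) s hs).1
  rcases hs.2.lt_or_eq with hlt | heq
  · exact (hbefore s hs.1 hlt).le
  · rw [heq]; exact hle

/-- An orbit which stays in the cone for all negative times tends to the origin. -/
lemma IsFold.tendsto_atBot (h : IsFold F l r κ c m C) (hw : IsDescent F w) {S : ℝ}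
    (hcone : ∀ s ≤ S, w s ∈ unstableCone l r κ) : Tendsto w atBot (𝓝 0) := by
  have hr : ∀ s ∈ Iic S, ‖w s‖ ≤ r := fun s hs => (hcone s hs).1
  have hc : ∀ s ∈ Iic S, ‖perp l (w s)‖ ≤ κ * |⟪w s, l⟫| := fun s hs =>
    (h.mem_unstableCone_iff.1 (hcone s hs)).2.1
  have hmono := h.monotoneOn_inner hw (convex_Iic S) hr hc
  have key : ∀ δ > 0, ∃ s₀ ≤ S, ∀ s ≤ s₀, ⟪w s, l⟫ < δ := by
    intro δ hδ
    by_contra hcon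
    push Not at hcon
    have hz : ∀ s ≤ S, δ ≤ ⟪w s, l⟫ := fun s hs => by
      obtain ⟨s', hs', hle⟩ := hcon s hs
      exact hle.trans (hmono (hs'.trans hs) hs hs')
    have hcδ : 0 < c * δ ^ 2 := mul_pos h.c_pos (by positivity)
    have hsub : S - ⟪w S, l⟫ / (c * δ ^ 2) ≤ S := by
      have : 0 ≤ ⟪w S, l⟫ / (c * δ ^ 2) := div_nonneg (hδ.le.trans (hz S le_rfl)) hcδ.le
      linarith
    have h1 := h.inner_add_le hw hsub hδ.le (fun s hs => hr s hs.2) (fun s hs => hc s hs.2)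
      (fun s hs => hz s hs.2)
    rw [sub_sub_cancel, mul_div_cancel₀ _ hcδ.ne'] at h1
    have h2 := hz _ hsub
    linarith
  rw [tendsto_zero_iff_norm_tendsto_zero, Metric.tendsto_nhds]
  intro ε hε
  obtain ⟨s₀, hs₀, hlt⟩ := key (ε / 2) (by linarith)
  filter_upwards [Iic_mem_atBot s₀] with s hs
  have hsS : s ≤ S := le_trans hs hs₀
  have h1 := h.norm_le_of_cone (hc s hsS)
  rw [abs_of_nonneg (h.inner_nonneg (hcone s hsS))] at h1
  rw [dist_zero_right, norm_norm]
  have := hlt s hs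
  linarith

variable [FiniteDimensional ℝ E]

/-- A globally Lipschitz bounded field with a fold at the origin has an orbit which is emitted
by the origin through the unstable cone. -/
lemma IsFold.exists_orbit (h : IsFold F l r κ c m C) (h0 : F 0 = 0) {L : ℝ}
    (hL : ∀ x, ‖F x‖ ≤ L) {K : NNReal} (hK : LipschitzWith K F) :
    ∃ w, IsDescent F w ∧ Tendsto w atBot (𝓝 0) ∧ ‖w 0‖ = r ∧ ∀ s ≤ 0, ‖w s‖ ≤ r := by
  have hrpos := h.r_pos
  set ε : ℕ → ℝ := fun k => r / (k + 2) with hεdef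
  have hε0 : ∀ k, 0 < ε k := fun k => by positivity
  have hεr : ∀ k, ε k < r := fun k => by
    rw [hεdef]
    exact div_lt_self hrpos (by have : (0:ℝ) ≤ k := k.cast_nonneg; linarith)
  have hεlim : Tendsto ε atTop (𝓝 0) :=
    tendsto_const_nhds.div_atTop (tendsto_atTop_add_const_right _ _ tendsto_natCast_atTop_atTop)
  choose ω hω hω0 using fun k => exists_isDescent hL hK (ε k • l)
  choose t ht htr htc using fun k => h.exists_exit (hω k) (hε0 k) (hεr k) (hω0 k)
  obtain ⟨q, hq, φ, hφ, hlim⟩ := (isCompact_sphere (0 : E) r).tendsto_subseq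
    (x := fun k => ω k (t k)) (fun k => by simpa using htr k)
  obtain ⟨w, hw, hw0⟩ := exists_isDescent hL hK q
  have hzero : IsDescent F (fun _ => (0 : E)) := fun s => by
    simpa [h0] using hasDerivAt_const s (0 : E)
  have htlarge : ∀ N : ℝ, 0 ≤ N → ∀ᶠ k in atTop, N ≤ t k := by
    intro N hN
    have h1 : Tendsto (fun k => ε k * Real.exp (K * N)) atTop (𝓝 0) := by
      simpa using hεlim.mul_const (Real.exp (K * N))
    filter_upwards [h1.eventually_lt_const hrpos] with k hk
    by_contra hcon
    have h2 := IsDescent.dist_le hK (hω k) hzero (t k)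
    rw [dist_zero_right, dist_zero_right, htr, hω0, norm_smul, h.norm_l, mul_one,
      Real.norm_of_nonneg (hε0 k).le, abs_of_nonneg (ht k)] at h2
    have h3 : ε k * Real.exp (K * t k) ≤ ε k * Real.exp (K * N) := by
      have := hε0 k
      have := (not_le.1 hcon).le
      gcongr
    linarith
  have hcone : ∀ s ≤ 0, w s ∈ unstableCone l r κ := by
    intro s hs
    have hconv : Tendsto (fun k => ω (φ k) (s + t (φ k))) atTop (𝓝 (w s)) := by
      rw [tendsto_iff_dist_tendsto_zero]
      have h1 : Tendsto (fun k => dist (ω (φ k) (t (φ k))) q * Real.exp (K * |s|)) atTop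
          (𝓝 0) := by
        simpa using (tendsto_iff_dist_tendsto_zero.1 hlim).mul_const (Real.exp (K * |s|))
      refine squeeze_zero (fun _ => dist_nonneg) (fun k => ?_) h1
      have := IsDescent.dist_le hK ((hω (φ k)).comp_add (t (φ k))) hw s
      simpa [hw0] using this
    refine (isClosed_unstableCone l r κ).mem_of_tendsto hconv ?_
    filter_upwards [hφ.tendsto_atTop.eventually (htlarge (-s) (by linarith))] with k hk
    exact htc (φ k) _ ⟨by linarith, by linarith⟩
  exact ⟨w, hw, h.tendsto_atBot hw hcone, by simpa [hw0] using hq, fun s hs => (hcone s hs).1⟩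

/-- Existence of an orbit emitted by a fold point of a field which points outward far away. -/
lemma exists_heteroclinic {G : E → E} {ξ : E} (hG : ContDiff ℝ 1 G) (hξ : G ξ = 0)
    (h : IsFold (fun x => G (ξ + x)) l r κ c m C) {M : ℝ}
    (hM : ∀ x, M < ‖x‖ ^ 2 → 0 ≤ ⟪G x, x⟫) :
    ∃ w, IsDescent G w ∧ Tendsto w atBot (𝓝 ξ) ∧ ∃ s₁ s₂, w s₁ ≠ w s₂ := by
  set R := max (Real.sqrt M) (‖ξ‖ + r) with hR
  have hR0 : 0 ≤ R := (Real.sqrt_nonneg _).trans (le_max_left _ _)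
  have hball : ∀ x, ‖x‖ ≤ r → ‖ξ + x‖ ≤ R := fun x hx =>
    (norm_add_le _ _).trans ((by linarith : ‖ξ‖ + ‖x‖ ≤ ‖ξ‖ + r).trans (le_max_right _ _))
  obtain ⟨G₁, χ, hχ, hG₁χ, hG₁, ⟨L, hL⟩, K, hK⟩ := exists_truncation hG R
  have hfold : IsFold (fun x => G₁ (ξ + x)) l r κ c m C := h.congr fun x hx => hG₁ _ (hball x hx)
  have hK' : LipschitzWith K (fun x => G₁ (ξ + x)) := by
    refine LipschitzWith.of_dist_le_mul fun x y => ?_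
    have := hK.dist_le_mul (ξ + x) (ξ + y)
    rwa [dist_add_left] at this
  obtain ⟨w, hw, hlim, hwr, hwneg⟩ := hfold.exists_orbit
    (by simpa [hξ] using hG₁ ξ (by simpa using hball 0 (by simpa using h.r_pos.le)))
    (fun x => hL _) hK'
  have hv : IsDescent G₁ (fun s => ξ + w s) := fun s => (hw s).const_add ξ
  have hout : ∀ x, R ^ 2 < ‖x‖ ^ 2 → 0 ≤ ⟪G₁ x, x⟫ := fun x hx => by
    rw [hG₁χ, inner_smul_left]
    refine mul_nonneg (hχ x) (hM x (lt_of_le_of_lt ?_ hx))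
    exact (Real.sqrt_le_left hR0).1 (le_max_left _ _)
  have hbound : ∀ s, ‖ξ + w s‖ ≤ R := by
    intro s
    rcases le_total s 0 with hs | hs
    · exact hball _ (hwneg s hs)
    · have := hv.norm_sq_le hout hs (by have := hball _ (hwneg 0 le_rfl); gcongr)
      exact le_of_sq_le_sq this hR0
  refine ⟨fun s => ξ + w s, fun s => ?_, by simpa using hlim.const_add ξ, ?_⟩
  · have := hv s
    rwa [hG₁ _ (hbound s)] at this
  · by_contra hcon
    push Not at hcon
    have h1 : ∀ s, w s = w 0 := fun s => add_left_cancel (hcon s 0)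
    have h2 : w 0 = 0 := tendsto_nhds_unique
      ((tendsto_const_nhds (x := w 0) (f := (atBot : Filter ℝ))).congr fun s => (h1 s).symm) hlim
    rw [h2, norm_zero] at hwr
    exact h.r_pos.ne hwr

end FoldExit

section FoldUnique

variable {E : Type*} [NormedAddCommGroup E] [InnerProductSpace ℝ E]
  {F : E → E} {l : E} {r κ c m C : ℝ}

/-- A local parametrization by the values of a function with positive derivative. -/
lemma exists_inverse_of_deriv_pos {z z' : ℝ → ℝ} {S : ℝ} (hz : ∀ s ≤ S, HasDerivAt z (z' s) s)
    (hz' : ∀ s ≤ S, 0 < z' s) (hlim : Tendsto z atBot (𝓝 0)) :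
    ∃ g : ℝ → ℝ, ∀ y ∈ Ioo 0 (z S), g y ≤ S ∧ z (g y) = y ∧ HasDerivAt g (z' (g y))⁻¹ y := by
  have hcont : ContinuousOn z (Iic S) := fun s hs => (hz s hs).continuousAt.continuousWithinAt
  have hmono : StrictMonoOn z (Iic S) := by
    refine strictMonoOn_of_deriv_pos (convex_Iic S) hcont fun s hs => ?_
    rw [interior_Iic] at hs
    rw [(hz s (le_of_lt hs)).deriv]
    exact hz' s (le_of_lt hs)
  have hpos : ∀ s ≤ S, 0 < z s := fun s hs => by
    have h1 : z (s - 1) < z s := hmono (by simp; linarith) hs (by linarith)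
    refine lt_of_le_of_lt (le_of_tendsto hlim ?_) h1
    filter_upwards [Iic_mem_atBot (s - 1)] with σ hσ
    have hσ' : σ ≤ s - 1 := hσ
    exact hmono.monotoneOn (by simp; linarith) (by simp; linarith) hσ'
  have hex : ∀ y, ∃ s, y ∈ Ioo 0 (z S) → s < S ∧ z s = y := by
    intro y
    by_cases hy : y ∈ Ioo 0 (z S)
    · obtain ⟨s₀, h1, h2⟩ := ((hlim.eventually_lt_const hy.1).and (Iic_mem_atBot S)).exists
      obtain ⟨s, hs, hsy⟩ := intermediate_value_Icc (show s₀ ≤ S from h2)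
        (hcont.mono Icc_subset_Iic_self) ⟨h1.le, hy.2.le⟩
      refine ⟨s, fun _ => ⟨lt_of_le_of_ne hs.2 ?_, hsy⟩⟩
      rintro rfl
      exact hy.2.ne' hsy
    · exact ⟨0, fun h => absurd h hy⟩
  choose g hg using hex
  have hgmono : MonotoneOn g (Ioo 0 (z S)) := fun y hy y' hy' hle => by
    by_contra hcon
    have := hmono (hg y' hy').1.le (hg y hy).1.le (not_le.1 hcon)
    rw [(hg y hy).2, (hg y' hy').2] at this
    linarith
  have himage : Iio S ⊆ g '' Ioo 0 (z S) := fun s hs => by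
    have hs' : s ≤ S := le_of_lt hs
    have hmem : z s ∈ Ioo 0 (z S) := ⟨hpos s hs', hmono hs' self_mem_Iic hs⟩
    exact ⟨z s, hmem, hmono.injOn (hg _ hmem).1.le hs' (hg _ hmem).2⟩
  refine ⟨g, fun y hy => ⟨(hg y hy).1.le, (hg y hy).2, ?_⟩⟩
  have hnhds : Ioo 0 (z S) ∈ 𝓝 y := Ioo_mem_nhds hy.1 hy.2
  have hgc : ContinuousAt g y := continuousAt_of_monotoneOn_of_image_mem_nhds hgmono hnhds
    (mem_of_superset (Iio_mem_nhds (hg y hy).1) himage)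
  refine HasDerivAt.of_local_left_inverse hgc (hz _ (hg y hy).1.le)
    (hz' _ (hg y hy).1.le).ne' ?_
  filter_upwards [hnhds] with y' hy' using (hg y' hy').2

variable [FiniteDimensional ℝ E]

/-- A nonconstant orbit emitted by the origin eventually lies in the unstable cone. -/
lemma IsFold.eventually_mem_cone (h : IsFold F l r κ c m C) (hF : ContDiff ℝ 1 F) (h0 : F 0 = 0)
    {w : ℝ → E} (hw : IsDescent F w) (hlim : Tendsto w atBot (𝓝 0)) (hne : ∃ s₁ s₂, w s₁ ≠ w s₂) :
    ∃ S, ∀ s ≤ S, w s ∈ unstableCone l r κ ∧ 0 < ⟪w s, l⟫ := by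
  have hzero : ∀ s, w s ≠ 0 := fun s hs => by
    have hc : IsDescent F (fun _ => (0 : E)) := fun s => by
      simpa [h0] using hasDerivAt_const s (0 : E)
    have heq := hw.eq_of_eq_at hF hc (s₀ := s) hs
    obtain ⟨s₁, s₂, h12⟩ := hne
    exact h12 (by rw [heq])
  have hn : Tendsto (fun s => ‖w s‖) atBot (𝓝 0) := by simpa using hlim.norm
  obtain ⟨S, hS⟩ := (hn.eventually_le_const h.r_pos).exists_forall_of_atBot
  have hzlim : Tendsto (fun s => ⟪w s, l⟫) atBot (𝓝 0) := by
    simpa using hlim.inner (tendsto_const_nhds (x := l))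
  have hQlim : Tendsto (fun s => ‖perp l (w s)‖ ^ 2 - κ ^ 2 * ⟪w s, l⟫ ^ 2) atBot (𝓝 0) := by
    have h1 : Tendsto (fun s => perp l (w s)) atBot (𝓝 0) := by
      have := ((continuous_perp l).tendsto 0).comp hlim
      simpa [perp, Function.comp_def] using this
    simpa using (h1.norm.pow 2).sub ((hzlim.pow 2).const_mul (κ ^ 2))
  have hcone : ∀ s ≤ S, ‖perp l (w s)‖ ≤ κ * |⟪w s, l⟫| := by
    intro s hs
    rw [← h.mem_cone_iff]
    by_contra hcon
    have hpos := not_le.1 hcon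
    obtain ⟨a, ha1, ha2⟩ := ((hQlim.eventually_le_const (half_pos hpos)).and
      (Iic_mem_atBot s)).exists
    have := h.cone_le_of_le hw ha2 (fun σ hσ => hS σ (hσ.2.trans hs)) (half_pos hpos).le ha1
    linarith
  have hmono := h.monotoneOn_inner hw (convex_Iic S) hS hcone
  have hnonneg : ∀ s ≤ S, 0 ≤ ⟪w s, l⟫ := fun s hs => by
    refine le_of_tendsto hzlim ?_
    filter_upwards [Iic_mem_atBot s] with σ hσ
    exact hmono (le_trans hσ hs) hs hσ
  refine ⟨S, fun s hs => ⟨h.mem_unstableCone_iff.2 ⟨hS s hs, hcone s hs, hnonneg s hs⟩, ?_⟩⟩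
  refine lt_of_le_of_ne (hnonneg s hs) fun heq => hzero s ?_
  have := h.norm_le_of_cone (hcone s hs)
  rw [← heq, abs_zero, mul_zero] at this
  exact norm_le_zero_iff.1 this

/-- Uniqueness, up to time-translation, of the orbit emitted by a fold point. -/
lemma IsFold.eq_comp_add (h : IsFold F l r κ c m C) (hF : ContDiff ℝ 1 F) (h0 : F 0 = 0)
    {w₁ w₂ : ℝ → E} (hw₁ : IsDescent F w₁) (hw₂ : IsDescent F w₂)
    (hlim₁ : Tendsto w₁ atBot (𝓝 0)) (hlim₂ : Tendsto w₂ atBot (𝓝 0))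
    (hne₁ : ∃ s₁ s₂, w₁ s₁ ≠ w₁ s₂) (hne₂ : ∃ s₁ s₂, w₂ s₁ ≠ w₂ s₂) :
    ∃ τ, ∀ s, w₁ s = w₂ (s + τ) := by
  obtain ⟨S₁, hS₁⟩ := h.eventually_mem_cone hF h0 hw₁ hlim₁ hne₁
  obtain ⟨S₂, hS₂⟩ := h.eventually_mem_cone hF h0 hw₂ hlim₂ hne₂
  have hdrift : ∀ x, x ∈ unstableCone l r κ ∧ 0 < ⟪x, l⟫ → 0 < -⟪F x, l⟫ := fun x hx => by
    have h1 := h.mem_unstableCone_iff.1 hx.1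
    exact lt_of_lt_of_le (mul_pos h.c_pos (pow_pos hx.2 2)) (h.drift x h1.1 h1.2.1)
  have hzlim : ∀ {w : ℝ → E}, Tendsto w atBot (𝓝 0) →
      Tendsto (fun s => ⟪w s, l⟫) atBot (𝓝 0) := fun hw => by
    simpa using hw.inner (tendsto_const_nhds (x := l))
  obtain ⟨g, hg⟩ := exists_inverse_of_deriv_pos (z := fun s => ⟪w₂ s, l⟫)
    (fun s _ => hw₂.hasDerivAt_inner l s) (fun s hs => hdrift _ (hS₂ s hs)) (hzlim hlim₂)
  obtain ⟨S, hS⟩ := (((hzlim hlim₁).eventually_lt_const (hS₂ S₂ le_rfl).2).and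
    (Iic_mem_atBot S₁)).exists_forall_of_atBot
  have hmem : ∀ s ≤ S, ⟪w₁ s, l⟫ ∈ Ioo 0 ⟪w₂ S₂, l⟫ := fun s hs =>
    ⟨(hS₁ s (hS s hs).2).2, (hS s hs).1⟩
  have hg₁ : ∀ s ≤ S, g ⟪w₁ s, l⟫ ≤ S₂ := fun s hs => (hg _ (hmem s hs)).1
  have hg₂ : ∀ s ≤ S, ⟪w₂ (g ⟪w₁ s, l⟫), l⟫ = ⟪w₁ s, l⟫ := fun s hs => (hg _ (hmem s hs)).2.1
  set D : ℝ → E := fun s => w₁ s - w₂ (g ⟪w₁ s, l⟫) with hD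
  have hDd : ∀ s ≤ S, HasDerivAt D (-F (w₁ s)
      + (⟪F (w₁ s), l⟫ / ⟪F (w₂ (g ⟪w₁ s, l⟫)), l⟫) • F (w₂ (g ⟪w₁ s, l⟫))) s := by
    intro s hs
    have h1 : HasDerivAt (fun s => g ⟪w₁ s, l⟫) _ s :=
      (hg _ (hmem s hs)).2.2.comp s (hw₁.hasDerivAt_inner l s)
    have h2 : HasDerivAt (fun s => w₂ (g ⟪w₁ s, l⟫)) _ s :=
      (hw₂ (g ⟪w₁ s, l⟫)).scomp s h1
    convert! (hw₁ s).sub h2 using 1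
    rw [smul_neg, sub_neg_eq_add, inv_neg, neg_mul_neg, div_eq_inv_mul]
  have hDsq : AntitoneOn (fun s => ‖D s‖ ^ 2) (Iic S) := by
    refine antitoneOn_of_deriv_nonpos (convex_Iic S)
      (fun s hs => (hDd s hs).norm_sq.continuousAt.continuousWithinAt)
      (fun s hs => (hDd s (interior_subset hs :
        s ∈ Iic S)).norm_sq.differentiableAt.differentiableWithinAt)
      fun s hs => ?_
    have hs' : s ≤ S := (interior_subset hs : s ∈ Iic S)
    rw [(hDd s hs').norm_sq.deriv]
    have hc₁ := h.mem_unstableCone_iff.1 (hS₁ s (hS s hs').2).1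
    have hc₂ := h.mem_unstableCone_iff.1 (hS₂ _ (hg₁ s hs')).1
    have := h.contract (w₁ s) (w₂ (g ⟪w₁ s, l⟫)) hc₁.1 hc₂.1 (hg₂ s hs').symm
      (hS₂ _ (hg₁ s hs')).2.ne' hc₁.2.1 hc₂.2.1
    rw [inner_add_right, inner_neg_right, inner_smul_right, real_inner_comm,
      real_inner_comm _ (D s)]
    rw [inner_sub_left] at this
    change (_ - 1) * ⟪_, D s⟫ ≤ ⟪_, D s⟫ - ⟪_, D s⟫ at this
    linarith
  have hDzero : D S = 0 := by
    have hbd : ∀ s ≤ S, ‖D s‖ ≤ 4 * ⟪w₁ s, l⟫ := fun s hs => by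
      have hc₁ := h.mem_unstableCone_iff.1 (hS₁ s (hS s hs).2).1
      have hc₂ := h.mem_unstableCone_iff.1 (hS₂ _ (hg₁ s hs)).1
      have h1 := h.norm_le_of_cone hc₁.2.1
      have h2 := h.norm_le_of_cone hc₂.2.1
      rw [hg₂ s hs] at h2
      rw [abs_of_nonneg hc₁.2.2] at h1 h2
      exact (norm_sub_le _ _).trans (by linarith)
    have hlim : Tendsto (fun s => (4 * ⟪w₁ s, l⟫) ^ 2) atBot (𝓝 0) := by
      simpa using ((hzlim hlim₁).const_mul 4).pow 2
    have h1 : ‖D S‖ ^ 2 ≤ 0 := by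
      refine ge_of_tendsto hlim ?_
      filter_upwards [Iic_mem_atBot S] with s hs
      refine (hDsq hs self_mem_Iic hs).trans ?_
      have := hbd s hs
      simp only
      gcongr
    exact norm_eq_zero.1 (pow_eq_zero_iff two_ne_zero |>.1 (le_antisymm h1 (sq_nonneg _)))
  refine ⟨g ⟪w₁ S, l⟫ - S, fun s => ?_⟩
  refine congrFun (hw₁.eq_of_eq_at hF (hw₂.comp_add (g ⟪w₁ S, l⟫ - S)) (s₀ := S) ?_) s
  simpa using sub_eq_zero.1 hDzero

end FoldUnique

section FoldSign

variable {n : ℕ} {T : ℝ} {f : ℝ → EuclideanSpace ℝ (Fin n) → ℝ}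

lemma thirdDeriv_smul (t : ℝ) (x l : EuclideanSpace ℝ (Fin n)) (s : ℝ) :
    thirdDeriv f t x (s • l) = s ^ 3 * thirdDeriv f t x l := by
  have h : (![s • l, s • l, s • l] : Fin 3 → EuclideanSpace ℝ (Fin n))
      = fun i => (fun _ : Fin 3 => s) i • (![l, l, l] : Fin 3 → _) i := by
    ext i
    fin_cases i <;> simp
  rw [thirdDeriv, thirdDeriv, h, ContinuousMultilinearMap.map_smul_univ]
  simp

/-- The fold structure of the gradient field at a transversal degenerate critical point. -/
lemma exists_isFold_gradient
    (hf : ContDiffOn ℝ 3 (Function.uncurry f) (Icc 0 T ×ˢ univ)) {τ : ℝ} (hτ : τ ∈ Icc 0 T)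
    {ξ : EuclideanSpace ℝ (Fin n)} (hξ : gradient (f τ) ξ = 0)
    (hpsd : PosSemidefForm (fderiv ℝ (gradient (f τ)) ξ))
    (htr : ∃ ℓ, ℓ ≠ 0 ∧ LinearMap.ker (fderiv ℝ (gradient (f τ)) ξ :
        EuclideanSpace ℝ (Fin n) →ₗ[ℝ] EuclideanSpace ℝ (Fin n)) = Submodule.span ℝ {ℓ} ∧
      ⟪gradft f τ ξ, ℓ⟫ ≠ 0 ∧ thirdDeriv f τ ξ ℓ ≠ 0) :
    ∃ l r κ c m C, IsFold (fun x => gradient (f τ) (ξ + x)) l r κ c m C ∧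
      LinearMap.ker (fderiv ℝ (gradient (f τ)) ξ :
        EuclideanSpace ℝ (Fin n) →ₗ[ℝ] EuclideanSpace ℝ (Fin n)) = Submodule.span ℝ {l} ∧
      ⟪gradft f τ ξ, l⟫ ≠ 0 ∧ thirdDeriv f τ ξ l < 0 := by
  obtain ⟨ℓ, hℓ, hker, ha, hb⟩ := htr
  have hfτ : ContDiff ℝ 3 (f τ) := contDiff_slice hf hτ
  have hG : ContDiff ℝ 2 (gradient (f τ)) := contDiff_gradient hfτ (by norm_num)
  have hG' : ContDiff ℝ 2 (fun x => gradient (f τ) (ξ + x)) := by fun_prop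
  obtain ⟨s, hs0, hs1, hs3⟩ : ∃ s : ℝ, s ≠ 0 ∧ |s| * ‖ℓ‖ = 1 ∧ s ^ 3 * thirdDeriv f τ ξ ℓ < 0 := by
    have hn : 0 < ‖ℓ‖ := norm_pos_iff.2 hℓ
    rcases hb.lt_or_gt with h | h
    · refine ⟨‖ℓ‖⁻¹, by positivity, ?_, mul_neg_of_pos_of_neg (by positivity) h⟩
      rw [abs_of_pos (by positivity), inv_mul_cancel₀ hn.ne']
    · refine ⟨-‖ℓ‖⁻¹, neg_ne_zero.2 (by positivity), ?_, ?_⟩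
      · rw [abs_neg, abs_of_pos (by positivity), inv_mul_cancel₀ hn.ne']
      · rw [Odd.neg_pow (by decide), neg_mul]
        have : 0 < ‖ℓ‖⁻¹ ^ 3 * thirdDeriv f τ ξ ℓ := by positivity
        linarith
  have hnorm : ‖s • ℓ‖ = 1 := by rw [norm_smul, Real.norm_eq_abs, hs1]
  have hker' : LinearMap.ker (fderiv ℝ (gradient (f τ)) ξ :
      EuclideanSpace ℝ (Fin n) →ₗ[ℝ] EuclideanSpace ℝ (Fin n)) = Submodule.span ℝ {s • ℓ} := by
    rw [hker, Submodule.span_singleton_smul_eq (IsUnit.mk0 s hs0)]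
  have hthird : thirdDeriv f τ ξ (s • ℓ) < 0 := by rwa [thirdDeriv_smul]
  have hfd : fderiv ℝ (fun x => gradient (f τ) (ξ + x)) 0 = fderiv ℝ (gradient (f τ)) ξ := by
    rw [fderiv_comp_add_left, add_zero]
  have hfd2 : fderiv ℝ (fderiv ℝ (fun y => ⟪gradient (f τ) (ξ + y), s • ℓ⟫)) 0
      = fderiv ℝ (fderiv ℝ (fun y => ⟪gradient (f τ) y, s • ℓ⟫)) ξ := by
    have h1 : fderiv ℝ (fun y => ⟪gradient (f τ) (ξ + y), s • ℓ⟫)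
        = fun y => fderiv ℝ (fun y => ⟪gradient (f τ) y, s • ℓ⟫) (ξ + y) := by
      funext y
      exact fderiv_comp_add_left (f := fun y => ⟪gradient (f τ) y, s • ℓ⟫) ξ
    rw [h1, fderiv_comp_add_left, add_zero]
  obtain ⟨r, κ, c, m, C, hfold⟩ := exists_isFold hG' (by simpa using hξ) (by rwa [hfd])
    (by rw [hfd]; exact fderiv_gradient_symm (hfτ.of_le (by norm_num)) ξ) hnorm (by rwa [hfd])
    (by rw [hfd2, ← iteratedFDeriv_three_eq hfτ]; exact hthird)
  refine ⟨s • ℓ, r, κ, c, m, C, hfold, hker', ?_, hthird⟩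
  rw [inner_smul_right]
  exact mul_ne_zero hs0 ha

/-- A branch of critical points which approaches a fold point from the past determines the sign
of the time derivative of the gradient in the kernel direction. -/
lemma IsFold.inner_gradft_nonpos (hT : 0 < T)
    (hf : ContDiffOn ℝ 3 (Function.uncurry f) (Icc 0 T ×ˢ univ)) {τ : ℝ} (hτ : τ ∈ Ioo 0 T)
    {ξ l : EuclideanSpace ℝ (Fin n)} {r κ c m C : ℝ}
    (h : IsFold (fun x => gradient (f τ) (ξ + x)) l r κ c m C)
    {u : ℝ → EuclideanSpace ℝ (Fin n)} (hu : ∀ᶠ t in 𝓝[<] τ, gradient (f t) (u t) = 0)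
    (hlim : Tendsto u (𝓝[<] τ) (𝓝 ξ)) : ⟪gradft f τ ξ, l⟫ ≤ 0 := by
  by_contra hcon
  set a := ⟪gradft f τ ξ, l⟫ with ha
  have hapos : 0 < a := not_le.1 hcon
  have hcd : ContDiffAt ℝ 2 (fun p : ℝ × EuclideanSpace ℝ (Fin n) => gradient (f p.1) p.2)
      (τ, ξ) := (contDiffOn_gradient_slice hT hf).contDiffAt
    (prod_mem_nhds (Icc_mem_nhds hτ.1 hτ.2) univ_mem)
  obtain ⟨L, hL⟩ : ∃ L, HasStrictFDerivAt
      (fun p : ℝ × EuclideanSpace ℝ (Fin n) => gradient (f p.1) p.2) L (τ, ξ) :=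
    ⟨_, hcd.hasStrictFDerivAt (by norm_num)⟩
  have hLa : ⟪L (1, 0), l⟫ = a := by
    have h1 : HasDerivAt (fun s : ℝ => (s, ξ)) ((1 : ℝ), (0 : EuclideanSpace ℝ (Fin n))) τ :=
      (hasDerivAt_id τ).prodMk (hasDerivAt_const τ ξ)
    have h2 := hL.hasFDerivAt.comp_hasDerivAt τ h1
    have h3 := h2.inner ℝ (hasDerivAt_const τ l)
    simp only [inner_zero_right, zero_add] at h3
    exact h3.unique (hasDerivAt_inner_gradient_time hf hτ ξ l)
  have hid : Tendsto (fun t : ℝ => t) (𝓝[<] τ) (𝓝 τ) := tendsto_id.mono_left nhdsWithin_le_nhds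
  have hpair : Tendsto (fun t => ((τ, u t), (t, u t))) (𝓝[<] τ) (𝓝 ((τ, ξ), (τ, ξ))) :=
    (tendsto_const_nhds.prodMk_nhds hlim).prodMk_nhds (hid.prodMk_nhds hlim)
  have hlo := hpair.eventually (hL.isLittleO.def (half_pos hapos))
  set B := ‖L (1, 0)‖ + a / 2 with hB
  have hwlim : Tendsto (fun t => ‖u t - ξ‖) (𝓝[<] τ) (𝓝 0) :=
    (tendsto_iff_norm_sub_tendsto_zero.1 hlim)
  have hsmall : Tendsto (fun t => |C| * ‖u t - ξ‖ * (B / m)) (𝓝[<] τ) (𝓝 0) := by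
    simpa using (hwlim.const_mul |C|).mul_const (B / m)
  obtain ⟨t, htlo, htr, hts, hcrit, htτ⟩ := (hlo.and ((hwlim.eventually_le_const h.r_pos).and
    ((hsmall.eventually_lt_const (half_pos hapos)).and (hu.and self_mem_nhdsWithin)))).exists
  have htτ' : 0 < τ - t := sub_pos.2 htτ
  simp only [hcrit, sub_zero, Prod.mk_sub_mk, sub_self] at htlo
  have hLt : L (τ - t, 0) = (τ - t) • L (1, 0) := by
    rw [← map_smul]; simp
  have hnorm : ‖((τ - t, 0) : ℝ × EuclideanSpace ℝ (Fin n))‖ = τ - t := by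
    simp [Prod.norm_def, abs_of_pos htτ', htτ'.le]
  rw [hLt, hnorm] at htlo
  set w := u t - ξ with hw
  have huw : u t = ξ + w := by rw [hw]; abel
  rw [huw] at htlo
  have hFn : ‖gradient (f τ) (ξ + w)‖ ≤ B * (τ - t) := by
    have h1 := norm_sub_norm_le (gradient (f τ) (ξ + w)) ((τ - t) • L (1, 0))
    rw [norm_smul, Real.norm_of_nonneg htτ'.le] at h1
    rw [hB]
    linarith
  have hFl : a / 2 * (τ - t) ≤ ⟪gradient (f τ) (ξ + w), l⟫ := by
    have h1 := neg_le_of_abs_le (abs_real_inner_le_norm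
      (gradient (f τ) (ξ + w) - (τ - t) • L (1, 0)) l)
    rw [h.norm_l, mul_one, inner_sub_left, real_inner_smul_left, hLa] at h1
    linarith
  have hpos : 0 < a / 2 * (τ - t) := by positivity
  by_cases hcone : ‖perp l w‖ ≤ κ * |⟪w, l⟫|
  · have h1 := h.drift w htr hcone
    have h2 : 0 ≤ c * ⟪w, l⟫ ^ 2 := mul_nonneg h.c_pos.le (sq_nonneg _)
    linarith
  · have h1 := (h.coercive w htr (not_le.1 hcone)).trans hFn
    have h2 := (le_abs_self _).trans (h.quadratic w htr)
    have h3 : ‖w‖ ≤ B / m * (τ - t) := by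
      rw [div_mul_eq_mul_div, le_div_iff₀ h.m_pos]
      linarith
    have h4 : C * ‖w‖ ^ 2 ≤ |C| * ‖w‖ * (B / m) * (τ - t) := by
      calc C * ‖w‖ ^ 2 ≤ |C| * ‖w‖ ^ 2 := by gcongr; exact le_abs_self C
        _ = |C| * ‖w‖ * ‖w‖ := by ring
        _ ≤ |C| * ‖w‖ * (B / m * (τ - t)) := by gcongr
        _ = _ := by ring
    have h5 : |C| * ‖w‖ * (B / m) * (τ - t) < a / 2 * (τ - t) := by gcongr
    linarith

/-- The sign condition does not depend on the choice of the kernel vector. -/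
lemma mul_pos_of_span_eq {τ : ℝ} {ξ l ℓ : EuclideanSpace ℝ (Fin n)}
    (ha : ⟪gradft f τ ξ, l⟫ < 0) (hb : thirdDeriv f τ ξ l < 0) (hℓ : ℓ ≠ 0)
    (hspan : Submodule.span ℝ {l} = Submodule.span ℝ {ℓ}) :
    0 < ⟪gradft f τ ξ, ℓ⟫ * thirdDeriv f τ ξ ℓ := by
  have hmem : ℓ ∈ Submodule.span ℝ {l} := hspan ▸ Submodule.mem_span_singleton_self ℓ
  obtain ⟨s, rfl⟩ := Submodule.mem_span_singleton.1 hmem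
  have hs : s ≠ 0 := fun h => hℓ (by rw [h, zero_smul])
  rw [inner_smul_right, thirdDeriv_smul]
  have h1 : 0 < s ^ 4 := by positivity
  have h2 := mul_pos h1 (mul_pos_of_neg_of_neg ha hb)
  linarith

end FoldSign

section Assembly

variable {n : ℕ} {T a₀ c₀ : ℝ} {f : ℝ → EuclideanSpace ℝ (Fin n) → ℝ}

/-- The standing assumptions: regularity, coercivity, transversality, isolation of degenerate
critical times and convergence of heteroclinics. -/
structure SlowFastHyp (T a₀ c₀ : ℝ) (f : ℝ → EuclideanSpace ℝ (Fin n) → ℝ) : Prop where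
  T_pos : 0 < T
  smooth : ContDiffOn ℝ 3 (Function.uncurry f) (Icc 0 T ×ˢ univ)
  c_pos : 0 < c₀
  coercive : ∀ t ∈ Icc 0 T, ∀ x, ⟪gradient (f t) x, x⟫ ≥ c₀ * ‖x‖ ^ 2 - a₀
  transverse : ∀ p ∈ degenerateCriticalSet T f, HessPosSemidef f p.1 p.2 →
    ∃ ℓ, ℓ ≠ 0 ∧ LinearMap.ker (fderiv ℝ (gradient (f p.1)) p.2 :
        EuclideanSpace ℝ (Fin n) →ₗ[ℝ] EuclideanSpace ℝ (Fin n)) = Submodule.span ℝ {ℓ} ∧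
      ⟪gradft f p.1 p.2, ℓ⟫ ≠ 0 ∧ thirdDeriv f p.1 p.2 ℓ ≠ 0
  finite : (degenerateCriticalSet T f).Finite
  inj : ∀ p ∈ degenerateCriticalSet T f, ∀ q ∈ degenerateCriticalSet T f, p.1 = q.1 → p = q
  ends : ∀ p ∈ degenerateCriticalSet T f, p.1 ≠ 0 ∧ p.1 ≠ T
  connect : ∀ p ∈ degenerateCriticalSet T f, HessPosSemidef f p.1 p.2 →
    ∀ w, IsDescent (gradient (f p.1)) w → Tendsto w atBot (𝓝 p.2) → (∃ s₁ s₂, w s₁ ≠ w s₂) →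
      ∃ x, Tendsto w atTop (𝓝 x) ∧ HessPosDef f p.1 x

/-- The slow branch `u` jumps at time `τ` along the heteroclinic `v`, which ends at `y`. -/
def IsJump (T : ℝ) (f : ℝ → EuclideanSpace ℝ (Fin n) → ℝ) (τ : ℝ)
    (u v : ℝ → EuclideanSpace ℝ (Fin n)) (y : EuclideanSpace ℝ (Fin n)) : Prop :=
  (∃ x, Tendsto u (𝓝[<] τ) (𝓝 x) ∧ (τ, x) ∈ degenerateCriticalSet T f ∧ HessPosSemidef f τ x ∧
    (∀ ℓ, ℓ ≠ 0 → LinearMap.ker (fderiv ℝ (gradient (f τ)) x :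
        EuclideanSpace ℝ (Fin n) →ₗ[ℝ] EuclideanSpace ℝ (Fin n)) = Submodule.span ℝ {ℓ} →
      0 < ⟪gradft f τ x, ℓ⟫ * thirdDeriv f τ x ℓ) ∧ Tendsto v atBot (𝓝 x)) ∧
  ContDiff ℝ 2 v ∧ (∃ s₁ s₂, v s₁ ≠ v s₂) ∧ IsDescent (gradient (f τ)) v ∧
  Tendsto v atTop (𝓝 y)

/-- A slow/fast family started at time `a` from the point `y`, with `k + 1` slow branches. -/
structure SlowFastFrom (T : ℝ) (f : ℝ → EuclideanSpace ℝ (Fin n) → ℝ) (a : ℝ)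
    (y : EuclideanSpace ℝ (Fin n)) (k : ℕ) (t : ℕ → ℝ)
    (u v : ℕ → ℝ → EuclideanSpace ℝ (Fin n)) : Prop where
  first : t 0 = a
  last : t (k + 1) = T
  lt : ∀ i ≤ k, t i < t (i + 1)
  start : u 0 a = y
  smooth : ∀ i ≤ k, ContDiffOn ℝ 2 (u i) (Ico (t i) (t (i + 1)))
  branch : ∀ i ≤ k, ∀ s ∈ Ico (t i) (t (i + 1)),
    gradient (f s) (u i s) = 0 ∧ HessPosDef f s (u i s)
  limit : ∃ x, Tendsto (u k) (𝓝[<] T) (𝓝 x)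
  jump : ∀ i < k, IsJump T f (t (i + 1)) (u i) (v i) (u (i + 1) (t (i + 1)))

lemma slowFastFamily_iff {y : EuclideanSpace ℝ (Fin n)} {k : ℕ} {t : ℕ → ℝ}
    {u v : ℕ → ℝ → EuclideanSpace ℝ (Fin n)} :
    SlowFastFamily T f y (k + 1) t u v ↔
      SlowFastFrom T f 0 y k t (fun i => u (i + 1)) (fun i => v (i + 1)) := by
  constructor
  · rintro ⟨-, h0, hT, hlt, hy, hu, hx, hv⟩
    refine ⟨h0, hT, fun i hi => hlt i (by omega), hy,
      fun i hi => (hu (i + 1) (by omega) (by omega)).1,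
      fun i hi => (hu (i + 1) (by omega) (by omega)).2, ?_, fun i hi => ?_⟩
    · obtain ⟨x, hx, -⟩ := hx (k + 1) (by omega) le_rfl
      exact ⟨x, hT ▸ hx⟩
    · obtain ⟨x, hx1, hx2⟩ := hx (i + 1) (by omega) (by omega)
      exact ⟨⟨x, hx1, hx2 (by omega)⟩, hv (i + 1) (by omega) (by omega)⟩
  · intro h
    refine ⟨by omega, h.first, h.last, fun i hi => h.lt i (by omega), h.start, ?_, ?_, ?_⟩
    · rintro (_ | i) h1 hi
      · omega
      · exact ⟨h.smooth i (by omega), h.branch i (by omega)⟩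
    · rintro (_ | i) h1 hi
      · omega
      · rcases (show i ≤ k by omega).lt_or_eq with hik | rfl
        · obtain ⟨⟨x, hx1, hx2⟩, -⟩ := h.jump i hik
          exact ⟨x, hx1, fun _ => hx2⟩
        · obtain ⟨x, hx⟩ := h.limit
          exact ⟨x, h.last.symm ▸ hx, fun hi' => by omega⟩
    · rintro (_ | i) h1 hi
      · omega
      · exact (h.jump i (by omega)).2

lemma SlowFastFrom.tail {a : ℝ} {y : EuclideanSpace ℝ (Fin n)} {k : ℕ} {t : ℕ → ℝ}
    {u v : ℕ → ℝ → EuclideanSpace ℝ (Fin n)} (h : SlowFastFrom T f a y (k + 1) t u v) :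
    SlowFastFrom T f (t 1) (u 1 (t 1)) k (fun i => t (i + 1)) (fun i => u (i + 1))
      (fun i => v (i + 1)) where
  first := rfl
  last := h.last
  lt i hi := h.lt (i + 1) (by omega)
  start := rfl
  smooth i hi := h.smooth (i + 1) (by omega)
  branch i hi := h.branch (i + 1) (by omega)
  limit := h.limit
  jump i hi := h.jump (i + 1) (by omega)

lemma SlowFastFrom.cons {a τ : ℝ} {y y' : EuclideanSpace ℝ (Fin n)} {k : ℕ} {t : ℕ → ℝ}
    {u v : ℕ → ℝ → EuclideanSpace ℝ (Fin n)} {U V : ℝ → EuclideanSpace ℝ (Fin n)}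
    (h : SlowFastFrom T f τ y' k t u v) (haτ : a < τ) (hUa : U a = y)
    (hU : ContDiffOn ℝ 2 U (Ico a τ))
    (hbr : ∀ s ∈ Ico a τ, gradient (f s) (U s) = 0 ∧ HessPosDef f s (U s))
    (hJ : IsJump T f τ U V y') :
    SlowFastFrom T f a y (k + 1) (fun i => Nat.casesOn i a t) (fun i => Nat.casesOn i U u)
      (fun i => Nat.casesOn i V v) where
  first := rfl
  last := h.last
  lt
    | 0, _ => by simpa [h.first] using haτ
    | i + 1, hi => h.lt i (by omega)
  start := hUa
  smooth
    | 0, _ => by simpa [h.first] using hU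
    | i + 1, hi => h.smooth i (by omega)
  branch
    | 0, _ => by simpa [h.first] using hbr
    | i + 1, hi => h.branch i (by omega)
  limit := h.limit
  jump
    | 0, _ => by simpa [h.first, h.start] using hJ
    | i + 1, hi => h.jump i (by omega)

lemma SlowFastFrom.isBranch {a : ℝ} {y : EuclideanSpace ℝ (Fin n)} {k : ℕ} {t : ℕ → ℝ}
    {u v : ℕ → ℝ → EuclideanSpace ℝ (Fin n)} (h : SlowFastFrom T f a y k t u v) :
    IsBranch (fun t => gradient (f t)) (u 0) (Ico a (t 1)) := by
  have h1 := h.smooth 0 (by omega)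
  have h2 := h.branch 0 (by omega)
  rw [h.first] at h1 h2
  exact ⟨h1.continuousOn, h2⟩

/-- A heteroclinic emitted by a fold point is unique up to time-translation. -/
lemma IsFold.eq_comp_add_of_tendsto {E : Type*} [NormedAddCommGroup E] [InnerProductSpace ℝ E]
    [FiniteDimensional ℝ E] {G : E → E} {ξ l : E} {r κ c m C : ℝ}
    (h : IsFold (fun x => G (ξ + x)) l r κ c m C) (hG : ContDiff ℝ 1 G) (hξ : G ξ = 0)
    {w₁ w₂ : ℝ → E} (hw₁ : IsDescent G w₁) (hw₂ : IsDescent G w₂)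
    (hlim₁ : Tendsto w₁ atBot (𝓝 ξ)) (hlim₂ : Tendsto w₂ atBot (𝓝 ξ))
    (hne₁ : ∃ s₁ s₂, w₁ s₁ ≠ w₁ s₂) (hne₂ : ∃ s₁ s₂, w₂ s₁ ≠ w₂ s₂) :
    ∃ τ, ∀ s, w₁ s = w₂ (s + τ) := by
  have hd : ∀ {w : ℝ → E}, IsDescent G w → IsDescent (fun x => G (ξ + x)) (fun s => w s - ξ) :=
    fun hw s => by simpa using (hw s).sub_const ξ
  have ht : ∀ {w : ℝ → E}, Tendsto w atBot (𝓝 ξ) → Tendsto (fun s => w s - ξ) atBot (𝓝 0) :=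
    fun hw => by simpa using hw.sub_const ξ
  have hn : ∀ {w : ℝ → E}, (∃ s₁ s₂, w s₁ ≠ w s₂) → ∃ s₁ s₂, w s₁ - ξ ≠ w s₂ - ξ :=
    fun ⟨s₁, s₂, h12⟩ => ⟨s₁, s₂, fun heq => h12 (sub_left_injective heq)⟩
  obtain ⟨τ, hτ⟩ := h.eq_comp_add (by fun_prop) (by simpa using hξ) (hd hw₁) (hd hw₂) (ht hlim₁)
    (ht hlim₂) (hn hne₁) (hn hne₂)
  exact ⟨τ, fun s => sub_left_injective (hτ s)⟩

/-- A maximal branch determines the end point of any other branch with the same initial value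
which ends at time `T` or at a degenerate point. -/
lemma IsBranch.end_eq (hT : 0 < T)
    (hf : ContDiffOn ℝ 3 (Function.uncurry f) (Icc 0 T ×ˢ univ)) {a τ b : ℝ} (ha : 0 ≤ a)
    (haτ : a < τ) (hτ : τ ≤ T) (hab : a < b) (hb : b ≤ T)
    {U u : ℝ → EuclideanSpace ℝ (Fin n)} {x : EuclideanSpace ℝ (Fin n)}
    (hU : IsBranch (fun t => gradient (f t)) U (Ico a τ))
    (hu : IsBranch (fun t => gradient (f t)) u (Ico a b)) (heq : u a = U a)
    (hUx : Tendsto U (𝓝[<] τ) (𝓝 x)) (hx : τ < T → ¬ PosDefForm (fderiv ℝ (gradient (f τ)) x))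
    (hux : b < T → ∃ x', Tendsto u (𝓝[<] b) (𝓝 x') ∧
      ¬ PosDefForm (fderiv ℝ (gradient (f b)) x')) : b = τ := by
  have key : ∀ {σ ρ : ℝ} {w z : ℝ → EuclideanSpace ℝ (Fin n)} {x : EuclideanSpace ℝ (Fin n)},
      a < σ → σ < ρ → ρ ≤ T → IsBranch (fun t => gradient (f t)) w (Ico a σ) →
      IsBranch (fun t => gradient (f t)) z (Ico a ρ) → w a = z a → Tendsto w (𝓝[<] σ) (𝓝 x) →
      PosDefForm (fderiv ℝ (gradient (f σ)) x) := by
    intro σ ρ w z x h1 h2 h3 hw hz hwz hlim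
    have hsub : Ico a σ ⊆ Icc 0 T := fun s hs => ⟨ha.trans hs.1, by linarith [hs.2]⟩
    have heqOn := hw.eqOn hT hf hsub (hz.mono (Ico_subset_Ico_right h2.le)) hwz
    have hσ : σ ∈ Ico a ρ := ⟨h1.le, h2⟩
    have hzlim : Tendsto z (𝓝[<] σ) (𝓝 (z σ)) :=
      (hz.1 σ hσ).mono_left (nhdsWithin_le_of_mem (mem_of_superset (Ioo_mem_nhdsLT h1)
        fun s hs => ⟨hs.1.le, hs.2.trans h2⟩))
    have hwlim : Tendsto w (𝓝[<] σ) (𝓝 (z σ)) := hzlim.congr' (by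
      filter_upwards [Ioo_mem_nhdsLT h1] with s hs using (heqOn ⟨hs.1.le, hs.2⟩).symm)
    rw [tendsto_nhds_unique hlim hwlim]
    exact (hz.2 σ hσ).2
  rcases lt_trichotomy b τ with h | h | h
  · obtain ⟨x', hx', hnot⟩ := hux (h.trans_le hτ)
    exact absurd (key hab h hτ hu hU heq hx') hnot
  · exact h
  · exact absurd (key haτ h hb hU hu heq.symm hUx) (hx (h.trans_le hb))

end Assembly

section Main

variable {n : ℕ} {T a₀ c₀ : ℝ} {f : ℝ → EuclideanSpace ℝ (Fin n) → ℝ}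

/-- A slow/fast family which is unique up to time-translation of its heteroclinics. -/
def IsUniqueSlowFastFrom (T : ℝ) (f : ℝ → EuclideanSpace ℝ (Fin n) → ℝ) (a : ℝ)
    (y : EuclideanSpace ℝ (Fin n)) (k : ℕ) (t : ℕ → ℝ)
    (u v : ℕ → ℝ → EuclideanSpace ℝ (Fin n)) : Prop :=
  SlowFastFrom T f a y k t u v ∧ ∀ k' t' u' v', SlowFastFrom T f a y k' t' u' v' →
    k' = k ∧ (∀ i ≤ k + 1, t' i = t i) ∧
    (∀ i ≤ k, EqOn (u' i) (u i) (Ico (t i) (t (i + 1)))) ∧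
    ∀ i < k, ∃ c, ∀ s, v' i s = v i (s + c)

lemma SlowFastHyp.mem_degenerate (h : SlowFastHyp T a₀ c₀ f) {t : ℝ}
    {x : EuclideanSpace ℝ (Fin n)} (ht : t ∈ Icc 0 T) (hx : gradient (f t) x = 0)
    (hpsd : PosSemidefForm (fderiv ℝ (gradient (f t)) x))
    (hpd : ¬ PosDefForm (fderiv ℝ (gradient (f t)) x)) : (t, x) ∈ degenerateCriticalSet T f := by
  have h3 : ContDiff ℝ 3 (f t) := contDiff_slice h.smooth ht
  refine ⟨ht, hx, by_contra fun hdet => hpd ?_⟩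
  exact hpsd.posDefForm_of_det_ne_zero (fderiv_gradient_symm (h3.of_le (by norm_num)) x) hdet

lemma SlowFastHyp.critical_norm_sq_le (h : SlowFastHyp T a₀ c₀ f) {t : ℝ} (ht : t ∈ Icc 0 T)
    {x : EuclideanSpace ℝ (Fin n)} (hx : gradient (f t) x = 0) : ‖x‖ ^ 2 ≤ a₀ / c₀ := by
  have := h.coercive t ht x
  rw [hx, inner_zero_left] at this
  rw [le_div_iff₀ h.c_pos]
  linarith

lemma SlowFastHyp.exists_maximal_branch (h : SlowFastHyp T a₀ c₀ f) {a : ℝ} (ha : a ∈ Ico 0 T)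
    {y : EuclideanSpace ℝ (Fin n)} (hy : gradient (f a) y = 0) (hpd : HessPosDef f a y) :
    ∃ τ ∈ Ioc a T, ∃ u x, IsBranch (fun t => gradient (f t)) u (Ico a τ) ∧ u a = y ∧
      Tendsto u (𝓝[<] τ) (𝓝 x) ∧ gradient (f τ) x = 0 ∧ HessPosSemidef f τ x ∧
      (τ < T → ¬ HessPosDef f τ x) := by
  refine _root_.exists_maximal_branch h.T_pos h.smooth
    (isCompact_closedBall (0 : EuclideanSpace ℝ (Fin n)) (√(a₀ / c₀))) ?_ ?_ ha hy hpd
  · intro t ht x hx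
    rw [mem_closedBall_zero_iff]
    exact Real.le_sqrt_of_sq_le (h.critical_norm_sq_le ht hx)
  · intro b hb x x' hx hx' h1 h2 h3 h4
    exact congrArg Prod.snd (h.inj (b, x) (h.mem_degenerate hb hx h1 h3) (b, x')
      (h.mem_degenerate hb hx' h2 h4) rfl)

/-- The first jump time of any slow/fast family is the end point of the maximal branch. -/
lemma SlowFastFrom.time_one_eq (h : SlowFastHyp T a₀ c₀ f) {a τ : ℝ} (ha : 0 ≤ a) (haτ : a < τ)
    (hτ : τ ≤ T) {y x : EuclideanSpace ℝ (Fin n)} {U : ℝ → EuclideanSpace ℝ (Fin n)}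
    (hU : IsBranch (fun t => gradient (f t)) U (Ico a τ)) (hUa : U a = y)
    (hUx : Tendsto U (𝓝[<] τ) (𝓝 x)) (hx : τ < T → ¬ HessPosDef f τ x) {k : ℕ} {t : ℕ → ℝ}
    {u v : ℕ → ℝ → EuclideanSpace ℝ (Fin n)} (hs : SlowFastFrom T f a y k t u v) :
    t 1 = τ ∧ EqOn (u 0) U (Ico a τ) := by
  have key : t 1 ≤ T ∧ (t 1 < T → ∃ x', Tendsto (u 0) (𝓝[<] t 1) (𝓝 x') ∧
      ¬ PosDefForm (fderiv ℝ (gradient (f (t 1))) x')) := by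
    cases k with
    | zero => exact ⟨hs.last.le, fun hlt => absurd hs.last hlt.ne⟩
    | succ k =>
      obtain ⟨⟨x', hx', hmem, -⟩, -⟩ := hs.jump 0 k.succ_pos
      exact ⟨hmem.1.2, fun _ => ⟨x', hx', fun hpd => hpd.det_ne_zero hmem.2.2⟩⟩
  have hab : a < t 1 := by simpa [hs.first] using hs.lt 0 (Nat.zero_le _)
  have heq : u 0 a = U a := hs.start.trans hUa.symm
  have h1 : t 1 = τ := IsBranch.end_eq h.T_pos h.smooth ha haτ hτ hab key.1 hU hs.isBranch heq
    hUx hx key.2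
  refine ⟨h1, IsBranch.eqOn h.T_pos h.smooth (fun s hs => ⟨ha.trans hs.1, ?_⟩)
    (h1 ▸ hs.isBranch) hU heq⟩
  exact hs.2.le.trans hτ

/-- If the maximal branch exists until time `T`, then it is the whole slow/fast family. -/
lemma SlowFastHyp.isUniqueSlowFastFrom_zero (h : SlowFastHyp T a₀ c₀ f) {a : ℝ}
    (ha : a ∈ Ico 0 T) {y x : EuclideanSpace ℝ (Fin n)} {U : ℝ → EuclideanSpace ℝ (Fin n)}
    (hU : IsBranch (fun t => gradient (f t)) U (Ico a T)) (hUa : U a = y)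
    (hUx : Tendsto U (𝓝[<] T) (𝓝 x)) :
    IsUniqueSlowFastFrom T f a y 0 (fun i => Nat.casesOn i a fun _ => T) (fun _ => U)
      (fun _ => U) := by
  have hsub : Ico a T ⊆ Icc 0 T := fun s hs => ⟨ha.1.trans hs.1, hs.2.le⟩
  refine ⟨⟨rfl, rfl, ?_, hUa, ?_, ?_, ⟨x, hUx⟩, fun i hi => absurd hi (Nat.not_lt_zero i)⟩, ?_⟩
  · intro i hi
    obtain rfl := Nat.le_zero.1 hi
    exact ha.2
  · intro i hi
    obtain rfl := Nat.le_zero.1 hi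
    exact hU.contDiffOn h.T_pos (contDiffOn_gradient_slice h.T_pos h.smooth) hsub
  · intro i hi
    obtain rfl := Nat.le_zero.1 hi
    exact hU.2
  · intro k' t' u' v' hs
    obtain ⟨h1, h2⟩ := SlowFastFrom.time_one_eq h ha.1 ha.2 le_rfl hU hUa hUx
      (fun hlt => absurd hlt (lt_irrefl T)) hs
    cases k' with
    | zero =>
      refine ⟨rfl, ?_, ?_, fun i hi => absurd hi (Nat.not_lt_zero i)⟩
      · rintro (_ | _ | i) hi
        · exact hs.first
        · exact h1
        · omega
      · intro i hi
        obtain rfl := Nat.le_zero.1 hi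
        exact h2
    | succ k' =>
      obtain ⟨⟨x', -, hmem, -⟩, -⟩ := hs.jump 0 k'.succ_pos
      exact absurd h1 (h.ends _ hmem).2

/-- A unique slow/fast family started at the landing point of a jump extends backwards along the
slow branch which precedes the jump. -/
lemma SlowFastHyp.isUniqueSlowFastFrom_cons (h : SlowFastHyp T a₀ c₀ f) {a τ : ℝ} (ha : 0 ≤ a)
    (haτ : a < τ) (hτ : τ < T) {y x y' : EuclideanSpace ℝ (Fin n)}
    {U V : ℝ → EuclideanSpace ℝ (Fin n)}
    (hU : IsBranch (fun t => gradient (f t)) U (Ico a τ)) (hUa : U a = y)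
    (hUx : Tendsto U (𝓝[<] τ) (𝓝 x)) (hx : ¬ HessPosDef f τ x) (hJ : IsJump T f τ U V y')
    (hV : ∀ w, IsDescent (gradient (f τ)) w → Tendsto w atBot (𝓝 x) → (∃ s₁ s₂, w s₁ ≠ w s₂) →
      ∃ c, ∀ s, w s = V (s + c))
    {k : ℕ} {t : ℕ → ℝ} {u v : ℕ → ℝ → EuclideanSpace ℝ (Fin n)}
    (hs : IsUniqueSlowFastFrom T f τ y' k t u v) :
    IsUniqueSlowFastFrom T f a y (k + 1) (fun i => Nat.casesOn i a t)
      (fun i => Nat.casesOn i U u) (fun i => Nat.casesOn i V v) := by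
  have hsub : Ico a τ ⊆ Icc 0 T := fun s hs => ⟨ha.trans hs.1, (hs.2.trans hτ).le⟩
  refine ⟨hs.1.cons haτ hUa (hU.contDiffOn h.T_pos
    (contDiffOn_gradient_slice h.T_pos h.smooth) hsub) hU.2 hJ, ?_⟩
  intro k' t' u' v' hs'
  obtain ⟨h1, h2⟩ := SlowFastFrom.time_one_eq h ha haτ hτ.le hU hUa hUx (fun _ => hx) hs'
  cases k' with
  | zero => exact absurd (h1.symm.trans hs'.last) hτ.ne
  | succ k' =>
    obtain ⟨⟨x', hx', -, -, -, hbot⟩, -, hne, hdesc, htop⟩ := hs'.jump 0 k'.succ_pos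
    have hu1 := hs'.tail
    simp only [Nat.reduceAdd, h1] at hx' hdesc htop hu1
    have hxx : x' = x := tendsto_nhds_unique hx' (hUx.congr' (by
      filter_upwards [Ioo_mem_nhdsLT haτ] with s hs using (h2 ⟨hs.1.le, hs.2⟩).symm))
    obtain ⟨c, hc⟩ := hV (v' 0) hdesc (hxx ▸ hbot) hne
    have hlim : Tendsto (v' 0) atTop (𝓝 y') := by
      rw [funext hc]
      exact hJ.2.2.2.2.comp (tendsto_atTop_add_const_right _ c tendsto_id)
    rw [tendsto_nhds_unique htop hlim] at hu1
    obtain ⟨hk, ht, hu, hv⟩ := hs.2 _ _ _ _ hu1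
    refine ⟨by rw [hk], ?_, ?_, ?_⟩
    · rintro (_ | i) hi
      · exact hs'.first
      · exact ht i (by omega)
    · rintro (_ | i) hi
      · simpa [hs.1.first] using h2
      · exact hu i (by omega)
    · rintro (_ | i) hi
      · exact ⟨c, hc⟩
      · exact hv i (by omega)

/-- A branch which reaches a degenerate point jumps along a unique heteroclinic. -/
lemma SlowFastHyp.exists_isJump (h : SlowFastHyp T a₀ c₀ f) {a τ : ℝ} (ha : 0 ≤ a)
    (haτ : a < τ) (hτ : τ < T) {x : EuclideanSpace ℝ (Fin n)}
    {U : ℝ → EuclideanSpace ℝ (Fin n)}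
    (hU : IsBranch (fun t => gradient (f t)) U (Ico a τ))
    (hUx : Tendsto U (𝓝[<] τ) (𝓝 x)) (hmem : (τ, x) ∈ degenerateCriticalSet T f)
    (hpsd : HessPosSemidef f τ x) :
    ∃ V y', IsJump T f τ U V y' ∧ gradient (f τ) y' = 0 ∧ HessPosDef f τ y' ∧
      ∀ w, IsDescent (gradient (f τ)) w → Tendsto w atBot (𝓝 x) → (∃ s₁ s₂, w s₁ ≠ w s₂) →
        ∃ c, ∀ s, w s = V (s + c) := by
  have hτI : τ ∈ Icc 0 T := hmem.1
  have h3 : ContDiff ℝ 3 (f τ) := contDiff_slice h.smooth hτI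
  have hG : ContDiff ℝ 1 (gradient (f τ)) := contDiff_gradient h3 (by norm_num)
  obtain ⟨l, r, κ, c, m, C, hfold, hker, hne, hneg⟩ :=
    exists_isFold_gradient h.smooth hτI hmem.2.1 hpsd (h.transverse _ hmem hpsd)
  have hsign : ⟪gradft f τ x, l⟫ < 0 := by
    refine lt_of_le_of_ne (hfold.inner_gradft_nonpos h.T_pos h.smooth ⟨ha.trans_lt haτ, hτ⟩ ?_
      hUx) hne
    filter_upwards [Ioo_mem_nhdsLT haτ] with s hs using (hU.2 s ⟨hs.1.le, hs.2⟩).1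
  obtain ⟨V, hV, hbot, hVne⟩ := exists_heteroclinic hG hmem.2.1 hfold (M := a₀ / c₀) (by
    intro z hz
    have := h.coercive τ hτI z
    rw [div_lt_iff₀ h.c_pos] at hz
    linarith)
  obtain ⟨y', hy', hpd⟩ := h.connect _ hmem hpsd V hV hbot hVne
  refine ⟨V, y', ⟨⟨x, hUx, hmem, hpsd, fun ℓ hℓ hspan => ?_, hbot⟩, hV.contDiff hG, hVne, hV, hy'⟩,
    hV.map_limit_eq_zero hG.continuous hy', hpd, fun w hw hwb hwne => ?_⟩
  · exact mul_pos_of_span_eq hsign hneg hℓ (hker.symm.trans hspan)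
  · exact hfold.eq_comp_add_of_tendsto hG hmem.2.1 hw hV hwb hbot hwne hVne

/-- Existence and uniqueness of the slow/fast family started at a nondegenerate minimum. -/
theorem SlowFastHyp.exists_isUniqueSlowFastFrom (h : SlowFastHyp T a₀ c₀ f) {a : ℝ}
    (ha : a ∈ Ico 0 T) {y : EuclideanSpace ℝ (Fin n)} (hy : gradient (f a) y = 0)
    (hpd : HessPosDef f a y) : ∃ k t u v, IsUniqueSlowFastFrom T f a y k t u v := by
  obtain ⟨N, hN⟩ : ∃ N, {p ∈ degenerateCriticalSet T f | a < p.1}.ncard = N := ⟨_, rfl⟩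
  induction N using Nat.strong_induction_on generalizing a y with
  | _ N ih =>
    obtain ⟨τ, ⟨haτ, hτT⟩, U, x, hU, hUa, hUx, hx, hpsd, hnpd⟩ := h.exists_maximal_branch ha hy hpd
    rcases hτT.eq_or_lt with rfl | hτT
    · exact ⟨_, _, _, _, h.isUniqueSlowFastFrom_zero ha hU hUa hUx⟩
    · have hmem := h.mem_degenerate ⟨ha.1.trans haτ.le, hτT.le⟩ hx hpsd (hnpd hτT)
      obtain ⟨V, y', hJ, hy', hpd', hV⟩ := h.exists_isJump ha.1 haτ hτT hU hUx hmem hpsd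
      have hlt : {p ∈ degenerateCriticalSet T f | τ < p.1}.ncard < N := by
        rw [← hN]
        refine Set.ncard_lt_ncard ⟨fun p hp => ⟨hp.1, haτ.trans hp.2⟩, fun hsub => ?_⟩
          (h.finite.subset (sep_subset _ _))
        exact lt_irrefl τ (hsub ⟨hmem, haτ⟩ : (τ, x) ∈ {p ∈ _ | τ < p.1}).2
      obtain ⟨k, t, u, v, hs⟩ := ih _ hlt ⟨ha.1.trans haτ.le, hτT⟩ hy' hpd' rfl
      exact ⟨_, _, _, _, h.isUniqueSlowFastFrom_cons ha.1 haτ hτT hU hUa hUx (hnpd hτT) hJ hV hs⟩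

end Main

/-- under Assumptions 1–4 and for an initial nondegenerate local minimum
`y₀` of `f(0,·)`, a slow/fast family exists; the times and slow branches are unique and
the heteroclinics are unique up to time-translations. -/
theorem slow_fast_family_exists_unique
    {n : ℕ} (hn : 1 ≤ n) {T : ℝ} (hT : 0 < T)
    (f : ℝ → EuclideanSpace ℝ (Fin n) → ℝ)
    (hf : ContDiffOn ℝ 3 (Function.uncurry f)
      (Set.Icc 0 T ×ˢ (Set.univ : Set (EuclideanSpace ℝ (Fin n)))))
    {a₀ c₀ : ℝ} (ha₀ : 0 ≤ a₀) (hc₀ : 0 < c₀)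
    (hA1 : ∀ t ∈ Set.Icc (0:ℝ) T, ∀ x : EuclideanSpace ℝ (Fin n),
      ⟪gradient (f t) x, x⟫ ≥ c₀ * ‖x‖ ^ 2 - a₀)
    (hA2 : ∀ p ∈ degenerateCriticalSet T f, HessPosSemidef f p.1 p.2 →
      ∃ ℓ : EuclideanSpace ℝ (Fin n), ℓ ≠ 0 ∧
        LinearMap.ker ((fderiv ℝ (gradient (f p.1)) p.2 :
          EuclideanSpace ℝ (Fin n) →L[ℝ] EuclideanSpace ℝ (Fin n)) :
          EuclideanSpace ℝ (Fin n) →ₗ[ℝ] EuclideanSpace ℝ (Fin n)) = Submodule.span ℝ {ℓ} ∧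
        ⟪gradft f p.1 p.2, ℓ⟫ ≠ 0 ∧ thirdDeriv f p.1 p.2 ℓ ≠ 0)
    (hA3fin : (degenerateCriticalSet T f).Finite)
    (hA3inj : ∀ p ∈ degenerateCriticalSet T f, ∀ q ∈ degenerateCriticalSet T f,
      p.1 = q.1 → p = q)
    (hA3end : ∀ p ∈ degenerateCriticalSet T f, p.1 ≠ 0 ∧ p.1 ≠ T)
    (hA4 : ∀ p ∈ degenerateCriticalSet T f, HessPosSemidef f p.1 p.2 →
      ∀ w : ℝ → EuclideanSpace ℝ (Fin n),
        (∀ s : ℝ, HasDerivAt w (-(gradient (f p.1) (w s))) s) →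
        Tendsto w atBot (nhds p.2) → (∃ s₁ s₂ : ℝ, w s₁ ≠ w s₂) →
        ∃ wlim : EuclideanSpace ℝ (Fin n),
          Tendsto w atTop (nhds wlim) ∧ HessPosDef f p.1 wlim)
    (y₀ : EuclideanSpace ℝ (Fin n))
    (hy₀ : gradient (f 0) y₀ = 0) (hy₀pd : HessPosDef f 0 y₀) :
    ∃ k : ℕ, ∃ t : ℕ → ℝ, ∃ u v : ℕ → ℝ → EuclideanSpace ℝ (Fin n),
      SlowFastFamily T f y₀ k t u v ∧
      ∀ k' : ℕ, ∀ t' : ℕ → ℝ, ∀ u' v' : ℕ → ℝ → EuclideanSpace ℝ (Fin n),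
        SlowFastFamily T f y₀ k' t' u' v' →
        k' = k ∧
        (∀ i ≤ k, t' i = t i) ∧
        (∀ i, 1 ≤ i → i ≤ k → Set.EqOn (u' i) (u i) (Set.Ico (t (i - 1)) (t i))) ∧
        (∀ i, 1 ≤ i → i ≤ k - 1 → ∃ c : ℝ, ∀ s : ℝ, v' i s = v i (s + c)) := by
  obtain ⟨k, t, u, v, hs, huniq⟩ := SlowFastHyp.exists_isUniqueSlowFastFrom
    (⟨hT, hf, hc₀, hA1, hA2, hA3fin, hA3inj, hA3end, hA4⟩ : SlowFastHyp T a₀ c₀ f)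
    ⟨le_rfl, hT⟩ hy₀ hy₀pd
  refine ⟨k + 1, t, fun i => u (i - 1), fun i => v (i - 1), slowFastFamily_iff.2 hs, ?_⟩
  intro k' t' u' v' hs'
  obtain ⟨j, rfl⟩ := Nat.exists_eq_succ_of_ne_zero (Nat.one_le_iff_ne_zero.1 hs'.1)
  obtain ⟨rfl, ht, hu, hv⟩ := huniq _ _ _ _ (slowFastFamily_iff.1 hs')
  refine ⟨rfl, ht, ?_, ?_⟩
  · rintro (_ | i) h1 hi
    · omega
    · exact hu i (by omega)
  · rintro (_ | i) h1 hi
    · omega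
    · exact hv i (by omega)
end

section
/- Let A be a d×d real symmetric positive definite matrix and let h : (−∞,0] → ℝ^d be continuous with sup_{t≤0} (t−1)²|h(t)| < ∞. Then x(t) := ∫_{−∞}^t e^{−A(t−s)} h(s) ds is well-defined for every t ≤ 0, is a C¹ solution of ẋ(t) + A x(t) = h(t) on (−∞,0] with lim_{t→−∞} x(t) = 0, satisfies sup_{t≤0} (t−1)²|x(t)| < ∞, and is the unique solution of ẋ + Ax = h on (−∞,0] tending to 0 as t → −∞. -/
open Set Filter Topology MeasureTheory

namespace Matrix

variable {n : Type*} [Fintype n] [DecidableEq n]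

theorem toEuclideanLin_exp_apply (M : Matrix n n ℝ) (v : EuclideanSpace ℝ n) :
    toEuclideanLin (NormedSpace.exp M) v
      = NormedSpace.exp (toEuclideanCLM (n := n) (𝕜 := ℝ) M) v := by
  let _ := Matrix.linftyOpNormedRing (n := n) (α := ℝ)
  let _ := Matrix.linftyOpNormedAlgebra (n := n) (R := ℝ) (α := ℝ)
  let _ : NormedAlgebra ℚ (Matrix n n ℝ) := NormedAlgebra.restrictScalars ℚ ℝ (Matrix n n ℝ)
  have hc : Continuous (toEuclideanCLM (n := n) (𝕜 := ℝ)) :=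
    (toEuclideanCLM (n := n) (𝕜 := ℝ)).toAlgEquiv.toLinearMap.continuous_of_finiteDimensional
  rw [← NormedSpace.map_exp _ hc M]
  rfl

theorem PosDef.exists_pos_mul_norm_sq_le_inner {A : Matrix n n ℝ} (hA : A.PosDef) :
    ∃ c : ℝ, 0 < c ∧ ∀ v : EuclideanSpace ℝ n,
      c * ‖v‖ ^ 2 ≤ inner ℝ v (toEuclideanCLM (n := n) (𝕜 := ℝ) A v) := by
  set B := toEuclideanCLM (n := n) (𝕜 := ℝ) A with hB
  have hpos : ∀ v : EuclideanSpace ℝ n, v ≠ 0 → 0 < inner ℝ v (B v) := by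
    intro v hv
    rw [hB, inner_toEuclideanCLM]
    have := (posDef_iff_dotProduct_mulVec.mp hA).2 (x := v.ofLp) (by simpa using hv)
    simpa using this
  have hcont : Continuous fun v : EuclideanSpace ℝ n => inner ℝ v (B v) := by fun_prop
  rcases (Metric.sphere (0 : EuclideanSpace ℝ n) 1).eq_empty_or_nonempty with hS | hS
  · refine ⟨1, one_pos, fun v => ?_⟩
    rcases eq_or_ne v 0 with rfl | hv
    · simp
    · have : (‖v‖⁻¹ • v) ∈ Metric.sphere (0 : EuclideanSpace ℝ n) 1 := by
        simp [norm_smul, hv]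
      simp [hS] at this
  · obtain ⟨u, hu, hmin⟩ := (isCompact_sphere _ _).exists_isMinOn hS hcont.continuousOn
    have hu0 : u ≠ 0 := ne_zero_of_mem_unit_sphere ⟨u, hu⟩
    refine ⟨_, hpos u hu0, fun v => ?_⟩
    rcases eq_or_ne v 0 with rfl | hv
    · simp
    · have hv' : (‖v‖⁻¹ • v) ∈ Metric.sphere (0 : EuclideanSpace ℝ n) 1 := by
        simp [norm_smul, hv]
      have h := isMinOn_iff.mp hmin _ hv'
      rw [map_smul, real_inner_smul_left, real_inner_smul_right] at h
      have hn : 0 < ‖v‖ := norm_pos_iff.mpr hv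
      calc inner ℝ u (B u) * ‖v‖ ^ 2
          ≤ ‖v‖⁻¹ * (‖v‖⁻¹ * inner ℝ v (B v)) * ‖v‖ ^ 2 := by gcongr
        _ = inner ℝ v (B v) := by field_simp

end Matrix

namespace ContinuousLinearMap

variable {E : Type*} [NormedAddCommGroup E]

theorem exp_sub_smul_apply [NormedSpace ℝ E] [CompleteSpace E] (B : E →L[ℝ] E) (s t : ℝ) (v : E) :
    NormedSpace.exp ((s - t) • B) v
      = NormedSpace.exp ((-t) • B) (NormedSpace.exp (s • B) v) := by
  let _ : NormedAlgebra ℚ (E →L[ℝ] E) := NormedAlgebra.restrictScalars ℚ ℝ (E →L[ℝ] E)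
  have hcomm : Commute ((-t) • B) (s • B) :=
    ((Commute.refl B).smul_left _).smul_right _
  rw [← mul_apply_eq_comp, ← NormedSpace.exp_add_of_commute hcomm, ← add_smul]
  congr 3
  ring

theorem continuous_exp_smul [NormedSpace ℝ E] [CompleteSpace E] (B : E →L[ℝ] E) :
    Continuous fun r : ℝ => NormedSpace.exp (r • B) :=
  (differentiable_exp_smul_const ℝ B).continuous

variable [InnerProductSpace ℝ E] {B : E →L[ℝ] E} {c : ℝ} {h : ℝ → E}

theorem eqOn_of_hasDerivWithinAt_of_tendsto_atBot (hB : ∀ v, 0 ≤ inner ℝ v (B v)) {a : ℝ}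
    {x y : ℝ → E} (hx : ∀ t ≤ a, HasDerivWithinAt x (h t - B (x t)) (Iic a) t)
    (hy : ∀ t ≤ a, HasDerivWithinAt y (h t - B (y t)) (Iic a) t)
    (hx0 : Tendsto x atBot (𝓝 0)) (hy0 : Tendsto y atBot (𝓝 0)) : EqOn y x (Iic a) := by
  have hz : ∀ t ≤ a, HasDerivWithinAt (fun t => ‖y t - x t‖ ^ 2)
      (2 * inner ℝ (y t - x t) (-B (y t - x t))) (Iic a) t := fun t ht => by
    refine (((hy t ht).sub (hx t ht)).congr_deriv ?_).norm_sq
    rw [map_sub]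
    abel
  have hanti : AntitoneOn (fun t => ‖y t - x t‖ ^ 2) (Iic a) := by
    refine antitoneOn_of_hasDerivWithinAt_nonpos (convex_Iic a)
      (fun t ht => (hz t ht).continuousWithinAt)
      (fun t ht => (hz t (interior_subset (s := Iic a) ht)).mono interior_subset) fun t _ => ?_
    have := hB (y t - x t)
    rw [inner_neg_right]
    linarith
  have hlim : Tendsto (fun t => ‖y t - x t‖ ^ 2) atBot (𝓝 0) := by
    simpa using (hy0.sub hx0).norm.pow 2
  intro t ht
  have hle : ‖y t - x t‖ ^ 2 ≤ 0 := by
    refine ge_of_tendsto hlim ?_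
    filter_upwards [eventually_le_atBot t] with s hs
    exact hanti (le_trans hs ht) ht hs
  exact sub_eq_zero.mp (norm_eq_zero.mp (pow_eq_zero_iff two_ne_zero |>.mp
    (le_antisymm hle (sq_nonneg _))))

variable [CompleteSpace E]

theorem norm_exp_smul_apply_le (hB : ∀ v, c * ‖v‖ ^ 2 ≤ inner ℝ v (B v)) {r : ℝ} (hr : r ≤ 0)
    (v : E) : ‖NormedSpace.exp (r • B) v‖ ≤ Real.exp (c * r) * ‖v‖ := by
  set f : ℝ → E := fun r => NormedSpace.exp (r • B) v with hf
  have hf' : ∀ r, HasDerivAt f (B (f r)) r := fun r => by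
    simpa [hf] using (hasDerivAt_exp_smul_const' B r).clm_apply (hasDerivAt_const r v)
  have hmono : Monotone fun r => Real.exp (-(2 * c) * r) * ‖f r‖ ^ 2 := by
    refine monotone_of_hasDerivAt_nonneg (fun r =>
      ((((hasDerivAt_id r).const_mul (-(2 * c))).exp).mul (hf' r).norm_sq)) fun r => ?_
    have := mul_nonneg (Real.exp_pos (-(2 * c) * r)).le (sub_nonneg.mpr (hB (f r)))
    simp only [id, Pi.zero_apply]
    linarith
  have h0 : Real.exp (-(2 * c) * r) * ‖f r‖ ^ 2 ≤ ‖v‖ ^ 2 := by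
    simpa [hf] using hmono hr
  refine le_of_sq_le_sq ?_ (by positivity)
  calc ‖f r‖ ^ 2 = Real.exp (c * r) ^ 2 * (Real.exp (-(2 * c) * r) * ‖f r‖ ^ 2) := by
        rw [← mul_assoc, ← Real.exp_nat_mul, ← Real.exp_add]
        ring_nf
        simp
    _ ≤ Real.exp (c * r) ^ 2 * ‖v‖ ^ 2 := by gcongr
    _ = (Real.exp (c * r) * ‖v‖) ^ 2 := by ring

theorem norm_exp_sub_smul_apply_le (hB : ∀ v, c * ‖v‖ ^ 2 ≤ inner ℝ v (B v)) {t K : ℝ}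
    (hK : ∀ s ≤ t, ‖h s‖ ≤ K) {s : ℝ} (hs : s ≤ t) :
    ‖NormedSpace.exp ((s - t) • B) (h s)‖ ≤ Real.exp (c * s) * (Real.exp (-(c * t)) * K) := by
  calc _ ≤ Real.exp (c * (s - t)) * ‖h s‖ := norm_exp_smul_apply_le hB (sub_nonpos.mpr hs) _
    _ ≤ Real.exp (c * (s - t)) * K := by gcongr; exact hK s hs
    _ = _ := by rw [mul_sub, sub_eq_add_neg, Real.exp_add, mul_assoc]

theorem integrableOn_exp_sub_smul_apply (hc : 0 < c) (hB : ∀ v, c * ‖v‖ ^ 2 ≤ inner ℝ v (B v))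
    {t K : ℝ} (hcont : ContinuousOn h (Iic t)) (hK : ∀ s ≤ t, ‖h s‖ ≤ K) :
    IntegrableOn (fun s => NormedSpace.exp ((s - t) • B) (h s)) (Iic t) := by
  refine Integrable.mono' ((integrableOn_exp_mul_Iic hc t).mul_const (Real.exp (-(c * t)) * K))
    (ContinuousOn.aestronglyMeasurable ?_ measurableSet_Iic) ?_
  · exact ((continuous_exp_smul B).comp (by fun_prop : Continuous fun s : ℝ => s - t)
      ).continuousOn.clm_apply hcont
  · filter_upwards [ae_restrict_mem measurableSet_Iic] with s hs
    exact norm_exp_sub_smul_apply_le hB hK hs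

theorem norm_integral_exp_sub_smul_apply_le (hc : 0 < c)
    (hB : ∀ v, c * ‖v‖ ^ 2 ≤ inner ℝ v (B v)) {t K : ℝ} (hK : ∀ s ≤ t, ‖h s‖ ≤ K) :
    ‖∫ s in Iic t, NormedSpace.exp ((s - t) • B) (h s)‖ ≤ K / c := by
  calc _ ≤ ∫ s in Iic t, Real.exp (c * s) * (Real.exp (-(c * t)) * K) := by
        refine norm_integral_le_of_norm_le ((integrableOn_exp_mul_Iic hc t).mul_const _) ?_
        filter_upwards [ae_restrict_mem measurableSet_Iic] with s hs
        exact norm_exp_sub_smul_apply_le hB hK hs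
    _ = K / c := by
        rw [integral_mul_const, integral_exp_mul_Iic hc, Real.exp_neg]
        field_simp

/-- Variation of constants from `-∞`. -/
theorem hasDerivWithinAt_integral_exp_sub_smul_apply (hc : 0 < c)
    (hB : ∀ v, c * ‖v‖ ^ 2 ≤ inner ℝ v (B v)) {a K : ℝ} (hcont : ContinuousOn h (Iic a))
    (hK : ∀ s ≤ a, ‖h s‖ ≤ K) {t : ℝ} (ht : t ≤ a) :
    HasDerivWithinAt (fun t => ∫ s in Iic t, NormedSpace.exp ((s - t) • B) (h s))
      (h t - B (∫ s in Iic t, NormedSpace.exp ((s - t) • B) (h s))) (Iic a) t := by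
  let k : ℝ → E := fun s => h (min s a)
  have hk : Continuous k :=
    hcont.comp_continuous (by fun_prop) fun s => min_le_right s a
  have hkK : ∀ s, ‖k s‖ ≤ K := fun s => hK _ (min_le_right s a)
  have hkh : ∀ s ≤ a, k s = h s := fun s hs => by simp [k, hs]
  let g : ℝ → E := fun s => NormedSpace.exp (s • B) (k s)
  have hg : Continuous g := (continuous_exp_smul B).clm_apply hk
  have hgint : ∀ t, IntegrableOn g (Iic t) := fun t => by
    have := integrableOn_exp_sub_smul_apply hc hB (t := t) hk.continuousOn fun s _ => hkK s
    refine ((NormedSpace.exp (t • B)).integrable_comp this).congr (.of_forall fun s => ?_)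
    simpa [g] using (exp_sub_smul_apply B (s - t) (-t) (k s)).symm
  have hG : HasDerivAt (fun t => ∫ s in Iic t, g s) (g t) t := by
    have heq : (fun t => ∫ s in Iic t, g s)
        = fun t => (∫ s in Iic a, g s) + ∫ s in a..t, g s := by
      funext t
      rw [← intervalIntegral.integral_Iic_sub_Iic (hgint a) (hgint t), add_sub_cancel]
    rw [heq]
    exact (hg.integral_hasStrictDerivAt a t).hasDerivAt.const_add _
  have hx : ∀ t, ∫ s in Iic t, NormedSpace.exp ((s - t) • B) (k s)
      = NormedSpace.exp ((-t) • B) (∫ s in Iic t, g s) := fun t => by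
    rw [← integral_comp_comm _ (hgint t)]
    simp only [g, exp_sub_smul_apply]
  have hxh : ∀ t ≤ a, ∫ s in Iic t, NormedSpace.exp ((s - t) • B) (h s)
      = NormedSpace.exp ((-t) • B) (∫ s in Iic t, g s) := fun t ht => by
    rw [← hx]
    refine setIntegral_congr_fun measurableSet_Iic fun s hs => ?_
    simp only [hkh s (le_trans hs ht)]
  have hE : HasDerivAt (fun t : ℝ => NormedSpace.exp ((-t) • B))
      (-(B * NormedSpace.exp ((-t) • B))) t := by
    simpa [Function.comp_def] using
      (hasDerivAt_exp_smul_const' B (-t)).scomp t (hasDerivAt_neg t)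
  have hmain := (hE.clm_apply hG).hasDerivWithinAt (s := Iic a)
  refine (hmain.congr_of_mem (fun t ht => hxh t ht) ht).congr_deriv ?_
  have hgt : NormedSpace.exp ((-t) • B) (g t) = h t := by
    simp only [g, ← exp_sub_smul_apply, sub_self, zero_smul, NormedSpace.exp_zero, one_apply_eq_self,
      hkh t ht]
  rw [hgt, hxh t ht, neg_apply, mul_apply_eq_comp]
  abel

end ContinuousLinearMap

/-- for a symmetric positive definite matrix `A` and a continuous `h` on
`(−∞,0]` with `(t−1)²|h(t)|` bounded, the function `x(t) = ∫_{−∞}^t e^{−A(t−s)} h(s) ds`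
is well defined, solves `ẋ + Ax = h` on `(−∞,0]`, tends to `0` at `−∞`, satisfies
`sup_{t≤0} (t−1)²|x(t)| < ∞`, and is the unique such solution tending to `0` at `−∞`. -/
theorem linear_ode_decaying_solution
    {d : ℕ} (hd : 1 ≤ d)
    (A : Matrix (Fin d) (Fin d) ℝ) (hAsymm : A.IsSymm) (hApos : A.PosDef)
    (h : ℝ → EuclideanSpace ℝ (Fin d))
    (hcont : ContinuousOn h (Set.Iic 0))
    (hbd : ∃ C : ℝ, ∀ t ≤ (0:ℝ), (t - 1) ^ 2 * ‖h t‖ ≤ C) :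
    (∀ t ≤ (0:ℝ), MeasureTheory.IntegrableOn
      (fun s => (Matrix.toEuclideanLin (NormedSpace.exp ((s - t) • A))) (h s))
      (Set.Iic t)) ∧
    (let x : ℝ → EuclideanSpace ℝ (Fin d) := fun t =>
      ∫ s in Set.Iic t, (Matrix.toEuclideanLin (NormedSpace.exp ((s - t) • A))) (h s)
     (∀ t ≤ (0:ℝ),
        HasDerivWithinAt x (h t - Matrix.toEuclideanLin A (x t)) (Set.Iic 0) t) ∧
     Tendsto x atBot (nhds 0) ∧
     (∃ C : ℝ, ∀ t ≤ (0:ℝ), (t - 1) ^ 2 * ‖x t‖ ≤ C) ∧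
     (∀ y : ℝ → EuclideanSpace ℝ (Fin d),
        (∀ t ≤ (0:ℝ),
          HasDerivWithinAt y (h t - Matrix.toEuclideanLin A (y t)) (Set.Iic 0) t) →
        Tendsto y atBot (nhds 0) →
        Set.EqOn y x (Set.Iic 0))) := by
  obtain ⟨c, hc, hB⟩ := hApos.exists_pos_mul_norm_sq_le_inner
  obtain ⟨C, hC⟩ := hbd
  simp only [Matrix.toEuclideanLin_exp_apply, map_smul]
  set B := Matrix.toEuclideanCLM (n := Fin d) (𝕜 := ℝ) A with hBdef
  have hlin : ∀ v, Matrix.toEuclideanLin A v = B v := fun _ => rfl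
  simp only [hlin]
  have hdecay : ∀ t ≤ (0 : ℝ), ∀ s ≤ t, ‖h s‖ ≤ C / (t - 1) ^ 2 := fun t ht s hs => by
    have h1 : 0 < (t - 1) ^ 2 := by nlinarith
    rw [le_div_iff₀ h1, mul_comm]
    refine le_trans ?_ (hC s (hs.trans ht))
    gcongr ?_ * _
    nlinarith
  have hx := fun t (ht : t ≤ (0 : ℝ)) =>
    ContinuousLinearMap.hasDerivWithinAt_integral_exp_sub_smul_apply hc hB hcont
      (hdecay 0 le_rfl) ht
  have hxbd := fun t (ht : t ≤ (0 : ℝ)) =>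
    ContinuousLinearMap.norm_integral_exp_sub_smul_apply_le hc hB (hdecay t ht)
  have hx0 : Tendsto (fun t => ∫ s in Iic t, NormedSpace.exp ((s - t) • B) (h s)) atBot
      (𝓝 0) := by
    refine squeeze_zero_norm' (a := fun t : ℝ => C / (t - 1) ^ 2 / c) ?_ ?_
    · filter_upwards [eventually_le_atBot 0] with t ht using hxbd t ht
    · have hsq : Tendsto (fun t : ℝ => (t - 1) ^ 2) atBot atTop := by
        have := (tendsto_pow_atTop (α := ℝ) two_ne_zero).comp
          (tendsto_neg_atBot_atTop.comp (tendsto_atBot_add_const_right atBot (-1 : ℝ) tendsto_id))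
        refine this.congr fun t => ?_
        simp only [Function.comp, id]
        ring
      simpa using (hsq.const_div_atTop C).div_const c
  refine ⟨fun t ht => ContinuousLinearMap.integrableOn_exp_sub_smul_apply hc hB
    (hcont.mono (Iic_subset_Iic.mpr ht)) (hdecay t ht), hx, hx0, ⟨C / c, fun t ht => ?_⟩,
    fun y hy hy0 => ContinuousLinearMap.eqOn_of_hasDerivWithinAt_of_tendsto_atBot
      (fun v => (by positivity : 0 ≤ c * ‖v‖ ^ 2).trans (hB v)) hx hy hx0 hy0⟩
  have h1 : 0 < (t - 1) ^ 2 := by nlinarith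
  calc _ ≤ (t - 1) ^ 2 * (C / (t - 1) ^ 2 / c) := by gcongr; exact hxbd t ht
    _ = C / c := by rw [← mul_div_assoc, mul_div_cancel₀ C h1.ne']
end
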